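/- Let F be a finite field with |F| = 2^f (f ≥ 1), let V be an F-vector space with dim_F V = 3n (n ≥ 1), and let O be a pseudo-hyperoval of V. Suppose there exists an irreducible subgroup G of GL(V) that stabilises O and is transitive on O. Then O is elementary: there exists an F-subalgebra K of the F-linear endomorphisms End_F(V) such that K is a field, |K| = (2^f)^n, and k(U) ⊆ U for every k ∈ K and every U ∈ O. -/

import Mathlib

section PartA

structure PHO {V : Type*} [AddCommGroup V] (m : ℕ) (O : Set (AddSubgroup V)) : Prop where
  two : ∀ v : V, v + v = 0
  fin : Finite V
  pos : 1 ≤ m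
  cardV : Nat.card V = 2 ^ (3 * m)
  cardU : ∀ U ∈ O, Nat.card U = 2 ^ m
  ncard : O.ncard = 2 ^ m + 2
  span : ∀ U₁ ∈ O, ∀ U₂ ∈ O, ∀ U₃ ∈ O, U₁ ≠ U₂ → U₁ ≠ U₃ → U₂ ≠ U₃ → U₁ ⊔ U₂ ⊔ U₃ = ⊤

namespace PHO
variable {V : Type*} [AddCommGroup V] {m : ℕ} {O : Set (AddSubgroup V)}

theorem neg_eq (h : PHO m O) (v : V) : -v = v := by
  rw [neg_eq_iff_add_eq_zero]; exact h.two v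

theorem sub_eq (h : PHO m O) (v w : V) : v - w = v + w := by
  rw [sub_eq_add_neg, h.neg_eq]

theorem eq_of_add (h : PHO m O) {v w : V} (e : v + w = 0) : v = w := by
  rw [← sub_eq_zero, h.sub_eq, e]

theorem decomp (h : PHO m O) {U₁ U₂ U₃ : AddSubgroup V} (h1 : U₁ ∈ O) (h2 : U₂ ∈ O) (h3 : U₃ ∈ O)
    (h12 : U₁ ≠ U₂) (h13 : U₁ ≠ U₃) (h23 : U₂ ≠ U₃) (x : V) :
    ∃ a ∈ U₁, ∃ b ∈ U₂, ∃ c ∈ U₃, x = a + b + c := by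
  have hx : x ∈ U₁ ⊔ U₂ ⊔ U₃ := by rw [h.span _ h1 _ h2 _ h3 h12 h13 h23]; trivial
  rw [AddSubgroup.mem_sup] at hx
  obtain ⟨y, hy, c, hc, rfl⟩ := hx
  rw [AddSubgroup.mem_sup] at hy
  obtain ⟨a, ha, b, hb, rfl⟩ := hy
  exact ⟨a, ha, b, hb, c, hc, rfl⟩

theorem indep (h : PHO m O) {U₁ U₂ U₃ : AddSubgroup V} (h1 : U₁ ∈ O) (h2 : U₂ ∈ O) (h3 : U₃ ∈ O)
    (h12 : U₁ ≠ U₂) (h13 : U₁ ≠ U₃) (h23 : U₂ ≠ U₃) {a b c : V} (ha : a ∈ U₁) (hb : b ∈ U₂)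
    (hc : c ∈ U₃) (e : a + b + c = 0) : a = 0 ∧ b = 0 ∧ c = 0 := by
  have := h.fin
  let φ : U₁ × U₂ × U₃ → V := fun p => p.1 + p.2.1 + p.2.2
  have hs : Function.Surjective φ := by
    intro x
    obtain ⟨a, ha, b, hb, c, hc, rfl⟩ := h.decomp h1 h2 h3 h12 h13 h23 x
    exact ⟨(⟨a, ha⟩, ⟨b, hb⟩, ⟨c, hc⟩), rfl⟩
  have hb' : Function.Bijective φ := by
    rw [Nat.bijective_iff_surjective_and_card]
    refine ⟨hs, ?_⟩
    rw [Nat.card_prod, Nat.card_prod, h.cardU _ h1, h.cardU _ h2, h.cardU _ h3, h.cardV]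
    ring
  have := @hb'.1 (⟨a, ha⟩, ⟨b, hb⟩, ⟨c, hc⟩) (0, 0, 0) (by simp [φ, e])
  simpa using this

theorem finO (h : PHO m O) : O.Finite := by
  have := h.ncard
  exact Set.finite_of_ncard_ne_zero (s := O) (by rw [this]; exact Nat.succ_ne_zero _)

theorem exists_third (h : PHO m O) (U U' : AddSubgroup V) : ∃ W ∈ O, W ≠ U ∧ W ≠ U' := by
  by_contra! hc
  have hsub : O ⊆ {U, U'} := by
    intro W hW
    by_cases e : W = U
    · simp [e]
    · simp [hc W hW e]
  have := Set.ncard_le_ncard hsub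
  have h2 : ({U, U'} : Set (AddSubgroup V)).ncard ≤ 2 := by
    have := Set.ncard_insert_le U {U'}
    simpa using this
  have := h.ncard
  have : 0 < 2 ^ m := by positivity
  omega

theorem disj (h : PHO m O) {U U' : AddSubgroup V} (h1 : U ∈ O) (h2 : U' ∈ O) (hne : U ≠ U')
    {v : V} (hv : v ∈ U) (hv' : v ∈ U') : v = 0 := by
  obtain ⟨W, hW, hW1, hW2⟩ := h.exists_third U U'
  exact (h.indep h1 h2 hW hne hW1.symm hW2.symm hv hv' W.zero_mem (by simpa using h.two v)).1

theorem exists_nz (h : PHO m O) {U : AddSubgroup V} (hU : U ∈ O) : ∃ u ∈ U, u ≠ 0 := by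
  have := h.fin
  have h1 := h.cardU U hU
  have : 1 < Nat.card U := by
    rw [h1]; exact Nat.one_lt_two_pow (by have := h.pos; omega)
  rw [Finite.one_lt_card_iff_nontrivial] at this
  obtain ⟨u, hu⟩ := exists_ne (0 : U)
  exact ⟨u, u.2, by simpa using hu⟩

/-- Every vector outside `U` is in the sum of `U` and another member. -/
theorem cover (h : PHO m O) {U : AddSubgroup V} (hU : U ∈ O) {x : V} (hx : x ∉ U) :
    ∃ W ∈ O, W ≠ U ∧ ∃ a ∈ W, ∃ b ∈ U, x = a + b := by
  have := h.fin
  have := h.finO.to_subtype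
  classical
  let S := Σ W : {W // W ∈ O \ {U}}, ({a : W.1 // a ≠ 0} × U)
  let φ : S → {x : V // x ∉ U} := fun p => ⟨(p.2.1.1 : V) + p.2.2, by
    intro hm
    have h1 : (p.2.1.1 : V) ∈ U := by
      have := U.sub_mem hm p.2.2.2
      simpa using this
    exact p.2.1.2 (Subtype.ext (h.disj p.1.2.1 hU p.1.2.2 p.2.1.1.2 h1))⟩
  have hfin1 : Finite {W // W ∈ O \ {U}} := (h.finO.subset Set.sdiff_subset).to_subtype
  have hinj : Function.Injective φ := by
    rintro ⟨⟨W, hW⟩, ⟨⟨a, haW⟩, ha⟩, b⟩ ⟨⟨W', hW'⟩, ⟨⟨a', haW'⟩, ha'⟩, b'⟩ he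
    have he' : a + b = a' + b' := congrArg Subtype.val he
    by_cases e : W = W'
    · subst e
      have h1 : a - a' = b' - b := by rw [sub_eq_sub_iff_add_eq_add, he']; abel
      have h2 := h.disj hW.1 hU hW.2 (W.sub_mem haW haW') (h1 ▸ U.sub_mem b'.2 b.2)
      have h3 : a = a' := sub_eq_zero.1 h2
      subst h3
      have : b = b' := Subtype.ext (add_left_cancel he')
      subst this
      rfl
    · exfalso
      have := h.indep hW.1 hW'.1 hU e hW.2 hW'.2 haW haW' (U.add_mem b.2 b'.2)
        (by
          have : a + a' + ((b : V) + b') = (a + b) + (a' + b') := by abel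
          rw [this, he']; exact h.two _)
      exact ha (Subtype.ext this.1)
  have hcard : Nat.card S = Nat.card {x : V // x ∉ U} := by
    have e1 : ∀ W : {W // W ∈ O \ {U}}, Nat.card ({a : W.1 // a ≠ 0} × U) = (2 ^ m - 1) * 2 ^ m := by
      intro W
      rw [Nat.card_prod, h.cardU _ hU]
      congr 1
      have := Fintype.ofFinite W.1
      rw [← h.cardU _ W.2.1, Nat.card_eq_fintype_card, Nat.card_eq_fintype_card,
        Fintype.card_subtype_compl, Fintype.card_subtype_eq]
    have := Fintype.ofFinite {W // W ∈ O \ {U}}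
    have := Fintype.ofFinite V
    rw [Nat.card_sigma]
    simp only [e1, Finset.sum_const, smul_eq_mul, Finset.card_univ]
    have e2 : Fintype.card {W // W ∈ O \ {U}} = 2 ^ m + 1 := by
      rw [← Nat.card_eq_fintype_card]
      change Nat.card (O \ {U} : Set _) = _
      rw [Nat.card_coe_set_eq, Set.ncard_sdiff_singleton_of_mem hU, h.ncard]; rfl
    have e3 : Nat.card {x : V // x ∉ U} = 2 ^ (3 * m) - 2 ^ m := by
      rw [Nat.card_eq_fintype_card, Fintype.card_subtype_compl, ← Nat.card_eq_fintype_card,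
        ← Nat.card_eq_fintype_card, h.cardV]
      congr 1
      exact h.cardU _ hU
    rw [e2, e3]
    have : 1 ≤ 2 ^ m := Nat.one_le_two_pow
    obtain ⟨t, ht⟩ := Nat.exists_eq_add_of_le this
    rw [pow_mul', ht, Nat.add_sub_cancel_left]
    symm
    apply Nat.sub_eq_of_eq_add
    ring
  have hbij : Function.Bijective φ := (Nat.bijective_iff_injective_and_card φ).2 ⟨hinj, hcard⟩
  obtain ⟨⟨W, a, b⟩, hp⟩ := hbij.2 ⟨x, hx⟩
  exact ⟨W, W.2.1, W.2.2, a.1, a.1.2, b, b.2, (congrArg Subtype.val hp).symm⟩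

end PHO

/-- The ring of additive maps preserving every member. -/
def PHK {V : Type*} [AddCommGroup V] (O : Set (AddSubgroup V)) : Subring (AddMonoid.End V) where
  carrier := {k | ∀ U ∈ O, ∀ u ∈ U, k u ∈ U}
  mul_mem' := fun ha hb U hU u hu => ha U hU _ (hb U hU u hu)
  one_mem' := fun _ _ _ hu => hu
  add_mem' := fun ha hb U hU u hu => U.add_mem (ha U hU u hu) (hb U hU u hu)
  zero_mem' := fun U _ _ _ => U.zero_mem
  neg_mem' := fun ha U hU u hu => U.neg_mem (ha U hU u hu)

namespace PHO
variable {V : Type*} [AddCommGroup V] {m : ℕ} {O : Set (AddSubgroup V)}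

theorem kill_other (h : PHO m O) {k : AddMonoid.End V} (hk : k ∈ PHK O) {U W : AddSubgroup V}
    (hU : U ∈ O) (hW : W ∈ O) (hne : U ≠ W) {u : V} (hu : u ∈ U) (hu0 : u ≠ 0) (hku : k u = 0)
    {w : V} (hw : w ∈ W) : k w = 0 := by
  obtain ⟨J, hJ, hJU, hJW⟩ := h.exists_third U W
  have hn : u + w ∉ J := fun hm => hu0 (h.indep hU hW hJ hne hJU.symm hJW.symm hu hw hm (h.two _)).1
  obtain ⟨P, hP, hPJ, a, ha, b, hb, e⟩ := h.cover hJ hn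
  by_cases hPW : P = W
  · subst hPW
    exfalso
    refine hu0 (h.indep hU hP hJ hne hJU.symm hJW.symm hu (P.add_mem hw ha) hb ?_).1
    rw [← add_assoc, e, add_assoc, add_assoc, add_comm b, add_assoc]
    rw [← add_assoc, h.two, zero_add]; exact h.two _
  · have e2 : k w + k a + k b = 0 := by
      have := congrArg k e
      rw [map_add, map_add, hku, zero_add] at this
      rw [this, add_assoc]; exact h.two _
    exact (h.indep hW hP hJ (Ne.symm hPW) hJW.symm hPJ (hk _ hW _ hw) (hk _ hP _ ha)
      (hk _ hJ _ hb) e2).1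

theorem eq_zero_of_kill (h : PHO m O) {k : AddMonoid.End V} (hk : k ∈ PHK O) {x : V} (hx : x ≠ 0)
    (hkx : k x = 0) : k = 0 := by
  obtain ⟨J, hJ, -⟩ := h.exists_third ⊥ ⊥
  have step : ∃ U ∈ O, ∃ u ∈ U, u ≠ 0 ∧ k u = 0 := by
    by_cases hxJ : x ∈ J
    · exact ⟨J, hJ, x, hxJ, hx, hkx⟩
    · obtain ⟨P, hP, hPJ, a, ha, b, hb, e⟩ := h.cover hJ hxJ
      refine ⟨P, hP, a, ha, ?_, ?_⟩
      · rintro rfl; apply hxJ; rw [e, zero_add]; exact hb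
      · have e2 : k a + k b = 0 := by rw [← map_add, ← e, hkx]
        have e3 : k a = k b := h.eq_of_add e2
        exact h.disj hP hJ hPJ (hk _ hP _ ha) (e3 ▸ hk _ hJ _ hb)
  obtain ⟨U, hU, u, hu, hu0, hku⟩ := step
  have h1 : ∀ W ∈ O, W ≠ U → ∀ w ∈ W, k w = 0 := fun W hW hne w hw =>
    h.kill_other hk hU hW hne.symm hu hu0 hku hw
  obtain ⟨W, hW, hWU, -⟩ := h.exists_third U U
  obtain ⟨W', hW', hW'U, hW'W⟩ := h.exists_third U W
  obtain ⟨w, hw, hw0⟩ := h.exists_nz hW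
  have h2 : ∀ v ∈ U, k v = 0 := fun v hv =>
    h.kill_other hk hW hU hWU hw hw0 (h1 W hW hWU w hw) hv
  ext v
  obtain ⟨a, ha, b, hb, c, hc, rfl⟩ := h.decomp hU hW hW' hWU.symm hW'U.symm hW'W.symm v
  rw [map_add, map_add, h2 a ha, h1 _ hW hWU b hb, h1 _ hW' hW'U c hc]; simp

theorem isField (h : PHO m O) : IsField (PHK O) := by
  have := h.fin
  have : Finite (AddMonoid.End V) := Finite.of_injective (fun k => (k : V → V)) DFunLike.coe_injective
  have hnz : NoZeroDivisors (PHK O) := by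
    constructor
    rintro ⟨a, ha⟩ ⟨b, hb⟩ hab
    have hab' : a * b = 0 := congrArg Subtype.val hab
    by_cases hb0 : b = 0
    · right; exact Subtype.ext hb0
    · left
      have : ∃ v, b v ≠ 0 := by
        by_contra! hc; exact hb0 (by ext v; simpa using hc v)
      obtain ⟨v, hv⟩ := this
      exact Subtype.ext (h.eq_zero_of_kill ha hv (by
        have := DFunLike.congr_fun hab' v
        simpa using this))
  have hnt : Nontrivial (PHK O) := by
    refine ⟨0, 1, ?_⟩
    intro he
    have h0 : (0 : AddMonoid.End V) = 1 := congrArg Subtype.val he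
    obtain ⟨J, hJ, -⟩ := h.exists_third ⊥ ⊥
    obtain ⟨u, -, hu0⟩ := h.exists_nz hJ
    exact hu0 (DFunLike.congr_fun h0 u).symm
  have : IsDomain (PHK O) := NoZeroDivisors.to_isDomain _
  exact Finite.isDomain_to_isField _

theorem card_pow (h : PHO m O) : ∃ e, 2 ^ m = Nat.card (PHK O) ^ e := by
  have := h.fin
  have : Finite (AddMonoid.End V) := Finite.of_injective (fun k => (k : V → V)) DFunLike.coe_injective
  letI : Field (PHK O) := h.isField.toField
  obtain ⟨J, hJ, -⟩ := h.exists_third ⊥ ⊥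
  let JJ : Submodule (PHK O) V :=
    { J with smul_mem' := fun k v hv => k.2 J hJ v hv }
  refine ⟨Module.finrank (PHK O) JJ, ?_⟩
  rw [← Module.natCard_eq_pow_finrank, ← h.cardU J hJ]
  rfl

theorem card_eq (h : PHO m O) (hbig : 2 ^ m < Nat.card (PHK O) ^ 2) : Nat.card (PHK O) = 2 ^ m := by
  obtain ⟨e, he⟩ := h.card_pow
  have hc : 1 ≤ Nat.card (PHK O) := by
    rcases Nat.eq_zero_or_pos (Nat.card (PHK O)) with h0 | h0
    · rw [h0] at hbig; simp at hbig
    · exact h0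
  have hpos := h.pos
  have h2 : 2 ≤ 2 ^ m := by
    calc 2 = 2 ^ 1 := rfl
      _ ≤ 2 ^ m := Nat.pow_le_pow_right (by norm_num) hpos
  rcases e with _ | _ | e
  · simp at he; omega
  · simpa using he.symm
  · exfalso
    have : Nat.card (PHK O) ^ 2 ≤ Nat.card (PHK O) ^ (e + 1 + 1) := Nat.pow_le_pow_right hc (by omega)
    omega

end PHO

end PartA

section PartB

section Zsig
open Polynomial

theorem zsig_order {n r : ℕ} (hn : 0 < n) (hr : r.Prime) (hd : (r : ℤ) ∣ (cyclotomic n ℤ).eval 2) :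
    ∃ a s, n = r ^ a * s ∧ ¬ r ∣ s ∧ orderOf (2 : ZMod r) = s := by
  haveI : Fact r.Prime := ⟨hr⟩
  obtain ⟨a, s, hs, e⟩ := Nat.exists_eq_pow_mul_and_not_dvd hn.ne' r hr.ne_one
  refine ⟨a, s, e, hs, ?_⟩
  have hroot : (cyclotomic (r ^ a * s) (ZMod r)).IsRoot 2 := by
    rw [← e, IsRoot.def]
    have h1 := (ZMod.intCast_zmod_eq_zero_iff_dvd _ r).2 hd
    have h2 := cyclotomic.eval_apply (2 : ℤ) n (Int.castRingHom (ZMod r))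
    simpa [h1] using h2
  haveI : NeZero (s : ZMod r) := ⟨by rwa [Ne, ZMod.natCast_eq_zero_iff]⟩
  rw [isRoot_cyclotomic_prime_pow_mul_iff_of_charP] at hroot
  exact hroot.eq_orderOf.symm

theorem zsig {n : ℕ} (hn : 7 ≤ n) : ∃ r, r.Prime ∧ orderOf (2 : ZMod r) = n := by
  by_contra! hcon
  set M : ℤ := (cyclotomic n ℤ).eval 2 with hM
  have hMR : ((M : ℤ) : ℝ) = (cyclotomic n ℝ).eval 2 := by
    have := cyclotomic.eval_apply (2 : ℤ) n (Int.castRingHom ℝ)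
    simp at this; rw [this]
  have hM1 : 1 < M := by
    have := sub_one_pow_totient_lt_cyclotomic_eval (n := n) (q := 2) (by omega) (by norm_num)
    rw [← hMR] at this
    norm_num at this
    exact_mod_cast this
  obtain ⟨N, hN⟩ : ∃ N : ℕ, M = N := ⟨M.toNat, by omega⟩
  have hN1 : 1 < N := by omega
  have hdiv : ∀ r : ℕ, r.Prime → r ∣ N → r ∣ n ∧ ∃ a s, n = r ^ a * s ∧ ¬ r ∣ s ∧
      orderOf (2 : ZMod r) = s ∧ s < r := by
    intro r hr hrN
    obtain ⟨a, s, e, hs, ho⟩ := zsig_order (n := n) (by omega) hr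
      (by rw [← hM, hN]; exact_mod_cast hrN)
    haveI : Fact r.Prime := ⟨hr⟩
    have ha : a ≠ 0 := by
      rintro rfl
      apply hcon r hr
      rw [ho, e]; simp
    refine ⟨?_, a, s, e, hs, ho, ?_⟩
    · rw [e]; exact Dvd.dvd.mul_right (dvd_pow_self _ ha) _
    · have hs0 : s ≠ 0 := by rintro rfl; simp at hs
      have h2 : (2 : ZMod r) ≠ 0 := by
        intro h0; rw [h0] at ho
        have : orderOf (0 : ZMod r) = 0 := by
          rw [orderOf_eq_zero_iff, isOfFinOrder_iff_pow_eq_one]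
          rintro ⟨k, hk, hk'⟩
          rw [zero_pow hk.ne'] at hk'
          exact zero_ne_one hk'
        omega
      have h3 := ZMod.orderOf_dvd_card_sub_one h2
      rw [ho] at h3
      have := Nat.le_of_dvd (by have := hr.two_le; omega) h3
      have := hr.two_le
      omega
  obtain ⟨r, hr, hrN⟩ := Nat.exists_prime_and_dvd (n := N) (by omega)
  haveI : Fact r.Prime := ⟨hr⟩
  obtain ⟨hrn, a, s, e, hs, ho, hsr⟩ := hdiv r hr hrN
  have huniq : ∀ q : ℕ, q.Prime → q ∣ N → q = r := by
    intro q hq hqN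
    by_contra hne
    obtain ⟨hqn, a', s', e', hs', ho', hsq⟩ := hdiv q hq hqN
    have h1 : q ∣ s := by
      rw [e] at hqn
      rcases (Nat.Prime.dvd_mul hq).1 hqn with h | h
      · exact absurd ((Nat.prime_dvd_prime_iff_eq hq hr).1 (hq.dvd_of_dvd_pow h)) hne
      · exact h
    have h2 : r ∣ s' := by
      rw [e'] at hrn
      rcases (Nat.Prime.dvd_mul hr).1 hrn with h | h
      · exact absurd ((Nat.prime_dvd_prime_iff_eq hr hq).1 (hr.dvd_of_dvd_pow h)).symm hne
      · exact h
    have hs0 : 0 < s := Nat.pos_of_ne_zero (by rintro rfl; simp at hs)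
    have hs0' : 0 < s' := Nat.pos_of_ne_zero (by rintro rfl; simp at hs')
    have := Nat.le_of_dvd hs0 h1
    have := Nat.le_of_dvd hs0' h2
    omega
  -- r is odd
  have hn0 : 0 < n := by omega
  have hs0 : 0 < s := Nat.pos_of_ne_zero (by rintro rfl; simp at hs)
  have hr2 : r ≠ 2 := by
    rintro rfl
    have : (2 : ZMod 2) = 0 := rfl
    rw [this] at ho
    have h0 : orderOf (0 : ZMod 2) = 0 := by
      rw [orderOf_eq_zero_iff, isOfFinOrder_iff_pow_eq_one]
      rintro ⟨k, hk, hk'⟩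
      rw [zero_pow hk.ne'] at hk'
      exact zero_ne_one hk'
    omega
  have hodd : Odd r := hr.odd_of_ne_two hr2
  obtain ⟨d, hd⟩ := hrn
  have hd0 : 0 < d := Nat.pos_of_ne_zero (by rintro rfl; omega)
  obtain ⟨b, rfl⟩ : ∃ b, a = b + 1 := by
    cases a with
    | zero => exact absurd (Dvd.intro d hd.symm) (by rw [e]; simpa using hs)
    | succ b => exact ⟨b, rfl⟩
  have hds : d = r ^ b * s := by
    have : r * d = r * (r ^ b * s) := by rw [← hd, e]; ring
    exact Nat.eq_of_mul_eq_mul_left hr.pos this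
  have h2r : (2 : ZMod r) ≠ 0 := by
    intro h0
    have : r ∣ 2 := (ZMod.natCast_eq_zero_iff 2 r).1 (by exact_mod_cast h0)
    exact hr2 ((Nat.prime_dvd_prime_iff_eq hr Nat.prime_two).1 this)
  have hval : padicValNat r N ≤ 1 := by
    have h1 : (X ^ d - 1) * cyclotomic n ℤ ∣ X ^ n - 1 :=
      X_pow_sub_one_mul_cyclotomic_dvd_X_pow_sub_one_of_dvd ℤ
        (Nat.mem_properDivisors.2 ⟨⟨r, by rw [hd, mul_comm]⟩, by
          rw [hd]; have := hr.two_le; nlinarith⟩)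
    have h2 := map_dvd (evalRingHom (2 : ℤ)) h1
    simp only [map_mul, map_sub, map_pow, coe_evalRingHom, eval_X, map_one, ← hM, hN] at h2
    have h3 : (2 ^ d - 1) * N ∣ 2 ^ n - 1 := by
      zify
      rw [Nat.cast_sub Nat.one_le_two_pow, Nat.cast_sub Nat.one_le_two_pow]
      push_cast; exact h2
    have hy : r ∣ 2 ^ d - 1 := by
      rw [← ZMod.natCast_eq_zero_iff, Nat.cast_sub Nat.one_le_two_pow]
      push_cast
      rw [sub_eq_zero, ← orderOf_dvd_iff_pow_eq_one, ho, hds]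
      exact Dvd.intro_left _ rfl
    have hnd : ¬ r ∣ 2 ^ d := by
      intro h
      exact hr2 ((Nat.prime_dvd_prime_iff_eq hr Nat.prime_two).1 (hr.dvd_of_dvd_pow h))
    have hlt : 1 < 2 ^ d := Nat.one_lt_two_pow hd0.ne'
    have hL := padicValNat.pow_sub_pow (p := r) hodd (x := 2 ^ d) (y := 1) hlt hy hnd (n := r) hr.ne_zero
    rw [padicValNat_self, one_pow, ← pow_mul, mul_comm d r, ← hd] at hL
    have hne : 2 ^ n - 1 ≠ 0 := by
      have := Nat.one_lt_two_pow (n := n) hn0.ne'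
      omega
    have h4 := (padicValNat_dvd_iff_le (p := r) hne (n := padicValNat r ((2 ^ d - 1) * N))).1
      (pow_padicValNat_dvd.trans h3)
    rw [padicValNat.mul (by omega) (by omega)] at h4
    omega
  have hNr : N = r := by
    have h1 : N = r ^ padicValNat r N := by
      have := Nat.eq_prime_pow_of_unique_prime_dvd (n := N) (p := r) (by omega) (fun {q} hq hqN => huniq q hq hqN)
      rw [this]
      congr 1
      rw [padicValNat.prime_pow]
    interval_cases hv : padicValNat r N
    · simp at h1; omega
    · simpa using h1
  have hr3 : 3 ≤ r := by have := hr.two_le; omega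
  have h2r' : ∀ r : ℕ, 3 ≤ r → r + 1 < 2 ^ r := by
    intro r hr
    induction r, hr using Nat.le_induction with
    | base => norm_num
    | succ k hk ih => rw [pow_succ]; omega
  have hR2 : (1 : ℝ) < 2 ^ r := by
    have := h2r' r hr3
    have h3 : ((r + 1 : ℕ) : ℝ) < ((2 ^ r : ℕ) : ℝ) := by exact_mod_cast this
    push_cast at h3
    have : (0:ℝ) ≤ r := by positivity
    linarith
  have hMr : (cyclotomic n ℝ).eval 2 = r := by rw [← hMR, hN, hNr]; simp
  have hnd' : n = d * r := by rw [hd, mul_comm]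
  have hlow := sub_one_pow_totient_le_cyclotomic_eval hR2
  by_cases hrd : r ∣ d
  · have h1 := congrArg (eval (2 : ℝ)) (cyclotomic_expand_eq_cyclotomic hr hrd ℝ)
    rw [expand_eval, ← hnd', hMr] at h1
    have h2 := hlow d
    rw [h1] at h2
    have h3 : (2 : ℝ) ^ r - 1 ≤ (2 ^ r - 1) ^ (Nat.totient d) := by
      apply le_self_pow₀ _ (Nat.totient_pos.2 hd0).ne'
      have := h2r' r hr3
      have h3 : ((r + 1 : ℕ) : ℝ) < ((2 ^ r : ℕ) : ℝ) := by exact_mod_cast this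
      push_cast at h3
      have : (3:ℝ) ≤ r := by exact_mod_cast hr3
      linarith
    have := h2r' r hr3
    have h4 : ((r + 1 : ℕ) : ℝ) < ((2 ^ r : ℕ) : ℝ) := by exact_mod_cast this
    push_cast at h4
    linarith
  · have hb : b = 0 := by
      by_contra hb
      exact hrd (by rw [hds]; exact Dvd.dvd.mul_right (dvd_pow_self _ hb) _)
    subst hb
    simp at hds
    subst hds
    have h5 : 5 ≤ r := by
      have h4 : r ≠ 4 := by rintro rfl; revert hr; norm_num
      have h3 : r ≠ 3 := by
        rintro rfl
        have : d ≤ 2 := by omega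
        omega
      omega
    have h1 := congrArg (eval (2 : ℝ)) (cyclotomic_expand_eq_cyclotomic_mul hr hrd ℝ)
    rw [expand_eval, ← hnd', eval_mul, hMr] at h1
    have h2 := hlow d
    have hup := cyclotomic_eval_le_add_one_pow_totient (q := 2) (by norm_num) d
    rw [h1] at h2
    have h6 : ∀ r : ℕ, 5 ≤ r → 3 * r + 1 < 2 ^ r := by
      intro r hr
      induction r, hr using Nat.le_induction with
      | base => norm_num
      | succ k hk ih => rw [pow_succ]; omega
    have h7 : ((3 * r + 1 : ℕ) : ℝ) < ((2 ^ r : ℕ) : ℝ) := by exact_mod_cast h6 r h5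
    push_cast at h7
    have hφ : d.totient ≠ 0 := (Nat.totient_pos.2 hd0).ne'
    have hr1 : (1 : ℝ) ≤ r := by exact_mod_cast hr.one_lt.le
    have h8 : (r : ℝ) * 3 ^ d.totient ≤ (3 * r) ^ d.totient := by
      rw [mul_pow, mul_comm]
      gcongr
      exact le_self_pow₀ hr1 hφ
    have h9 : (3 * (r : ℝ)) ^ d.totient < (2 ^ r - 1) ^ d.totient := by
      apply pow_lt_pow_left₀ (by linarith) (by positivity) hφ
    have h10 : (r : ℝ) * eval 2 (cyclotomic d ℝ) ≤ r * 3 ^ d.totient := by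
      gcongr
      norm_num at hup
      exact hup
    linarith
end Zsig

end PartB

section PartC

open scoped Pointwise

namespace PHO
variable {V : Type*} [AddCommGroup V] {m : ℕ} {O : Set (AddSubgroup V)}
variable {G : Type*} [Group G] [DistribMulAction G V]

theorem smul_eq_of_sq {α : Type*} [MulAction G α] {g : G} (hg : Odd (orderOf g)) {x : α}
    (h : g • g • x = x) : g • x = x := by
  obtain ⟨k, hk⟩ := hg
  have h2 : g ^ 2 ∈ MulAction.stabilizer G x := by
    rw [MulAction.mem_stabilizer_iff, pow_two, mul_smul, h]
  have h3 : g = (g ^ 2) ^ (k + 1) := by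
    rw [← pow_mul, show 2 * (k + 1) = orderOf g + 1 by omega, pow_succ, pow_orderOf_eq_one, one_mul]
  have h4 : g ∈ MulAction.stabilizer G x := by
    rw [h3]; exact Subgroup.pow_mem _ h2 _
  exact h4

theorem three_distinct {α : Type*} [MulAction G α] {g : G} (hg : Odd (orderOf g)) {x : α}
    (h : g • x ≠ x) : x ≠ g • x ∧ x ≠ g • g • x ∧ g • x ≠ g • g • x :=
  ⟨h.symm, fun e => h (smul_eq_of_sq hg e.symm), fun e => h (smul_left_cancel g e).symm⟩

theorem card_fixed_le (h : PHO m O) [Finite G] (hodd : Odd (Nat.card G))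
    (hst : ∀ g : G, ∀ U ∈ O, g • U ∈ O) {U : AddSubgroup V} (hU : U ∈ O) {a b : G}
    (h1 : U ≠ a • U) (h2 : U ≠ b • U) (h3 : a • U ≠ b • U) :
    Nat.card (MulAction.fixedPoints G V) ≤ 2 ^ m := by
  have := h.fin
  have := Fintype.ofFinite G
  let e : V → V := fun v => ∑ g : G, g • v
  have hadd : ∀ v w, e (v + w) = e v + e w := by
    intro v w; simp [e, Finset.sum_add_distrib]
  have hsm : ∀ (g : G) v, e (g • v) = e v := by
    intro g v
    simp only [e, ← mul_smul]
    exact Fintype.sum_equiv (Equiv.mulRight g) _ _ (fun _ => rfl)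
  have hfix : ∀ v ∈ MulAction.fixedPoints G V, e v = v := by
    intro v hv
    have : e v = ∑ g : G, v := Finset.sum_congr rfl (fun g _ => hv g)
    rw [this, Finset.sum_const, Finset.card_univ, ← Nat.card_eq_fintype_card]
    obtain ⟨k, hk⟩ := hodd
    rw [hk, add_smul, mul_comm, mul_smul, two_smul, h.two, smul_zero, zero_add, one_smul]
  have hsurj : ∀ v : MulAction.fixedPoints G V, ∃ u : U, e u = v := by
    intro ⟨v, hv⟩
    obtain ⟨x, hx, y, hy, w, hw, rfl⟩ := h.decomp hU (hst a U hU) (hst b U hU) h1 h2 h3 v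
    rw [AddSubgroup.mem_smul_pointwise_iff_exists] at hy hw
    obtain ⟨y, hy, rfl⟩ := hy
    obtain ⟨w, hw, rfl⟩ := hw
    refine ⟨⟨x + y + w, U.add_mem (U.add_mem hx hy) hw⟩, ?_⟩
    change e (x + y + w) = _
    refine Eq.trans ?_ (hfix _ hv)
    simp only [hadd, hsm]
  choose f hf using hsurj
  rw [← h.cardU U hU]
  refine Nat.card_le_card_of_injective f ?_
  intro v w hvw
  apply Subtype.ext
  rw [← hf v, ← hf w, hvw]

theorem finG (h : PHO m O) [FaithfulSMul G V] : Finite G := by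
  have := h.fin
  exact Finite.of_injective (fun g : G => (fun v : V => g • v))
    (fun a b hab => FaithfulSMul.eq_of_smul_eq_smul (α := V) (fun v => congrFun hab v))

theorem orbit_eq (hst : ∀ g : G, ∀ U ∈ O, g • U ∈ O)
    (htr : ∀ U ∈ O, ∀ U' ∈ O, ∃ g : G, g • U = U') {U : AddSubgroup V} (hU : U ∈ O) :
    MulAction.orbit G U = O := by
  ext W
  constructor
  · rintro ⟨g, rfl⟩; exact hst g U hU
  · intro hW
    obtain ⟨g, hg⟩ := htr U hU W hW
    exact ⟨g, hg⟩

theorem odd_orderOf_of_isPGroup {p : ℕ} (hp : p.Prime) (hp2 : p ≠ 2) (hG : IsPGroup p G) (g : G) :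
    Odd (orderOf g) := by
  haveI : Fact p.Prime := ⟨hp⟩
  obtain ⟨k, hk⟩ := (IsPGroup.iff_orderOf.1 hG) g
  rw [hk]
  exact (hp.odd_of_ne_two hp2).pow

theorem odd_card_of_isPGroup {p : ℕ} (hp : p.Prime) (hp2 : p ≠ 2) [Finite G] (hG : IsPGroup p G) :
    Odd (Nat.card G) := by
  haveI : Fact p.Prime := ⟨hp⟩
  obtain ⟨k, hk⟩ := (IsPGroup.iff_card.1 hG)
  rw [hk]
  exact (hp.odd_of_ne_two hp2).pow

theorem big_false (h : PHO m O) [FaithfulSMul G V] (hm : 5 ≤ m)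
    (hst : ∀ g : G, ∀ U ∈ O, g • U ∈ O)
    (htr : ∀ U ∈ O, ∀ U' ∈ O, ∃ g : G, g • U = U') : False := by
  have := h.finG (G := G)
  have := h.fin
  obtain ⟨r, hr, ho⟩ := zsig (n := 2 * (m - 1)) (by omega)
  haveI : Fact r.Prime := ⟨hr⟩
  have hr2 : r ≠ 2 := by
    rintro rfl
    have h0 : orderOf (2 : ZMod 2) = 0 := by
      have : (2 : ZMod 2) = 0 := rfl
      rw [this, orderOf_eq_zero_iff, isOfFinOrder_iff_pow_eq_one]
      rintro ⟨k, hk, hk'⟩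
      rw [zero_pow hk.ne'] at hk'
      exact zero_ne_one hk'
    omega
  have hdiv : r ∣ 2 ^ m + 2 := by
    have h1 : (2 : ZMod r) ^ (m - 1) ≠ 1 := by
      intro h1
      have := orderOf_dvd_of_pow_eq_one h1
      rw [ho] at this
      have := Nat.le_of_dvd (by omega) this
      omega
    have h2 : ((2 : ZMod r) ^ (m - 1) - 1) * (2 ^ (m - 1) + 1) = 0 := by
      have : (2 : ZMod r) ^ (2 * (m - 1)) = 1 := by rw [← ho]; exact pow_orderOf_eq_one _
      rw [mul_comm 2, pow_mul] at this
      linear_combination this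
    have h3 : (2 : ZMod r) ^ (m - 1) + 1 = 0 :=
      (mul_eq_zero.1 h2).resolve_left (sub_ne_zero.2 h1)
    rw [← ZMod.natCast_eq_zero_iff]
    push_cast
    obtain ⟨k, rfl⟩ : ∃ k, m = k + 1 := ⟨m - 1, by omega⟩
    simp only [Nat.add_sub_cancel] at h3
    linear_combination 2 * h3
  obtain ⟨U, hU, -⟩ := h.exists_third ⊥ ⊥
  obtain ⟨P⟩ : Nonempty (Sylow r G) := inferInstance
  have hnot : ¬ (P : Subgroup G) ≤ MulAction.stabilizer G U := by
    intro hle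
    have h1 := Subgroup.index_dvd_of_le hle
    rw [MulAction.index_stabilizer, orbit_eq hst htr hU, h.ncard] at h1
    exact P.not_dvd_index (hdiv.trans h1)
  obtain ⟨a, haP, haU⟩ := SetLike.not_le_iff_exists.1 hnot
  have haU' : a • U ≠ U := haU
  have hPp : IsPGroup r P := P.2
  let a' : P := ⟨a, haP⟩
  have hoa : Odd (orderOf a') := odd_orderOf_of_isPGroup hr hr2 hPp a'
  have haU2 : a' • U ≠ U := haU'
  obtain ⟨d1, d2, d3⟩ := three_distinct hoa haU2
  have hfix := h.card_fixed_le (G := P) (odd_card_of_isPGroup hr hr2 hPp)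
    (fun g U hU => hst g U hU) hU (a := a') (b := a' * a') d1
    (fun e => d2 (e.trans (mul_smul a' a' U))) (fun e => d3 (e.trans (mul_smul a' a' U)))
  have hmod := hPp.card_modEq_card_fixedPoints V
  obtain ⟨c, hc, hcc⟩ : ∃ c ≤ 3 * m, Nat.card (MulAction.fixedPoints P V) = 2 ^ c := by
    rw [← Nat.dvd_prime_pow Nat.prime_two, ← h.cardV]
    exact AddSubgroup.card_addSubgroup_dvd_card (FixedPoints.addSubgroup P V)
  rw [hcc] at hfix hmod
  have hcm : c ≤ m := (Nat.pow_le_pow_iff_right (by norm_num)).1 hfix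
  rw [h.cardV, ← ZMod.natCast_eq_natCast_iff] at hmod
  push_cast at hmod
  have h2r : (2 : ZMod r) ≠ 0 := by
    intro h0
    have : r ∣ 2 := (ZMod.natCast_eq_zero_iff 2 r).1 (by exact_mod_cast h0)
    exact hr2 ((Nat.prime_dvd_prime_iff_eq hr Nat.prime_two).1 this)
  have h1 : (2 : ZMod r) ^ (3 * m - c) = 1 := by
    have : (2 : ZMod r) ^ (3 * m - c) * 2 ^ c = 1 * 2 ^ c := by
      rw [← pow_add, Nat.sub_add_cancel hc, hmod, one_mul]
    exact mul_right_cancel₀ (pow_ne_zero _ h2r) this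
  obtain ⟨t, ht⟩ := orderOf_dvd_of_pow_eq_one h1
  rw [ho] at ht
  rcases t with _ | _ | t
  · omega
  · omega
  · have : 2 * (m - 1) * (t + 1 + 1) = 2 * (m - 1) * t + 4 * (m - 1) := by ring
    have : 0 ≤ 2 * (m - 1) * t := Nat.zero_le _
    omega

end PHO

end PartC

section PartD

theorem ph_graph {X : Type*} [AddCommGroup X] [Finite X] (T : AddSubgroup (X × X × X))
    (hc : Nat.card T = Nat.card X) (h0 : ∀ y w, ((0, y, w) : X × X × X) ∈ T → y = 0 ∧ w = 0) :
    ∃ A B : AddMonoid.End X, ∀ x y w, ((x, y, w) : X × X × X) ∈ T ↔ y = A x ∧ w = B x := by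
  let π : T →+ X := (AddMonoidHom.fst X (X × X)).comp T.subtype
  have hinj : Function.Injective π := by
    rw [injective_iff_map_eq_zero]
    rintro ⟨⟨x, y, w⟩, ht⟩ h
    have hx : x = 0 := h
    subst hx
    obtain ⟨rfl, rfl⟩ := h0 _ _ ht
    rfl
  have hbij : Function.Bijective π := (Nat.bijective_iff_injective_and_card _).2 ⟨hinj, hc⟩
  let e : T ≃+ X := AddEquiv.ofBijective π hbij
  let σ : X →+ X × X × X := T.subtype.comp e.symm.toAddMonoidHom
  have hσT : ∀ x, σ x ∈ T := fun x => (e.symm x).2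
  have hσ1 : ∀ x, (σ x).1 = x := fun x => e.apply_symm_apply x
  refine ⟨(AddMonoidHom.fst X X).comp ((AddMonoidHom.snd X (X × X)).comp σ),
    (AddMonoidHom.snd X X).comp ((AddMonoidHom.snd X (X × X)).comp σ), ?_⟩
  intro x y w
  constructor
  · intro h
    have h1 := T.sub_mem h (hσT x)
    have h2 : ((x, y, w) : X × X × X) - σ x = (0, y - (σ x).2.1, w - (σ x).2.2) := by
      ext <;> simp [hσ1]
    rw [h2] at h1
    obtain ⟨h3, h4⟩ := h0 _ _ h1
    exact ⟨sub_eq_zero.1 h3, sub_eq_zero.1 h4⟩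
  · rintro ⟨rfl, rfl⟩
    have : ((x, (σ x).2.1, (σ x).2.2) : X × X × X) = σ x := by ext <;> simp [hσ1]
    have h2 := hσT x
    rw [← this] at h2
    exact h2

namespace PHO
variable {V : Type*} [AddCommGroup V] {m : ℕ} {O : Set (AddSubgroup V)}

theorem exists_avoid (h : PHO m O) (L : Finset (AddSubgroup V)) (hL : L.card < 2 ^ m + 2) :
    ∃ W ∈ O, W ∉ L := by
  by_contra! hc
  have hsub : O ⊆ (L : Set (AddSubgroup V)) := fun W hW => hc W hW
  have := Set.ncard_le_ncard hsub
  rw [h.ncard, Set.ncard_coe_finset] at this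
  omega

/-- projection onto the first of three members -/
theorem exists_proj (h : PHO m O) {U₁ U₂ U₃ : AddSubgroup V} (h1 : U₁ ∈ O) (h2 : U₂ ∈ O)
    (h3 : U₃ ∈ O) (h12 : U₁ ≠ U₂) (h13 : U₁ ≠ U₃) (h23 : U₂ ≠ U₃) :
    ∃ p q r : V →+ V, (∀ v, p v ∈ U₁) ∧ (∀ v, q v ∈ U₂) ∧ (∀ v, r v ∈ U₃) ∧
      ∀ v, v = p v + q v + r v := by
  choose p hp q hq r hr e using h.decomp h1 h2 h3 h12 h13 h23
  have key : ∀ v w, (p (v + w) = p v + p w ∧ q (v + w) = q v + q w ∧ r (v + w) = r v + r w) := by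
    intro v w
    have := h.indep h1 h2 h3 h12 h13 h23 (U₁.add_mem (hp (v + w)) (U₁.add_mem (hp v) (hp w)))
      (U₂.add_mem (hq (v + w)) (U₂.add_mem (hq v) (hq w)))
      (U₃.add_mem (hr (v + w)) (U₃.add_mem (hr v) (hr w))) (by
        have e1 : p (v + w) + (p v + p w) + (q (v + w) + (q v + q w)) + (r (v + w) + (r v + r w))
          = (p (v + w) + q (v + w) + r (v + w)) + ((p v + q v + r v) + (p w + q w + r w)) := by abel
        rw [e1, ← e, ← e, ← e]
        exact h.two _)
    exact ⟨h.eq_of_add this.1, h.eq_of_add this.2.1, h.eq_of_add this.2.2⟩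
  exact ⟨AddMonoidHom.mk' p (fun v w => (key v w).1), AddMonoidHom.mk' q (fun v w => (key v w).2.1),
    AddMonoidHom.mk' r (fun v w => (key v w).2.2), hp, hq, hr, e⟩

theorem coords (h : PHO m O) :
    ∃ (X : AddSubgroup V) (Φ : (X × X × X) ≃+ V) (S : Set (AddMonoid.End X × AddMonoid.End X)),
      Nat.card X = 2 ^ m ∧ ((1, 1) ∈ S) ∧
      (∀ P ∈ S, (∀ x, P.1 x = 0 → x = 0) ∧ (∀ x, P.2 x = 0 → x = 0)) ∧
      (∀ P ∈ S, ∀ Q ∈ S, P ≠ Q → (∀ x, P.1 x = Q.1 x → x = 0) ∧ (∀ x, P.2 x = Q.2 x → x = 0) ∧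
        (∀ x y, P.1 x = Q.1 y → P.2 x = Q.2 y → x = 0)) ∧
      (∀ L : Finset (AddMonoid.End X × AddMonoid.End X), L.card + 3 < 2 ^ m + 2 →
        ∃ P ∈ S, P ∉ L) ∧
      (∀ k : AddMonoid.End X, (∀ P ∈ S, P.1 * k = k * P.1 ∧ P.2 * k = k * P.2) →
        ∃ κ ∈ PHK O, ∀ x y w, κ (Φ (x, y, w)) = Φ (k x, k y, k w)) := by
  classical
  have := h.fin
  have hm1 : 2 ≤ 2 ^ m := by
    calc 2 = 2 ^ 1 := rfl
      _ ≤ 2 ^ m := Nat.pow_le_pow_right (by norm_num) h.pos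
  obtain ⟨U₁, h1, -⟩ := h.exists_avoid ∅ (by simp)
  obtain ⟨U₂, h2, n2⟩ := h.exists_avoid {U₁} (by simp)
  obtain ⟨U₃, h3, n3⟩ := h.exists_avoid {U₁, U₂} (by
    have := Finset.card_le_two (a := U₁) (b := U₂); omega)
  obtain ⟨X, hX, n4⟩ := h.exists_avoid {U₁, U₂, U₃} (by
    have := Finset.card_le_three (a := U₁) (b := U₂) (c := U₃); omega)
  simp only [Finset.mem_insert, Finset.mem_singleton, not_or] at n2 n3 n4
  have n12 : U₁ ≠ U₂ := fun e => n2 e.symm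
  have n13 : U₁ ≠ U₃ := fun e => n3.1 e.symm
  have n23 : U₂ ≠ U₃ := fun e => n3.2 e.symm
  obtain ⟨p, q, r, hp, hq, hr, e⟩ := h.exists_proj h1 h2 h3 n12 n13 n23
  have uniq : ∀ {a b c : V}, a ∈ U₁ → b ∈ U₂ → c ∈ U₃ → p (a + b + c) = a ∧ q (a + b + c) = b ∧
      r (a + b + c) = c := by
    intro a b c ha hb hc
    have := h.indep h1 h2 h3 n12 n13 n23 (U₁.add_mem (hp (a + b + c)) ha)
      (U₂.add_mem (hq (a + b + c)) hb) (U₃.add_mem (hr (a + b + c)) hc) (by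
        have e1 : p (a + b + c) + a + (q (a + b + c) + b) + (r (a + b + c) + c) =
          (p (a + b + c) + q (a + b + c) + r (a + b + c)) + (a + b + c) := by abel
        rw [e1, ← e]; exact h.two _)
    exact ⟨h.eq_of_add this.1, h.eq_of_add this.2.1, h.eq_of_add this.2.2⟩
  have uniq0 : ∀ {a b c : V}, a ∈ U₁ → b ∈ U₂ → c ∈ U₃ → a + b + c = 0 → a = 0 ∧ b = 0 ∧ c = 0 :=
    fun ha hb hc he => h.indep h1 h2 h3 n12 n13 n23 ha hb hc he
  -- projections are injective on members other than the frame
  have pin : ∀ T ∈ O, T ≠ U₂ → T ≠ U₃ → ∀ t ∈ T, p t = 0 → t = 0 := by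
    intro T hT t2 t3 t ht h0
    have := h.indep hT h2 h3 t2 t3 n23 ht (hq t) (hr t) (by
      have := e t; rw [h0, zero_add] at this
      rw [add_assoc, ← this]; exact h.two _)
    exact this.1
  have qin : ∀ T ∈ O, T ≠ U₁ → T ≠ U₃ → ∀ t ∈ T, q t = 0 → t = 0 := by
    intro T hT t2 t3 t ht h0
    have := h.indep hT h1 h3 t2 t3 n13 ht (hp t) (hr t) (by
      have := e t; rw [h0, add_zero] at this
      rw [add_assoc, ← this]; exact h.two _)
    exact this.1
  have rin : ∀ T ∈ O, T ≠ U₁ → T ≠ U₂ → ∀ t ∈ T, r t = 0 → t = 0 := by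
    intro T hT t2 t3 t ht h0
    have := h.indep hT h1 h2 t2 t3 n12 ht (hp t) (hq t) (by
      have := e t; rw [h0, add_zero] at this
      rw [add_assoc, ← this]; exact h.two _)
    exact this.1
  let φ : (X × X × X) →+ V := AddMonoidHom.mk' (fun t => p t.1 + q t.2.1 + r t.2.2) (by
    intro s t
    simp only [Prod.fst_add, Prod.snd_add, AddSubgroup.coe_add, map_add]
    abel)
  have hφ : ∀ x y w : X, φ (x, y, w) = p x + q y + r w := fun _ _ _ => rfl
  have hφi : Function.Injective φ := by
    rw [injective_iff_map_eq_zero]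
    rintro ⟨x, y, w⟩ h0
    rw [hφ] at h0
    obtain ⟨a, b, c⟩ := uniq0 (hp _) (hq _) (hr _) h0
    have a1 := pin X hX n4.2.1 n4.2.2 x x.2 a
    have a2 := qin X hX n4.1 n4.2.2 y y.2 b
    have a3 := rin X hX n4.1 n4.2.1 w w.2 c
    ext
    · exact a1
    · exact a2
    · exact a3
  have hφb : Function.Bijective φ := (Nat.bijective_iff_injective_and_card _).2 ⟨hφi, by
    rw [Nat.card_prod, Nat.card_prod, h.cardU _ hX, h.cardV]; ring⟩
  let Φ : (X × X × X) ≃+ V := AddEquiv.ofBijective φ hφb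
  have hΦ : ∀ x y w : X, Φ (x, y, w) = p x + q y + r w := fun _ _ _ => rfl
  have hpΦ : ∀ x y w : X, p (Φ (x, y, w)) = p x := fun x y w => by
    rw [hΦ]; exact (uniq (hp _) (hq _) (hr _)).1
  let S : Set (AddMonoid.End X × AddMonoid.End X) := {P | ∃ T ∈ O, ∀ x y w,
    Φ (x, y, w) ∈ T ↔ y = P.1 x ∧ w = P.2 x}
  have hgraph : ∀ T ∈ O, T ≠ U₂ → T ≠ U₃ → ∃ A B : AddMonoid.End X, ∀ x y w,
      Φ (x, y, w) ∈ T ↔ y = A x ∧ w = B x := by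
    intro T hT t2 t3
    have hcT : Nat.card (T.comap Φ.toAddMonoidHom) = Nat.card X := by
      rw [h.cardU X hX, ← h.cardU T hT]
      refine Nat.card_congr (Equiv.subtypeEquiv Φ.toEquiv ?_)
      intro a; exact Iff.rfl
    exact ph_graph (T.comap Φ.toAddMonoidHom) hcT (by
      intro y w hyw
      have hyw' : Φ (0, y, w) ∈ T := hyw
      have := pin T hT t2 t3 _ hyw' (by rw [hpΦ]; simp)
      have h5 : ((0, y, w) : X × X × X) = 0 := by
        apply Φ.injective; rw [this, map_zero]
      simpa using h5)
  -- members on the axes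
  have hU1 : ∀ x : X, Φ (x, 0, 0) ∈ U₁ := fun x => by rw [hΦ]; simpa using hp x
  have hU2 : ∀ x : X, Φ (0, x, 0) ∈ U₂ := fun x => by rw [hΦ]; simpa using hq x
  have hU3 : ∀ x : X, Φ (0, 0, x) ∈ U₃ := fun x => by rw [hΦ]; simpa using hr x
  have hnzX : ∃ x : X, x ≠ 0 := by
    obtain ⟨u, hu, hu0⟩ := h.exists_nz hX
    exact ⟨⟨u, hu⟩, by simpa using hu0⟩
  obtain ⟨x₀, hx₀⟩ := hnzX
  have neAx : ∀ (T : AddSubgroup V) (P : AddMonoid.End X × AddMonoid.End X), (∀ x y w,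
      Φ (x, y, w) ∈ T ↔ y = P.1 x ∧ w = P.2 x) → T ≠ U₂ ∧ T ≠ U₃ := by
    intro T P hP
    constructor
    · rintro rfl
      have := ((hP _ _ _).1 (hU2 x₀)).1
      simp at this; exact hx₀ this
    · rintro rfl
      have := ((hP _ _ _).1 (hU3 x₀)).2
      simp at this; exact hx₀ this
  refine ⟨X, Φ, insert (1, 1) {P | P ∈ S ∧ P ≠ 0}, h.cardU X hX, Set.mem_insert _ _, ?_⟩
  have h11 : ((1, 1) : AddMonoid.End X × AddMonoid.End X) ∈ S := by
    refine ⟨X, hX, ?_⟩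
    obtain ⟨A, B, hAB⟩ := hgraph X hX n4.2.1 n4.2.2
    have : ∀ x : X, Φ (x, x, x) ∈ X := fun x => by rw [hΦ, ← e]; exact x.2
    have h7 : ∀ x, x = A x ∧ x = B x := fun x => (hAB _ _ _).1 (this x)
    intro x y w
    rw [hAB, ← (h7 x).1, ← (h7 x).2]; rfl
  have h10 : ((1, 1) : AddMonoid.End X × AddMonoid.End X) ≠ 0 := by
    intro h0
    have := congrArg Prod.fst h0
    exact hx₀ (DFunLike.congr_fun this x₀)
  have hins : insert (1, 1) {P | P ∈ S ∧ P ≠ 0} = {P | P ∈ S ∧ P ≠ 0} :=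
    Set.insert_eq_of_mem ⟨h11, h10⟩
  rw [hins]
  have ne1 : ∀ (T : AddSubgroup V) (P : AddMonoid.End X × AddMonoid.End X), P ≠ 0 → (∀ x y w,
      Φ (x, y, w) ∈ T ↔ y = P.1 x ∧ w = P.2 x) → T ≠ U₁ := by
    rintro T P hP0 hP rfl
    apply hP0
    have : ∀ x, 0 = P.1 x ∧ 0 = P.2 x := fun x => (hP _ _ _).1 (hU1 x)
    ext x
    · simp [← (this x).1]
    · simp [← (this x).2]
  refine ⟨?_, ?_, ?_, ?_⟩
  · rintro P ⟨⟨T, hT, hTP⟩, hP0⟩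
    have t1 := ne1 T P hP0 hTP
    obtain ⟨t2, t3⟩ := neAx T P hTP
    constructor
    · intro x hx
      have h5 : Φ (x, P.1 x, P.2 x) ∈ T := (hTP _ _ _).2 ⟨rfl, rfl⟩
      have := qin T hT t1 t3 _ h5 (by rw [hΦ, (uniq (hp _) (hq _) (hr _)).2.1, hx]; simp)
      have h6 : ((x, P.1 x, P.2 x) : X × X × X) = 0 := by
        apply Φ.injective; rw [this, map_zero]
      exact congrArg Prod.fst h6
    · intro x hx
      have h5 : Φ (x, P.1 x, P.2 x) ∈ T := (hTP _ _ _).2 ⟨rfl, rfl⟩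
      have := rin T hT t1 t2 _ h5 (by rw [hΦ, (uniq (hp _) (hq _) (hr _)).2.2, hx]; simp)
      have h6 : ((x, P.1 x, P.2 x) : X × X × X) = 0 := by
        apply Φ.injective; rw [this, map_zero]
      exact congrArg Prod.fst h6
  · rintro P ⟨⟨T, hT, hTP⟩, hP0⟩ Q ⟨⟨T', hT', hTQ⟩, hQ0⟩ hne
    have t1 := ne1 T P hP0 hTP
    obtain ⟨t2, t3⟩ := neAx T P hTP
    have t1' := ne1 T' Q hQ0 hTQ
    obtain ⟨t2', t3'⟩ := neAx T' Q hTQ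
    have hTT : T ≠ T' := by
      rintro rfl
      apply hne
      have : ∀ x, P.1 x = Q.1 x ∧ P.2 x = Q.2 x := fun x => (hTQ _ _ _).1 ((hTP _ _ _).2 ⟨rfl, rfl⟩)
      apply Prod.ext
      · apply DFunLike.ext; exact fun x => (this x).1
      · apply DFunLike.ext; exact fun x => (this x).2
    have m1 : ∀ x, Φ (x, P.1 x, P.2 x) ∈ T := fun x => (hTP _ _ _).2 ⟨rfl, rfl⟩
    have m2 : ∀ x, Φ (x, Q.1 x, Q.2 x) ∈ T' := fun x => (hTQ _ _ _).2 ⟨rfl, rfl⟩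
    have fin0 : ∀ x, Φ (x, P.1 x, P.2 x) = 0 → x = 0 := by
      intro x hx
      have h6 : ((x, P.1 x, P.2 x) : X × X × X) = 0 := by
        apply Φ.injective; rw [hx, map_zero]
      exact congrArg Prod.fst h6
    have two' : ∀ x : X, x + x = 0 := fun x => Subtype.ext (h.two x)
    refine ⟨?_, ?_, ?_⟩
    · intro x hx
      refine fin0 x (h.indep hT hT' h3 hTT t3 t3' (m1 x) (m2 x) (hU3 (P.2 x + Q.2 x)) ?_).1
      rw [← map_add, ← map_add]
      simp [hx, two']
    · intro x hx
      refine fin0 x (h.indep hT hT' h2 hTT t2 t2' (m1 x) (m2 x) (hU2 (P.1 x + Q.1 x)) ?_).1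
      rw [← map_add, ← map_add]
      simp [hx, two']
    · intro x y hx hy
      refine fin0 x (h.indep hT hT' h1 hTT t1 t1' (m1 x) (m2 y) (hU1 (x + y)) ?_).1
      rw [← map_add, ← map_add]
      simp [hx, hy, two']
  · intro L hL
    let tm : AddMonoid.End X × AddMonoid.End X → AddSubgroup V := fun P =>
      if hP : ∃ T ∈ O, ∀ x y w, Φ (x, y, w) ∈ T ↔ y = P.1 x ∧ w = P.2 x then hP.choose else ⊥
    obtain ⟨T, hT, hTL⟩ := h.exists_avoid ({U₁, U₂, U₃} ∪ L.image tm) (by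
      have := Finset.card_union_le {U₁, U₂, U₃} (L.image tm)
      have := Finset.card_le_three (a := U₁) (b := U₂) (c := U₃)
      have := Finset.card_image_le (s := L) (f := tm)
      omega)
    simp only [Finset.mem_union, Finset.mem_insert, Finset.mem_singleton, not_or,
      Finset.mem_image, not_exists, not_and] at hTL
    obtain ⟨⟨t1, t2, t3⟩, hTL⟩ := hTL
    obtain ⟨A, B, hAB⟩ := hgraph T hT t2 t3
    have hex : ∃ T ∈ O, ∀ x y w, Φ (x, y, w) ∈ T ↔ y = A x ∧ w = B x := ⟨T, hT, hAB⟩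
    refine ⟨(A, B), ⟨⟨T, hT, hAB⟩, ?_⟩, ?_⟩
    · intro h0
      have hA : A = 0 := congrArg Prod.fst h0
      have hB : B = 0 := congrArg Prod.snd h0
      have : Φ (x₀, 0, 0) ∈ T := (hAB _ _ _).2 (by simp [hA, hB])
      have := h.disj hT h1 t1 this (hU1 x₀)
      have h6 : ((x₀, 0, 0) : X × X × X) = 0 := by
        apply Φ.injective; rw [this, map_zero]
      exact hx₀ (congrArg Prod.fst h6)
    · intro hmem
      apply hTL _ hmem
      have e1 : tm (A, B) = hex.choose := dif_pos hex
      rw [e1]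
      have := hex.choose_spec.2
      ext v
      obtain ⟨⟨x, y, w⟩, rfl⟩ := Φ.surjective v
      rw [this, hAB]
  · intro k hk
    let κ : AddMonoid.End V := (Φ.toAddMonoidHom.comp
      ((AddMonoidHom.prodMap k (AddMonoidHom.prodMap k k)))).comp Φ.symm.toAddMonoidHom
    have hκ : ∀ x y w, κ (Φ (x, y, w)) = Φ (k x, k y, k w) := by
      intro x y w
      change Φ (AddMonoidHom.prodMap k (AddMonoidHom.prodMap k k) (Φ.symm (Φ (x, y, w)))) = _
      rw [Φ.symm_apply_apply]; rfl
    refine ⟨κ, ?_, hκ⟩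
    intro T hT v hv
    obtain ⟨⟨x, y, w⟩, rfl⟩ := Φ.surjective v
    rw [hκ]
    have g1 : ∀ a : X, p a = 0 → a = 0 := fun a ha => Subtype.ext (pin X hX n4.2.1 n4.2.2 a a.2 ha)
    have g2 : ∀ a : X, q a = 0 → a = 0 := fun a ha => Subtype.ext (qin X hX n4.1 n4.2.2 a a.2 ha)
    have g3 : ∀ a : X, r a = 0 → a = 0 := fun a ha => Subtype.ext (rin X hX n4.1 n4.2.1 a a.2 ha)
    have two' : ∀ x : V, x + x = 0 := h.two
    by_cases t2 : T = U₂
    · rw [t2] at hv ⊢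
      rw [hΦ] at hv
      have := uniq0 (hp x) (U₂.add_mem (hq y) hv) (hr w) (by
        have : p x + (q y + (p x + q y + r w)) + r w = (p x + p x) + (q y + q y) + (r w + r w) := by
          abel
        rw [this, two' (p x), two' (q y), two' (r w)]; simp)
      rw [g1 x this.1, g3 w this.2.2]
      simpa using hU2 (k y)
    by_cases t3 : T = U₃
    · rw [t3] at hv ⊢
      rw [hΦ] at hv
      have := uniq0 (hp x) (hq y) (U₃.add_mem (hr w) hv) (by
        have : p x + q y + (r w + (p x + q y + r w)) = (p x + p x) + (q y + q y) + (r w + r w) := by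
          abel
        rw [this, two' (p x), two' (q y), two' (r w)]; simp)
      rw [g1 x this.1, g2 y this.2.1]
      simpa using hU3 (k w)
    obtain ⟨A, B, hAB⟩ := hgraph T hT t2 t3
    obtain ⟨rfl, rfl⟩ := (hAB _ _ _).1 hv
    rw [hAB]
    by_cases h0 : ((A, B) : AddMonoid.End X × AddMonoid.End X) = 0
    · have hA : A = 0 := congrArg Prod.fst h0
      have hB : B = 0 := congrArg Prod.snd h0
      simp [hA, hB]
    · obtain ⟨c1, c2⟩ := hk (A, B) ⟨⟨T, hT, hAB⟩, h0⟩
      exact ⟨(DFunLike.congr_fun c1 x).symm, (DFunLike.congr_fun c2 x).symm⟩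

end PHO

end PartD

section PartE

/-- the field with two elements, with kernel friendly operations -/
inductive F2 where
  | o
  | i
  deriving DecidableEq

namespace F2
protected def add : F2 → F2 → F2
  | o, b => b
  | i, o => i
  | i, i => o
protected def mul : F2 → F2 → F2
  | o, _ => o
  | i, b => b
instance : Zero F2 := ⟨o⟩
instance : One F2 := ⟨i⟩
instance : Add F2 := ⟨F2.add⟩
instance : Mul F2 := ⟨F2.mul⟩
instance : Neg F2 := ⟨fun a => a⟩
instance : Inv F2 := ⟨fun a => a⟩

instance : Field F2 where
  add_assoc := by intro a b c; cases a <;> cases b <;> cases c <;> rfl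
  zero_add := by intro a; cases a <;> rfl
  add_zero := by intro a; cases a <;> rfl
  add_comm := by intro a b; cases a <;> cases b <;> rfl
  neg_add_cancel := by intro a; cases a <;> rfl
  left_distrib := by intro a b c; cases a <;> cases b <;> cases c <;> rfl
  right_distrib := by intro a b c; cases a <;> cases b <;> cases c <;> rfl
  zero_mul := by intro a; cases a <;> rfl
  mul_zero := by intro a; cases a <;> rfl
  mul_assoc := by intro a b c; cases a <;> cases b <;> cases c <;> rfl
  one_mul := by intro a; cases a <;> rfl
  mul_one := by intro a; cases a <;> rfl
  mul_comm := by intro a b; cases a <;> cases b <;> rfl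
  exists_pair_ne := ⟨o, i, by decide⟩
  mul_inv_cancel := by intro a ha; cases a; exact absurd rfl ha; rfl
  inv_zero := rfl
  nsmul := nsmulRec
  zsmul := zsmulRec
  nnqsmul := _
  qsmul := _

instance : Fintype F2 := ⟨{o, i}, by intro a; cases a <;> decide⟩

theorem cases01 (a : F2) : a = 0 ∨ a = 1 := by cases a; exact Or.inl rfl; exact Or.inr rfl

def all (p : F2 → Bool) : Bool := p o && p i
theorem all_spec {p : F2 → Bool} (h : all p = true) (a : F2) : p a = true := by
  simp only [all, Bool.and_eq_true] at h
  cases a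
  exacts [h.1, h.2]

def isO : F2 → Bool
  | o => true
  | i => false
theorem isO_iff (a : F2) : isO a = true ↔ a = 0 := by cases a <;> decide
theorem isO_false (a : F2) : isO a = false ↔ a ≠ 0 := by cases a <;> decide
protected def beq (a b : F2) : Bool := isO (F2.add a b)
theorem beq_iff (a b : F2) : F2.beq a b = true ↔ a = b := by cases a <;> cases b <;> decide

/-- module structure on a group of exponent two -/
@[reducible] def module {X : Type*} [AddCommGroup X] (h : ∀ x : X, x + x = 0) : Module F2 X where
  smul a x := match a with
    | o => 0
    | i => x
  one_smul _ := rfl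
  mul_smul a b x := by cases a <;> cases b <;> rfl
  smul_zero a := by cases a <;> rfl
  smul_add a x y := by
    cases a
    · exact (add_zero (0 : X)).symm
    · rfl
  add_smul a b x := by
    cases a <;> cases b
    · exact (add_zero (0 : X)).symm
    · exact (zero_add x).symm
    · exact (add_zero x).symm
    · exact (h x).symm
  zero_smul _ := rfl
end F2

/-- 3 by 3 matrices over F2 -/
structure M3 where
  (a b c d e f g h i : F2)

namespace M3
def add (A B : M3) : M3 := ⟨A.a.add B.a, A.b.add B.b, A.c.add B.c, A.d.add B.d, A.e.add B.e,
  A.f.add B.f, A.g.add B.g, A.h.add B.h, A.i.add B.i⟩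
def dot (a b c x y z : F2) : F2 := ((a.mul x).add (b.mul y)).add (c.mul z)
def mul (A B : M3) : M3 := ⟨dot A.a A.b A.c B.a B.d B.g, dot A.a A.b A.c B.b B.e B.h,
  dot A.a A.b A.c B.c B.f B.i, dot A.d A.e A.f B.a B.d B.g, dot A.d A.e A.f B.b B.e B.h,
  dot A.d A.e A.f B.c B.f B.i, dot A.g A.h A.i B.a B.d B.g, dot A.g A.h A.i B.b B.e B.h,
  dot A.g A.h A.i B.c B.f B.i⟩
def one : M3 := ⟨.i, .o, .o, .o, .i, .o, .o, .o, .i⟩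
def det (A : M3) : F2 := (A.a.mul ((A.e.mul A.i).add (A.f.mul A.h))).add
  ((A.b.mul ((A.d.mul A.i).add (A.f.mul A.g))).add (A.c.mul ((A.d.mul A.h).add (A.e.mul A.g))))
/-- singular -/
def sg (A : M3) : Bool := F2.isO A.det
def beq (A B : M3) : Bool := F2.beq A.a B.a && F2.beq A.b B.b && F2.beq A.c B.c && F2.beq A.d B.d
  && F2.beq A.e B.e && F2.beq A.f B.f && F2.beq A.g B.g && F2.beq A.h B.h && F2.beq A.i B.i
def all (p : M3 → Bool) : Bool :=
  F2.all fun a => F2.all fun b => F2.all fun c => F2.all fun d => F2.all fun e => F2.all fun f =>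
  F2.all fun g => F2.all fun h => F2.all fun i => p ⟨a, b, c, d, e, f, g, h, i⟩
theorem all_spec {p : M3 → Bool} (h : all p = true) (A : M3) : p A = true := by
  obtain ⟨a, b, c, d, e, f, g, h', i⟩ := A
  have := F2.all_spec h a
  have := F2.all_spec this b
  have := F2.all_spec this c
  have := F2.all_spec this d
  have := F2.all_spec this e
  have := F2.all_spec this f
  have := F2.all_spec this g
  have := F2.all_spec this h'
  exact F2.all_spec this i
theorem beq_iff (A B : M3) : beq A B = true ↔ A = B := by
  simp only [beq, Bool.and_eq_true, F2.beq_iff]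
  constructor
  · rintro ⟨⟨⟨⟨⟨⟨⟨⟨h1, h2⟩, h3⟩, h4⟩, h5⟩, h6⟩, h7⟩, h8⟩, h9⟩
    cases A; cases B; simp_all
  · rintro rfl; simp

def nirr (A : M3) : Bool := sg A || sg (add A one)
def comp (a b c : F2) : M3 := ⟨.o, .o, a, .i, .o, b, .o, .i, c⟩
def pol (a b c : F2) (N : M3) : M3 :=
  let N2 := mul N N
  let s := fun x y z => F2.add x (F2.add (b.mul y) (c.mul z))
  ⟨s a N.a N2.a, s .o N.b N2.b, s .o N.c N2.c, s .o N.d N2.d, s a N.e N2.e, s .o N.f N2.f,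
   s .o N.g N2.g, s .o N.h N2.h, s a N.i N2.i⟩

def chk0 : Bool := all fun A => !(beq (add (mul A A) (add A one)) ⟨.o, .o, .o, .o, .o, .o, .o, .o, .o⟩)
def chk1 : Bool := F2.all fun a => F2.all fun b => F2.all fun c =>
  nirr (comp a b c) || all fun N => sg (add N (comp a b c)) || nirr N ||
    beq (mul N (comp a b c)) (mul (comp a b c) N) ||
    all fun L => sg (add N L) || sg (add L (comp a b c)) || nirr L
def chk2 : Bool := F2.all fun a => F2.all fun b => F2.all fun c =>
  nirr (comp a b c) || all fun N => !(beq (mul N (comp a b c)) (mul (comp a b c) N)) ||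
    beq N (pol N.a N.d N.g (comp a b c))
def chk3 : Bool := F2.all fun a => F2.all fun b => F2.all fun c =>
  nirr (comp a b c) || all fun C => nirr C || sg (add (mul C (comp a b c)) one) ||
    beq (mul C (comp a b c)) (mul (comp a b c) C) ||
    F2.all fun x => F2.all fun y => F2.all fun z =>
      nirr (pol x y z (comp a b c)) || sg (add (pol x y z (comp a b c)) (comp a b c)) ||
    F2.all fun u => F2.all fun v => F2.all fun w =>
      nirr (pol u v w C) || sg (add (pol u v w C) C) ||
        !(beq (mul (mul (pol u v w C) (pol x y z (comp a b c))) (mul C (comp a b c)))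
          (mul (mul C (comp a b c)) (mul (pol u v w C) (pol x y z (comp a b c)))))

set_option maxRecDepth 100000
theorem chk0_true : chk0 = true := by decide +kernel
theorem chk1_true : chk1 = true := by decide +kernel
theorem chk2_true : chk2 = true := by decide +kernel
theorem chk3_true : chk3 = true := by decide +kernel
end M3

end PartE

section PartE2

namespace M3
open Matrix
abbrev Mat := Matrix (Fin 3) (Fin 3) F2
def of (M : Mat) : M3 := ⟨M 0 0, M 0 1, M 0 2, M 1 0, M 1 1, M 1 2, M 2 0, M 2 1, M 2 2⟩

theorem of_inj {M N : Mat} (h : of M = of N) : M = N := by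
  simp only [of, mk.injEq] at h
  obtain ⟨h1, h2, h3, h4, h5, h6, h7, h8, h9⟩ := h
  ext i j
  fin_cases i <;> fin_cases j <;> assumption
theorem of_add (M N : Mat) : of (M + N) = add (of M) (of N) := rfl
theorem of_one : of 1 = one := rfl
theorem of_zero : of 0 = ⟨.o, .o, .o, .o, .o, .o, .o, .o, .o⟩ := rfl
theorem of_mul (M N : Mat) : of (M * N) = mul (of M) (of N) := by
  simp only [of, mul, Matrix.mul_apply, Fin.sum_univ_three]
  rfl
theorem det_of (M : Mat) : det (of M) = M.det := by
  rw [Matrix.det_fin_three]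
  change M 0 0 * (M 1 1 * M 2 2 + M 1 2 * M 2 1) + (M 0 1 * (M 1 0 * M 2 2 + M 1 2 * M 2 0) +
    M 0 2 * (M 1 0 * M 2 1 + M 1 1 * M 2 0)) = _
  have h : ∀ x y : F2, x - y = x + y := fun x y => by cases x <;> cases y <;> rfl
  simp only [h]
  ring
theorem sg_of {M : Mat} (h : IsUnit M) : sg (of M) = false := by
  rw [sg, F2.isO_false, det_of]
  exact ((Matrix.isUnit_iff_isUnit_det M).1 h).ne_zero
theorem nirr_of {M : Mat} (h : IsUnit M) (h1 : IsUnit (M + 1)) : nirr (of M) = false := by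
  rw [nirr, sg_of h, ← of_one, ← of_add, sg_of h1]; rfl
theorem of_pol (a b c : F2) (M : Mat) :
    of (a • (1 : Mat) + b • M + c • (M * M)) = pol a b c (of M) := by
  have h1 : ∀ x y z, F2.add x (F2.add (b.mul y) (c.mul z)) = x + b * y + c * z := fun x y z =>
    (add_assoc x (b * y) (c * z)).symm
  simp only [pol, h1, ← of_mul]
  have h2 : (F2.o : F2) = 0 := rfl
  simp [of, h2]
end M3

section three
variable {X : Type*} [AddCommGroup X] [Module F2 X]
open M3

theorem F2.exists_equiv (hX : Nat.card X = 8) {N : Module.End F2 X} (h0 : IsUnit N)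
    (h1 : IsUnit (N + 1)) :
    ∃ (ρ : Module.End F2 X ≃ₐ[F2] Mat) (a b c : F2), of (ρ N) = comp a b c := by
  have hfin : Finite X := Nat.finite_of_card_ne_zero (by rw [hX]; norm_num)
  have hfd : Module.Finite F2 X := Module.Finite.of_finite
  have hr : Module.finrank F2 X = 3 := by
    have := Module.natCard_eq_pow_finrank (K := F2) (V := X)
    rw [hX, Nat.card_eq_fintype_card, show Fintype.card F2 = 2 from rfl] at this
    have h8 : 2 ^ 3 = 2 ^ Module.finrank F2 X := by rw [← this]; norm_num
    exact (Nat.pow_right_injective (le_refl 2) h8).symm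
  have i0 : ∀ x, N x = 0 → x = 0 := fun x hx => by
    have := ((Module.End.isUnit_iff N).1 h0).1
    exact this (by rw [hx, map_zero])
  have i1 : ∀ x, N x + x = 0 → x = 0 := fun x hx => by
    have := ((Module.End.isUnit_iff (N + 1)).1 h1).1
    exact this (by rw [map_zero]; exact hx)
  have hx : ∃ x, N (N x) + (N x + x) ≠ 0 := by
    by_contra! hc
    let b := Module.finBasisOfFinrankEq F2 X hr
    let ρ := LinearMap.toMatrixAlgEquiv b
    have e : N * N + (N + 1) = 0 := by ext x; exact hc x
    have e2 : ρ N * ρ N + (ρ N + 1) = 0 := by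
      rw [← map_mul, ← map_one ρ, ← map_add, ← map_add, e, map_zero]
    have e3 := M3.all_spec chk0_true (of (ρ N))
    rw [← of_mul, ← of_one, ← of_add, ← of_add, e2, of_zero] at e3
    exact absurd e3 (by decide)
  obtain ⟨x, hx⟩ := hx
  have hx0 : x ≠ 0 := by rintro rfl; simp at hx
  have two' : ∀ y : X, y + y = 0 := fun y => by
    have : ((1 : F2) + 1) • y = y + y := by rw [add_smul, one_smul]
    rw [← this, show (1 : F2) + 1 = 0 from rfl, zero_smul]
  have hli : LinearIndependent F2 ![x, N x, N (N x)] := by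
    rw [Fintype.linearIndependent_iff]
    intro g hg
    rw [Fin.sum_univ_three] at hg
    simp only [Matrix.cons_val] at hg
    have key : g 0 = 0 ∧ g 1 = 0 ∧ g 2 = 0 := by
      rcases F2.cases01 (g 0) with e0 | e0 <;> rcases F2.cases01 (g 1) with e1 | e1 <;>
        rcases F2.cases01 (g 2) with e2 | e2 <;> rw [e0, e1, e2] at hg <;>
        simp only [zero_smul, one_smul, add_zero, zero_add] at hg
      · exact ⟨e0, e1, e2⟩
      · exact absurd (i0 _ (i0 _ hg)) hx0
      · exact absurd (i0 _ hg) hx0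
      · exact absurd (i0 _ (i1 _ (by rw [add_comm]; exact hg))) hx0
      · exact absurd hg hx0
      · refine absurd (i1 _ (i1 _ ?_)) hx0
        rw [map_add]
        have : N (N x) + N x + (N x + x) = (x + N (N x)) + (N x + N x) := by abel
        rw [this, hg, two']; simp
      · exact absurd (i1 _ (by rw [add_comm]; exact hg)) hx0
      · refine absurd ?_ hx
        rw [← hg]; abel
    intro i
    fin_cases i
    exacts [key.1, key.2.1, key.2.2]
  let b := basisOfLinearIndependentOfCardEqFinrank hli (by rw [hr]; rfl)
  have b0 : b 0 = x := by simp [b]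
  have b1 : b 1 = N x := by simp [b]
  have b2 : b 2 = N (N x) := by simp [b]
  let ρ := LinearMap.toMatrixAlgEquiv b
  refine ⟨ρ, ρ N 0 2, ρ N 1 2, ρ N 2 2, ?_⟩
  have c0 : ∀ i, ρ N i 0 = b.repr (b 1) i := fun i => by
    rw [LinearMap.toMatrixAlgEquiv_apply, b0, b1]
  have c1 : ∀ i, ρ N i 1 = b.repr (b 2) i := fun i => by
    rw [LinearMap.toMatrixAlgEquiv_apply, b1, b2]
  simp only [of, comp, c0, c1, Module.Basis.repr_self]
  simp
  and_intros <;> rfl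

theorem F2.L1 (hX : Nat.card X = 8) {N N' L : Module.End F2 X} (h0 : IsUnit N)
    (h1 : IsUnit (N + 1)) (h0' : IsUnit N') (h1' : IsUnit (N' + 1)) (k0 : IsUnit L)
    (k1 : IsUnit (L + 1)) (e : IsUnit (N' + N)) (e1 : IsUnit (N' + L)) (e2 : IsUnit (L + N)) :
    N' * N = N * N' := by
  obtain ⟨ρ, a, b, c, h⟩ := F2.exists_equiv hX h0 h1
  have u : ∀ {M : Module.End F2 X}, IsUnit M → IsUnit (ρ M) := fun hM => hM.map ρ
  have := F2.all_spec (F2.all_spec (F2.all_spec chk1_true a) b) c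
  rw [← h, nirr_of (u h0) (by simpa using u h1), Bool.false_or] at this
  have := M3.all_spec this (of (ρ N'))
  rw [← of_add, sg_of (by simpa using u e), nirr_of (u h0') (by simpa using u h1'), Bool.false_or,
    Bool.false_or, Bool.or_eq_true] at this
  rcases this with this | this
  · rw [M3.beq_iff, ← of_mul, ← of_mul] at this
    apply ρ.injective
    simpa using of_inj this
  · have := M3.all_spec this (of (ρ L))
    rw [← of_add, ← of_add, sg_of (by simpa using u e1), sg_of (by simpa using u e2),
      nirr_of (u k0) (by simpa using u k1)] at this
    exact absurd this (by decide)

theorem F2.L2 (hX : Nat.card X = 8) {N M : Module.End F2 X} (h0 : IsUnit N)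
    (h1 : IsUnit (N + 1)) (e : M * N = N * M) :
    ∃ a b c : F2, M = a • (1 : Module.End F2 X) + b • N + c • (N * N) := by
  obtain ⟨ρ, a, b, c, h⟩ := F2.exists_equiv hX h0 h1
  have u : ∀ {M : Module.End F2 X}, IsUnit M → IsUnit (ρ M) := fun hM => hM.map ρ
  have := F2.all_spec (F2.all_spec (F2.all_spec chk2_true a) b) c
  rw [← h, nirr_of (u h0) (by simpa using u h1), Bool.false_or] at this
  have := M3.all_spec this (of (ρ M))
  rw [← of_mul, ← of_mul, ← map_mul, ← map_mul, e, (M3.beq_iff _ _).2 rfl] at this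
  simp only [Bool.not_true, Bool.false_or] at this
  rw [M3.beq_iff, ← of_pol] at this
  refine ⟨(of (ρ M)).a, (of (ρ M)).d, (of (ρ M)).g, ρ.injective ?_⟩
  refine (of_inj this).trans ?_
  simp

theorem F2.L3 (hX : Nat.card X = 8) {A C A' C' : Module.End F2 X} (h0 : IsUnit A)
    (h1 : IsUnit (A + 1)) (h0' : IsUnit A') (h1' : IsUnit (A' + 1)) (k0 : IsUnit C)
    (k1 : IsUnit (C + 1)) (k0' : IsUnit C') (k1' : IsUnit (C' + 1)) (l : IsUnit (C * A + 1))
    (e1 : IsUnit (A' + A)) (e2 : IsUnit (C' + C)) (f1 : A' * A = A * A') (f2 : C' * C = C * C')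
    (f3 : (C' * A') * (C * A) = (C * A) * (C' * A')) : C * A = A * C := by
  obtain ⟨x, y, z, hA'⟩ := F2.L2 hX h0 h1 f1
  obtain ⟨r, s, t, hC'⟩ := F2.L2 hX k0 k1 f2
  obtain ⟨ρ, a, b, c, h⟩ := F2.exists_equiv hX h0 h1
  have u : ∀ {M : Module.End F2 X}, IsUnit M → IsUnit (ρ M) := fun hM => hM.map ρ
  have q1 : of (ρ A') = pol x y z (of (ρ A)) := by
    rw [← of_pol, hA']; simp
  have q2 : of (ρ C') = pol r s t (of (ρ C)) := by
    rw [← of_pol, hC']; simp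
  have := F2.all_spec (F2.all_spec (F2.all_spec chk3_true a) b) c
  rw [← h, nirr_of (u h0) (by simpa using u h1), Bool.false_or] at this
  have := M3.all_spec this (of (ρ C))
  rw [nirr_of (u k0) (by simpa using u k1), Bool.false_or, ← of_mul, ← of_one, ← of_add,
    sg_of (by simpa using u l), Bool.false_or, Bool.or_eq_true] at this
  rcases this with this | this
  · rw [M3.beq_iff, ← of_mul] at this
    apply ρ.injective
    simpa using of_inj this
  · have := F2.all_spec (F2.all_spec (F2.all_spec this x) y) z
    rw [← q1, nirr_of (u h0') (by simpa using u h1'), ← of_add, sg_of (by simpa using u e1),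
      Bool.false_or, Bool.false_or] at this
    have := F2.all_spec (F2.all_spec (F2.all_spec this r) s) t
    rw [← q2, nirr_of (u k0') (by simpa using u k1'), ← of_add, sg_of (by simpa using u e2),
      Bool.false_or, Bool.false_or, ← of_mul, ← of_mul, ← of_mul, ← map_mul, ← map_mul, ← map_mul,
      ← map_mul, f3, (M3.beq_iff _ _).2 rfl] at this
    exact absurd this (by decide)

end three

end PartE2

section PartE3

/-- additive maps of a group of exponent two are linear -/
def F2.lin {X : Type*} [AddCommGroup X] [Module F2 X] : AddMonoid.End X →+* Module.End F2 X where
  toFun A := { A with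
    map_smul' := fun a x => by
      rcases F2.cases01 a with rfl | rfl
      · change A ((0 : F2) • x) = (0 : F2) • A x
        rw [zero_smul, zero_smul]; exact map_zero A
      · change A ((1 : F2) • x) = (1 : F2) • A x
        rw [one_smul, one_smul] }
  map_one' := rfl
  map_mul' _ _ := rfl
  map_zero' := rfl
  map_add' _ _ := rfl

theorem ph_isUnit {R X : Type*} [Ring R] [AddCommGroup X] [Module R X] [Finite X] {A : Module.End R X}
    (h : ∀ x, A x = 0 → x = 0) : IsUnit A := by
  rw [Module.End.isUnit_iff]
  exact Finite.injective_iff_bijective.1 ((injective_iff_map_eq_zero A).2 h)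

theorem ph_unit_inj {R X : Type*} [Ring R] [AddCommGroup X] [Module R X] {A : Module.End R X}
    (h : IsUnit A) {x : X} (hx : A x = 0) : x = 0 := by
  rw [Module.End.isUnit_iff] at h
  exact h.1 (by rw [hx, map_zero])

namespace PHO
variable {V : Type*} [AddCommGroup V] {m : ℕ} {O : Set (AddSubgroup V)}

theorem finK (h : PHO m O) : Finite (PHK O) := by
  have := h.fin
  have : Finite (AddMonoid.End V) := Finite.of_injective (fun k => (k : V → V)) DFunLike.coe_injective
  infer_instance

theorem card_le_of_list (h : PHO m O) (L : List (AddMonoid.End V)) (hn : L.Nodup)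
    (hL : ∀ k ∈ L, k ∈ PHK O) : L.length ≤ Nat.card (PHK O) := by
  have := h.finK
  have hf : Finite {k // k ∈ L} := List.finite_toSet L
  classical
  have e : Nat.card {k // k ∈ L} = L.length := by
    rw [← List.toFinset_card_of_nodup hn]
    have : Nat.card {k // k ∈ L} = Nat.card {k // k ∈ L.toFinset} :=
      Nat.card_congr (Equiv.subtypeEquivRight (fun k => List.mem_toFinset.symm))
    rw [this, Nat.card_eq_fintype_card, Fintype.card_coe]
  rw [← e]
  exact Nat.card_le_card_of_injective (fun k : {k // k ∈ L} => (⟨k.1, hL _ k.2⟩ : PHK O))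
    (fun a b hab => Subtype.ext (congrArg (fun z : PHK O => z.1) hab))

theorem exists_one_ne_zero (h : PHO m O) : (0 : AddMonoid.End V) ≠ 1 := by
  intro h0
  obtain ⟨J, hJ, -⟩ := h.exists_third ⊥ ⊥
  obtain ⟨u, -, hu0⟩ := h.exists_nz hJ
  exact hu0 (DFunLike.congr_fun h0 u).symm

theorem card_three (h : PHO m O) {κ : AddMonoid.End V} (hk : κ ∈ PHK O) (h0 : κ ≠ 0)
    (h1 : κ ≠ 1) : 3 ≤ Nat.card (PHK O) := by
  refine h.card_le_of_list [0, 1, κ] ?_ ?_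
  · have := h.exists_one_ne_zero
    simp [h0.symm, h1.symm, this]
  · intro k hk'
    simp only [List.mem_cons, List.not_mem_nil, or_false] at hk'
    rcases hk' with rfl | rfl | rfl
    exacts [zero_mem _, one_mem _, hk]

theorem core_one (h : PHO 1 O) : 2 ^ 1 < Nat.card (PHK O) ^ 2 := by
  have := h.card_le_of_list [0, 1] (by simp [h.exists_one_ne_zero]) (by
    intro k hk'
    simp only [List.mem_cons, List.not_mem_nil, or_false] at hk'
    rcases hk' with rfl | rfl
    exacts [zero_mem _, one_mem _])
  simp only [List.length_cons, List.length_nil] at this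
  nlinarith

/-- four element group: two fixed point free maps commute -/
theorem four_comm {X : Type*} [AddCommGroup X] (hX : Nat.card X = 4) (two : ∀ x : X, x + x = 0)
    {N M : AddMonoid.End X} (h0 : ∀ x, N x = 0 → x = 0) (h1 : ∀ x, N x = x → x = 0)
    (k0 : ∀ x, M x = 0 → x = 0) (k1 : ∀ x, M x = x → x = 0) : M * N = N * M := by
  classical
  have hfin : Finite X := Nat.finite_of_card_ne_zero (by rw [hX]; norm_num)
  have := Fintype.ofFinite X
  rw [Nat.card_eq_fintype_card] at hX
  have eqadd : ∀ {x y : X}, x + y = 0 → x = y := fun {x y} hxy => by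
    have : x = x + y + y := by rw [add_assoc, two, add_zero]
    rw [this, hxy, zero_add]
  have ex : ∀ {N : AddMonoid.End X}, (∀ x, N x = 0 → x = 0) → (∀ x, N x = x → x = 0) →
      ∀ x, x ≠ 0 → ∀ y, y = 0 ∨ y = x ∨ y = N x ∨ y = x + N x := by
    intro N h0 h1 x hx y
    have hc : ({0, x, N x, x + N x} : Finset X).card = 4 := by
      have a1 : N x ≠ 0 := fun e => hx (h0 _ e)
      have a2 : N x ≠ x := fun e => hx (h1 _ e)
      have a3 : x + N x ≠ 0 := fun e => a2 (eqadd e).symm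
      rw [Finset.card_insert_of_notMem, Finset.card_insert_of_notMem, Finset.card_insert_of_notMem,
        Finset.card_singleton]
      · simp [hx]
      · simp [a2.symm, a1]
      · simp [hx.symm, a1.symm, a3.symm]
    have hu := (Finset.card_eq_iff_eq_univ _).1 (hc.trans hX.symm)
    have := Finset.mem_univ y
    rw [← hu] at this
    simpa using this
  have sq : ∀ {N : AddMonoid.End X}, (∀ x, N x = 0 → x = 0) → (∀ x, N x = x → x = 0) →
      ∀ x, N (N x) = x + N x := by
    intro N h0 h1 x
    by_cases hx : x = 0
    · subst hx; simp
    rcases ex h0 h1 x hx (N (N x)) with e | e | e | e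
    · exact absurd (h0 _ (h0 _ e)) hx
    · have h2 : N (N x + x) = N x + x := by rw [map_add, e, add_comm]
      exact absurd (h1 _ (eqadd (h1 _ h2))) hx
    · exact absurd (h0 _ (h1 _ e)) hx
    · exact e
  ext x
  change M (N x) = N (M x)
  by_cases hx : x = 0
  · subst hx; simp
  rcases ex h0 h1 x hx (M x) with e | e | e | e
  · exact absurd (k0 _ e) hx
  · exact absurd (k1 _ e) hx
  · rw [← e, sq k0 k1, e, ← e, e, sq h0 h1]
  · have e2 : N x = x + M x := by rw [e, ← add_assoc, two, zero_add]
    rw [e2, map_add, sq k0 k1, e, map_add, sq h0 h1]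
    have a1 : x + N x + (x + (x + N x)) = x + (x + x) + (N x + N x) := by abel
    have a2 : N x + (x + N x) = x + (N x + N x) := by abel
    rw [a1, a2, two, two]; simp

theorem core_two (h : PHO 2 O) : 2 ^ 2 < Nat.card (PHK O) ^ 2 := by
  obtain ⟨X, Φ, S, hX, h11, hS1, hS2, hL, hk⟩ := h.coords
  obtain ⟨P, hP, hP1⟩ := hL {(1, 1)} (by simp)
  simp only [Finset.mem_singleton] at hP1
  have two' : ∀ x : X, x + x = 0 := fun x => Subtype.ext (h.two x)
  have key : ∀ Q ∈ S, Q.1 * P.1 = P.1 * Q.1 ∧ Q.2 * P.1 = P.1 * Q.2 := by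
    intro Q hQ
    by_cases hQ1 : Q = (1, 1)
    · subst hQ1; simp
    · have a := hS2 P hP (1, 1) h11 hP1
      have b := hS2 Q hQ (1, 1) h11 hQ1
      exact ⟨four_comm hX two' (hS1 P hP).1 a.1 (hS1 Q hQ).1 b.1,
        four_comm hX two' (hS1 P hP).1 a.1 (hS1 Q hQ).2 b.2.1⟩
  obtain ⟨κ, hκ, e⟩ := hk P.1 key
  have hnt : ∃ x : X, x ≠ 0 := by
    by_contra! hc
    have : Subsingleton X := ⟨fun a b => by rw [hc a, hc b]⟩
    rw [Nat.card_of_subsingleton (0 : X)] at hX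
    omega
  obtain ⟨x, hx⟩ := hnt
  have := h.card_three hκ (by
    rintro rfl
    have := e x 0 0
    have h6 : ((P.1 x, P.1 0, P.1 0) : X × X × X) = 0 := Φ.injective (by rw [← this]; simp)
    exact hx ((hS1 P hP).1 x (congrArg Prod.fst h6))) (by
    rintro rfl
    have := e x 0 0
    have h6 := Φ.injective this
    exact hx ((hS2 P hP (1, 1) h11 hP1).1 x (congrArg Prod.fst h6).symm))
  nlinarith

theorem core_three (h : PHO 3 O) : 2 ^ 3 < Nat.card (PHK O) ^ 2 := by
  classical
  have := h.fin
  obtain ⟨X, Φ, S, hX, h11, hS1, hS2, hL, hk⟩ := h.coords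
  have two' : ∀ x : X, x + x = 0 := fun x => Subtype.ext (h.two x)
  letI : Module F2 X := F2.module two'
  have h8 : Nat.card X = 8 := by rw [hX]; norm_num
  have eqadd : ∀ {x y : X}, x + y = 0 → x = y := fun {x y} hxy => by
    have : x = x + y + y := by rw [add_assoc, two', add_zero]
    rw [this, hxy, zero_add]
  let l : AddMonoid.End X →+* Module.End F2 X := F2.lin
  have linj : Function.Injective l := by
    intro a b hab
    apply DFunLike.ext
    intro x
    exact DFunLike.congr_fun hab x
  have u1 : ∀ P ∈ S, IsUnit (l P.1) := fun P hP => ph_isUnit (hS1 P hP).1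
  have u2 : ∀ P ∈ S, IsUnit (l P.2) := fun P hP => ph_isUnit (hS1 P hP).2
  have exC : ∀ P : AddMonoid.End X × AddMonoid.End X, ∃ C : Module.End F2 X, P ∈ S → C * l P.1 = l P.2 := by
    intro P
    by_cases hP : P ∈ S
    · obtain ⟨u, hu⟩ := u1 P hP
      refine ⟨l P.2 * ↑u⁻¹, fun _ => ?_⟩
      rw [← hu, mul_assoc, Units.inv_mul, mul_one]
    · exact ⟨0, fun h => absurd h hP⟩
  choose C hC using exC
  have u3 : ∀ P ∈ S, IsUnit (C P) := fun P hP => by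
    have := u2 P hP
    rw [← hC P hP] at this
    exact (u1 P hP).mul_right_iff.1 this
  have v1 : ∀ P ∈ S, ∀ Q ∈ S, P ≠ Q → IsUnit (l P.1 + l Q.1) := fun P hP Q hQ hne =>
    ph_isUnit (fun x hx => (hS2 P hP Q hQ hne).1 x (eqadd hx))
  have v2 : ∀ P ∈ S, ∀ Q ∈ S, P ≠ Q → IsUnit (l P.2 + l Q.2) := fun P hP Q hQ hne =>
    ph_isUnit (fun x hx => (hS2 P hP Q hQ hne).2.1 x (eqadd hx))
  have v3 : ∀ P ∈ S, ∀ Q ∈ S, P ≠ Q → IsUnit (C P + C Q) := by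
    intro P hP Q hQ hne
    apply ph_isUnit
    intro z hz
    obtain ⟨x, rfl⟩ := ((Module.End.isUnit_iff _).1 (u1 P hP)).2 z
    obtain ⟨y, hy⟩ := ((Module.End.isUnit_iff _).1 (u1 Q hQ)).2 (l P.1 x)
    have e1 : l P.2 x = l Q.2 y := by
      rw [← hC P hP, ← hC Q hQ]
      change C P (l P.1 x) = C Q (l Q.1 y)
      rw [hy]; exact eqadd hz
    have := (hS2 P hP Q hQ hne).2.2 x y hy.symm e1
    rw [this, map_zero]
  have C1 : C (1, 1) = 1 := by simpa using hC (1, 1) h11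
  have w1 : ∀ P ∈ S, P ≠ (1, 1) → IsUnit (l P.1 + 1) := fun P hP hne => by
    simpa using v1 P hP (1, 1) h11 hne
  have w2 : ∀ P ∈ S, P ≠ (1, 1) → IsUnit (l P.2 + 1) := fun P hP hne => by
    simpa using v2 P hP (1, 1) h11 hne
  have w3 : ∀ P ∈ S, P ≠ (1, 1) → IsUnit (C P + 1) := fun P hP hne => by
    simpa [C1] using v3 P hP (1, 1) h11 hne
  have comm : ∀ P ∈ S, ∀ Q ∈ S, P ≠ (1, 1) → Q ≠ (1, 1) → Q ≠ P →
      l Q.1 * l P.1 = l P.1 * l Q.1 ∧ l Q.2 * l P.2 = l P.2 * l Q.2 ∧ C Q * C P = C P * C Q := by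
    intro P hP Q hQ hP1 hQ1 hne
    obtain ⟨R, hR, hR1⟩ := hL {(1, 1), P, Q} (by
      have := Finset.card_le_three (a := ((1, 1) : AddMonoid.End X × AddMonoid.End X)) (b := P) (c := Q)
      omega)
    simp only [Finset.mem_insert, Finset.mem_singleton, not_or] at hR1
    obtain ⟨r1, r2, r3⟩ := hR1
    exact ⟨F2.L1 h8 (u1 P hP) (w1 P hP hP1) (u1 Q hQ) (w1 Q hQ hQ1) (u1 R hR) (w1 R hR r1)
        (v1 Q hQ P hP hne) (v1 Q hQ R hR (Ne.symm r3)) (v1 R hR P hP r2),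
      F2.L1 h8 (u2 P hP) (w2 P hP hP1) (u2 Q hQ) (w2 Q hQ hQ1) (u2 R hR) (w2 R hR r1)
        (v2 Q hQ P hP hne) (v2 Q hQ R hR (Ne.symm r3)) (v2 R hR P hP r2),
      F2.L1 h8 (u3 P hP) (w3 P hP hP1) (u3 Q hQ) (w3 Q hQ hQ1) (u3 R hR) (w3 R hR r1)
        (v3 Q hQ P hP hne) (v3 Q hQ R hR (Ne.symm r3)) (v3 R hR P hP r2)⟩
  have AB : ∀ P ∈ S, P ≠ (1, 1) → l P.2 * l P.1 = l P.1 * l P.2 := by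
    intro P hP hP1
    obtain ⟨Q, hQ, hQ1⟩ := hL {(1, 1), P} (by
      have := Finset.card_le_two (a := ((1, 1) : AddMonoid.End X × AddMonoid.End X)) (b := P)
      omega)
    simp only [Finset.mem_insert, Finset.mem_singleton, not_or] at hQ1
    obtain ⟨c1, c2, c3⟩ := comm P hP Q hQ hP1 hQ1.1 hQ1.2
    have := F2.L3 h8 (u1 P hP) (w1 P hP hP1) (u1 Q hQ) (w1 Q hQ hQ1.1) (u3 P hP) (w3 P hP hP1)
      (u3 Q hQ) (w3 Q hQ hQ1.1) (by rw [hC P hP]; exact w2 P hP hP1) (v1 Q hQ P hP hQ1.2)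
      (v3 Q hQ P hP hQ1.2) c1 c3 (by rw [hC P hP, hC Q hQ]; exact c2)
    rw [← hC P hP, ← mul_assoc, this]
  obtain ⟨P, hP, hP1⟩ := hL {(1, 1)} (by simp)
  simp only [Finset.mem_singleton] at hP1
  have key : ∀ Q ∈ S, Q.1 * P.1 = P.1 * Q.1 ∧ Q.2 * P.1 = P.1 * Q.2 := by
    intro Q hQ
    by_cases hQ1 : Q = (1, 1)
    · subst hQ1; simp
    have c1 : l Q.1 * l P.1 = l P.1 * l Q.1 := by
      by_cases hne : Q = P
      · rw [hne]
      · exact (comm P hP Q hQ hP1 hQ1 hne).1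
    refine ⟨linj (by simpa using c1), linj ?_⟩
    rw [map_mul, map_mul]
    obtain ⟨a, b, c, e⟩ := F2.L2 h8 (u1 Q hQ) (w1 Q hQ hQ1) c1.symm
    have e2 := AB Q hQ hQ1
    have : Commute (l Q.2) (l P.1) := by
      rw [e]
      have cc : Commute (l Q.2) (l Q.1) := e2
      exact (((Commute.one_right _).smul_right a).add_right (cc.smul_right b)).add_right
        ((cc.mul_right cc).smul_right c)
    exact this
  obtain ⟨κ, hκ, e⟩ := hk P.1 key
  have hnt : ∃ x : X, x ≠ 0 := by
    by_contra! hc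
    have : Subsingleton X := ⟨fun a b => by rw [hc a, hc b]⟩
    rw [Nat.card_of_subsingleton (0 : X)] at hX
    omega
  obtain ⟨x, hx⟩ := hnt
  have := h.card_three hκ (by
    rintro rfl
    have := e x 0 0
    have h6 : ((P.1 x, P.1 0, P.1 0) : X × X × X) = 0 := Φ.injective (by rw [← this]; simp)
    exact hx ((hS1 P hP).1 x (congrArg Prod.fst h6))) (by
    rintro rfl
    have := e x 0 0
    have h6 := Φ.injective this
    exact hx ((hS2 P hP (1, 1) h11 hP1).1 x (congrArg Prod.fst h6).symm))
  nlinarith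

end PHO

end PartE3

section PartF1

open scoped Pointwise

theorem ph_free {H α : Type*} [Group H] [Finite H] [MulAction H α] [Finite α]
    (hf : ∀ a : α, ∀ g : H, g • a = a → g = 1) : Nat.card H ∣ Nat.card α := by
  have e := MulAction.selfEquivOrbitsQuotientProd (fun b : α => show MulAction.stabilizer H b = ⊥ by
    rw [Subgroup.eq_bot_iff_forall]
    intro g hg
    exact hf b g hg)
  rw [Nat.card_congr e, Nat.card_prod]
  exact Dvd.intro_left _ rfl

namespace PHO
variable {V : Type*} [AddCommGroup V] {m : ℕ} {O : Set (AddSubgroup V)}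
variable {R : Type*} [Group R] [DistribMulAction R V]

/-- fixed vectors of an element -/
def fx (V : Type*) [AddCommGroup V] [DistribMulAction R V] (g : R) : AddSubgroup V where
  carrier := {v | g • v = v}
  add_mem' := fun {a b} ha hb => by
    change g • (a + b) = a + b
    rw [smul_add, ha, hb]
  zero_mem' := smul_zero g
  neg_mem' := fun {a} ha => by
    change g • (-a) = -a
    rw [smul_neg, ha]

theorem mem_fx {g : R} {v : V} : v ∈ fx V g ↔ g • v = v := Iff.rfl

theorem K1 (h : PHO m O) (hst : ∀ g : R, ∀ U ∈ O, g • U ∈ O) {g : R} (hg : g ^ 3 = 1)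
    {U : AddSubgroup V} (hU : U ∈ O) (hne : g • U ≠ U) : Nat.card (fx V g) = 2 ^ m := by
  have := h.fin
  have hg3 : ∀ v : V, g • g • g • v = v := fun v => by
    rw [← mul_smul, ← mul_smul, ← pow_three', hg, one_smul]
  have hodd : Odd (orderOf g) := by
    have := orderOf_dvd_of_pow_eq_one hg
    rcases (Nat.dvd_prime Nat.prime_three).1 this with e | e <;> rw [e] <;> decide
  obtain ⟨d1, d2, d3⟩ := three_distinct hodd hne
  have h1 := hst g U hU
  have h2 := hst g _ h1
  have mem1 : ∀ u ∈ U, g • u ∈ g • U := fun u hu => AddSubgroup.smul_mem_pointwise_smul u g U hu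
  have mem2 : ∀ u ∈ U, g • g • u ∈ g • g • U :=
    fun u hu => AddSubgroup.smul_mem_pointwise_smul _ g _ (mem1 u hu)
  let f : U → fx V g := fun u => ⟨(u : V) + g • (u : V) + g • g • (u : V), by
    rw [mem_fx, smul_add, smul_add, hg3]; abel⟩
  rw [← h.cardU U hU]
  symm
  refine Nat.card_eq_of_bijective f ⟨?_, ?_⟩
  · intro u v huv
    have e : (u : V) + g • (u : V) + g • g • (u : V) = (v : V) + g • (v : V) + g • g • (v : V) :=
      congrArg Subtype.val huv
    have := h.indep hU h1 h2 d1 d2 d3 (U.sub_mem u.2 v.2) (mem1 _ (U.sub_mem u.2 v.2))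
      (mem2 _ (U.sub_mem u.2 v.2)) (by
        simp only [smul_sub]
        have e2 : (u : V) - v + (g • (u : V) - g • (v : V)) + (g • g • (u : V) - g • g • (v : V)) =
          ((u : V) + g • (u : V) + g • g • (u : V)) - ((v : V) + g • (v : V) + g • g • (v : V)) := by
            abel
        rw [e2, e, sub_self])
    exact Subtype.ext (sub_eq_zero.1 this.1)
  · rintro ⟨v, hv⟩
    rw [mem_fx] at hv
    obtain ⟨a, ha, b, hb, c, hc, e⟩ := h.decomp hU h1 h2 d1 d2 d3 v
    rw [AddSubgroup.mem_smul_pointwise_iff_exists] at hb hc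
    obtain ⟨b, hb, rfl⟩ := hb
    obtain ⟨c', hc', rfl⟩ := hc
    rw [AddSubgroup.mem_smul_pointwise_iff_exists] at hc'
    obtain ⟨c, hc, rfl⟩ := hc'
    have e2 : v = c + g • a + g • g • b := by
      conv_lhs => rw [← hv, e]
      rw [smul_add, smul_add, hg3]; abel
    have := h.indep hU h1 h2 d1 d2 d3 (U.add_mem ha hc) (mem1 _ (U.add_mem hb ha))
      (mem2 _ (U.add_mem hc hb)) (by
        simp only [smul_add]
        have e3 : a + c + (g • b + g • a) + (g • g • c + g • g • b) =
          (a + g • b + g • g • c) + (c + g • a + g • g • b) := by abel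
        rw [e3, ← e, ← e2]; exact h.two v)
    have ac : a = c := h.eq_of_add this.1
    have ba : b = a := h.eq_of_add ((smul_eq_zero_iff_eq g).1 this.2.1)
    refine ⟨⟨a, ha⟩, Subtype.ext ?_⟩
    change a + g • a + g • g • a = v
    rw [e, ← ac, ba]

/-- kernel of the action on the members -/
def ker (O : Set (AddSubgroup V)) : Subgroup R where
  carrier := {g | ∀ U ∈ O, g • U = U}
  mul_mem' := fun {a b} ha hb U hU => by rw [mul_smul, hb U hU, ha U hU]
  one_mem' := fun U _ => one_smul _ U
  inv_mem' := fun {a} ha U hU => by rw [inv_smul_eq_iff, ha U hU]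

theorem mem_ker {g : R} : g ∈ ker (R := R) O ↔ ∀ U ∈ O, g • U = U := Iff.rfl

theorem toEnd_mem {g : R} (hg : g ∈ ker (R := R) O) :
    (DistribSMul.toAddMonoidHom V g : AddMonoid.End V) ∈ PHK O := by
  intro U hU u hu
  change g • u ∈ U
  have := AddSubgroup.smul_mem_pointwise_smul u g U hu
  rwa [hg U hU] at this

theorem ker_fpf (h : PHO m O) [FaithfulSMul R V] {g : R} (hg : g ∈ ker (R := R) O) (h1 : g ≠ 1)
    {v : V} (hv : g • v = v) : v = 0 := by
  by_contra hv0
  have hk := sub_mem (toEnd_mem hg) (one_mem (PHK O))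
  have := h.eq_zero_of_kill hk hv0 (by
    change g • v - v = 0
    rw [hv, sub_self])
  apply h1
  apply FaithfulSMul.eq_of_smul_eq_smul (α := V)
  intro w
  have := DFunLike.congr_fun this w
  change g • w - w = 0 at this
  rw [one_smul]; exact sub_eq_zero.1 this

theorem ker_card (h : PHO m O) [FaithfulSMul R V] (hK : Nat.card (PHK O) ≤ 4)
    (L : List R) (hn : L.Nodup) (hL : ∀ g ∈ L, g ∈ ker (R := R) O) : L.length ≤ 3 := by
  have := h.card_le_of_list (0 :: L.map (fun g => (DistribSMul.toAddMonoidHom V g : AddMonoid.End V)))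
    (by
      rw [List.nodup_cons]
      constructor
      · intro h0
        obtain ⟨g, -, hg⟩ := List.mem_map.1 h0
        obtain ⟨J, hJ, -⟩ := h.exists_third ⊥ ⊥
        obtain ⟨u, -, hu0⟩ := h.exists_nz hJ
        have := DFunLike.congr_fun hg u
        change g • u = 0 at this
        exact hu0 ((smul_eq_zero_iff_eq g).1 this)
      · refine List.Nodup.map ?_ hn
        intro a b hab
        apply FaithfulSMul.eq_of_smul_eq_smul (α := V)
        intro w
        exact DFunLike.congr_fun hab w)
    (by
      intro k hk
      rw [List.mem_cons] at hk
      rcases hk with rfl | hk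
      · exact zero_mem _
      · obtain ⟨g, hg, rfl⟩ := List.mem_map.1 hk
        exact toEnd_mem (hL g hg))
  have h2 := this.trans hK
  rw [List.length_cons] at h2
  have h3 : (L.map (fun g => (DistribSMul.toAddMonoidHom V g : AddMonoid.End V))).length = L.length := List.length_map (as := L) _
  have h4 : (L.map (fun g => (DistribSMul.toAddMonoidHom V g : AddMonoid.End V))).length + 1 ≤ 4 := h2
  omega

theorem ker_normal' (hst : ∀ g : R, ∀ U ∈ O, g • U ∈ O) : (ker (R := R) O).Normal := by
  constructor
  intro n hn g U hU
  rw [mul_smul, mul_smul, hn _ (hst g⁻¹ U hU), smul_inv_smul]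

theorem ker_two (h : PHO m O) [FaithfulSMul R V] (hK : Nat.card (PHK O) ≤ 4) (hp : IsPGroup 3 R)
    {r s : R} (hr : r ∈ ker (R := R) O) (hs : s ∈ ker (R := R) O) (hr1 : r ≠ 1) (hs1 : s ≠ 1) :
    s = r ∨ s = r⁻¹ := by
  by_contra! hc
  have hrr : r ≠ r⁻¹ := by
    intro e
    have h2 : r ^ 2 = 1 := by rw [pow_two]; nth_rw 1 [e]; exact inv_mul_cancel r
    have := odd_orderOf_of_isPGroup Nat.prime_three (by norm_num) hp r
    have h3 := orderOf_dvd_of_pow_eq_one h2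
    rcases (Nat.dvd_prime Nat.prime_two).1 h3 with e | e
    · exact hr1 (orderOf_eq_one_iff.1 e)
    · rw [e] at this; exact absurd this (by decide)
  have := h.ker_card hK [1, r, r⁻¹, s] (by
    simp [hr1, hr1.symm, hs1.symm, hrr, hc.1.symm, hc.2.symm]) (by
    intro g hg
    simp only [List.mem_cons, List.not_mem_nil, or_false] at hg
    rcases hg with rfl | rfl | rfl | rfl
    exacts [one_mem _, hr, inv_mem hr, hs])
  simp at this

theorem ker_cube (h : PHO m O) [FaithfulSMul R V] (hK : Nat.card (PHK O) ≤ 4) (hp : IsPGroup 3 R)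
    {r : R} (hr : r ∈ ker (R := R) O) : r ^ 3 = 1 := by
  by_contra hc
  have hr1 : r ≠ 1 := by rintro rfl; exact hc (one_pow 3)
  have hodd := odd_orderOf_of_isPGroup Nat.prime_three (by norm_num) hp r
  have h2 : r ^ 2 ≠ 1 := by
    intro h2
    have h3 := orderOf_dvd_of_pow_eq_one h2
    rcases (Nat.dvd_prime Nat.prime_two).1 h3 with e | e
    · exact hr1 (orderOf_eq_one_iff.1 e)
    · rw [e] at hodd; exact absurd hodd (by decide)
  rcases h.ker_two hK hp hr (pow_mem hr 2) hr1 h2 with e | e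
  · apply hr1
    rw [pow_two] at e
    exact mul_eq_left.1 e
  · apply hc
    rw [pow_succ, e, inv_mul_cancel]

theorem ker_central (h : PHO m O) [FaithfulSMul R V] (hK : Nat.card (PHK O) ≤ 4)
    (hp : IsPGroup 3 R) (hst : ∀ g : R, ∀ U ∈ O, g • U ∈ O)
    {r : R} (hr : r ∈ ker (R := R) O) (g : R) : g * r = r * g := by
  by_cases hr1 : r = 1
  · subst hr1; simp
  have hn := ker_normal' hst
  have hodd := odd_orderOf_of_isPGroup Nat.prime_three (by norm_num) hp g
  have c1 : g * r * g⁻¹ ∈ ker (R := R) O := hn.conj_mem r hr g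
  have n1 : g * r * g⁻¹ ≠ 1 := by simpa using hr1
  rcases h.ker_two hK hp hr c1 hr1 n1 with e | e
  · exact mul_inv_eq_iff_eq_mul.1 e
  · have h2 : Commute (g ^ 2) r := by
      have : g * (g * r * g⁻¹) * g⁻¹ = r := by
        rw [e, ← conj_inv, e, inv_inv]
      have h3 : g ^ 2 * r * (g ^ 2)⁻¹ = r := by
        have h4 : g ^ 2 * r * (g ^ 2)⁻¹ = g * (g * r * g⁻¹) * g⁻¹ := by rw [pow_two]; group
        rw [h4, this]
      exact mul_inv_eq_iff_eq_mul.1 h3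
    obtain ⟨k, hk⟩ := hodd
    have h3 : g = (g ^ 2) ^ (k + 1) := by
      rw [← pow_mul, show 2 * (k + 1) = orderOf g + 1 by omega, pow_succ, pow_orderOf_eq_one, one_mul]
    rw [h3]
    exact (h2.pow_left _)

end PHO

end PartF1

section PartF2g

open scoped Pointwise

/-- an element of 3-power order acting semiregularly on an invariant finite set -/
theorem ph_cyc {R α : Type*} [Group R] [MulAction R α] [Finite α] {g : R} (k : ℕ)
    (ho : orderOf g = 3 ^ (k + 1)) (S : Set α) (hS : ∀ v ∈ S, g • v ∈ S)
    (hf : ∀ v ∈ S, g ^ (3 ^ k) • v ≠ v) : 3 ^ (k + 1) ∣ S.ncard := by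
  have hpow : ∀ n : ℕ, ∀ v ∈ S, g ^ n • v ∈ S := by
    intro n
    induction n with
    | zero => intro v hv; simpa using hv
    | succ n ih => intro v hv; rw [pow_succ', mul_smul]; exact hS _ (ih v hv)
  have hfo : IsOfFinOrder g := by
    rw [← orderOf_pos_iff, ho]; positivity
  let A : SubMulAction (Subgroup.zpowers g) α :=
    { carrier := S
      smul_mem' := by
        rintro ⟨c, hc⟩ v hv
        rw [← hfo.mem_powers_iff_mem_zpowers] at hc
        obtain ⟨n, rfl⟩ := hc
        exact hpow n v hv }
  have hfin : Finite (Subgroup.zpowers g) := Nat.finite_of_card_ne_zero (by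
    rw [Nat.card_zpowers, ho]; positivity)
  have hfinA : Finite A := Subtype.finite
  have := ph_free (H := Subgroup.zpowers g) (α := A) (by
    rintro ⟨v, hv⟩ ⟨c, hc⟩ e
    rw [← hfo.mem_powers_iff_mem_zpowers] at hc
    obtain ⟨n, rfl⟩ := hc
    have e1 : g ^ n • v = v := congrArg Subtype.val e
    have h1 : Function.minimalPeriod (g • ·) v ∣ n := MulAction.pow_smul_eq_iff_minimalPeriod_dvd.1 e1
    have h2 : Function.minimalPeriod (g • ·) v ∣ 3 ^ (k + 1) :=
      MulAction.pow_smul_eq_iff_minimalPeriod_dvd.1 (by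
        rw [← ho, pow_orderOf_eq_one, one_smul])
    have h3 : ¬ Function.minimalPeriod (g • ·) v ∣ 3 ^ k := fun h3 =>
      hf v hv (MulAction.pow_smul_eq_iff_minimalPeriod_dvd.2 h3)
    have h4 : Function.minimalPeriod (g • ·) v = 3 ^ (k + 1) := by
      obtain ⟨j, hj, e⟩ := (Nat.dvd_prime_pow Nat.prime_three).1 h2
      rw [e] at h3 ⊢
      rcases Nat.lt_or_ge j (k + 1) with h | h
      · exact absurd (pow_dvd_pow 3 (by omega)) h3
      · rw [show j = k + 1 by omega]
    rw [h4, ← ho] at h1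
    exact Subtype.ext (orderOf_dvd_iff_pow_eq_one.1 h1))
  rw [Nat.card_zpowers, ho] at this
  exact this

namespace PHO
variable {V : Type*} [AddCommGroup V] {O : Set (AddSubgroup V)}
variable {R : Type*} [Group R] [DistribMulAction R V]

theorem card_nz (h : PHO 4 O) (A : AddSubgroup V) : ((A : Set V) \ {0}).ncard = Nat.card A - 1 := by
  have := h.fin
  rw [Set.ncard_sdiff (by simpa using A.zero_mem), Set.ncard_singleton]
  rfl

/-- fixed vectors of `g` on a sum of three fixed members -/
theorem fx_prod (h : PHO 4 O) {g : R} {U W T : AddSubgroup V} (hU : U ∈ O) (hW : W ∈ O) (hT : T ∈ O)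
    (d1 : U ≠ W) (d2 : U ≠ T) (d3 : W ≠ T) (gU : g • U = U) (gW : g • W = W) (gT : g • T = T) :
    Nat.card (fx V g) = Nat.card (fx V g ⊓ U : AddSubgroup V) *
      (Nat.card (fx V g ⊓ W : AddSubgroup V) * Nat.card (fx V g ⊓ T : AddSubgroup V)) := by
  have mem : ∀ {A : AddSubgroup V}, g • A = A → ∀ u ∈ A, g • u ∈ A := by
    intro A hA u hu
    have := AddSubgroup.smul_mem_pointwise_smul u g A hu
    rwa [hA] at this
  rw [← Nat.card_prod, ← Nat.card_prod]
  symm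
  let f : (fx V g ⊓ U : AddSubgroup V) × (fx V g ⊓ W : AddSubgroup V) × (fx V g ⊓ T : AddSubgroup V)
    → fx V g := fun p => ⟨(p.1 : V) + p.2.1 + p.2.2,
      (fx V g).add_mem ((fx V g).add_mem p.1.2.1 p.2.1.2.1) p.2.2.2.1⟩
  refine Nat.card_eq_of_bijective f ⟨?_, ?_⟩
  · rintro ⟨⟨a, ha⟩, ⟨b, hb⟩, ⟨c, hc⟩⟩ ⟨⟨a', ha'⟩, ⟨b', hb'⟩, ⟨c', hc'⟩⟩ e
    have e1 : a + b + c = a' + b' + c' := congrArg Subtype.val e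
    have := h.indep hU hW hT d1 d2 d3 (U.sub_mem ha.2 ha'.2) (W.sub_mem hb.2 hb'.2)
      (T.sub_mem hc.2 hc'.2) (by
        have : a - a' + (b - b') + (c - c') = (a + b + c) - (a' + b' + c') := by abel
        rw [this, e1, sub_self])
    simp only [Prod.mk.injEq, Subtype.mk.injEq]
    exact ⟨sub_eq_zero.1 this.1, sub_eq_zero.1 this.2.1, sub_eq_zero.1 this.2.2⟩
  · rintro ⟨v, hv⟩
    obtain ⟨a, ha, b, hb, c, hc, e⟩ := h.decomp hU hW hT d1 d2 d3 v
    rw [mem_fx] at hv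
    have := h.indep hU hW hT d1 d2 d3 (U.sub_mem (mem gU a ha) ha) (W.sub_mem (mem gW b hb) hb)
      (T.sub_mem (mem gT c hc) hc) (by
        have : g • a - a + (g • b - b) + (g • c - c) = g • (a + b + c) - (a + b + c) := by
          rw [smul_add, smul_add]; abel
        rw [this, ← e, hv, sub_self])
    exact ⟨⟨⟨a, sub_eq_zero.1 this.1, ha⟩, ⟨b, sub_eq_zero.1 this.2.1, hb⟩,
      ⟨c, sub_eq_zero.1 this.2.2, hc⟩⟩, Subtype.ext e.symm⟩

theorem claimA (h : PHO 4 O) [FaithfulSMul R V] (hK : Nat.card (PHK O) ≤ 4) (hp : IsPGroup 3 R)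
    (hst : ∀ g : R, ∀ U ∈ O, g • U ∈ O) {y : R} (hy : y ^ 3 ∈ ker (R := R) O)
    {U1 U2 U3 U4 : AddSubgroup V} (h1 : U1 ∈ O) (h2 : U2 ∈ O) (h3 : U3 ∈ O) (h4 : U4 ∈ O)
    (d12 : U1 ≠ U2) (d13 : U1 ≠ U3) (d14 : U1 ≠ U4) (d23 : U2 ≠ U3) (d24 : U2 ≠ U4) (d34 : U3 ≠ U4)
    (y1 : y • U1 = U1) (y2 : y • U2 = U2) (y3 : y • U3 = U3) (y4 : y • U4 = U4) :
    y ∈ ker (R := R) O := by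
  have := h.fin
  by_cases hy1 : y ^ 3 = 1
  · by_contra hyk
    rw [mem_ker] at hyk
    push Not at hyk
    obtain ⟨W, hW, hyW⟩ := hyk
    have c16 := h.K1 hst hy1 hW hyW
    have e1 := h.fx_prod h1 h2 h3 d12 d13 d23 y1 y2 y3
    have e2 := h.fx_prod h1 h2 h4 d12 d14 d24 y1 y2 y4
    have e3 := h.fx_prod h1 h3 h4 d13 d14 d34 y1 y3 y4
    have e4 := h.fx_prod h2 h3 h4 d23 d24 d34 y2 y3 y4
    rw [c16] at e1 e2 e3 e4
    generalize Nat.card (fx V y ⊓ U1 : AddSubgroup V) = a at *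
    generalize Nat.card (fx V y ⊓ U2 : AddSubgroup V) = b at *
    generalize Nat.card (fx V y ⊓ U3 : AddSubgroup V) = c at *
    generalize Nat.card (fx V y ⊓ U4 : AddSubgroup V) = d at *
    norm_num at e1 e2 e3 e4
    have ha : a ≠ 0 := by rintro rfl; omega
    have hb : b ≠ 0 := by rintro rfl; omega
    have hc : c ≠ 0 := by rintro rfl; omega
    have cd : c = d := by
      have := e1.symm.trans e2
      exact mul_left_cancel₀ hb (mul_left_cancel₀ ha this)
    subst cd
    have bc : b = c := by
      have := e1.symm.trans e3
      exact mul_right_cancel₀ hc (mul_left_cancel₀ ha this)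
    subst bc
    have ab : a = b := by
      have := e1.symm.trans e4
      exact mul_right_cancel₀ (mul_ne_zero hb hb) this
    subst ab
    have : a < 3 := by
      by_contra h3
      have : 3 * 3 ≤ a * a := Nat.mul_le_mul (by omega) (by omega)
      have : 3 * (3 * 3) ≤ a * (a * a) := Nat.mul_le_mul (by omega) this
      omega
    interval_cases a <;> omega
  · exfalso
    have ho : orderOf y = 3 ^ (1 + 1) := by
      haveI : Fact (Nat.Prime 3) := ⟨Nat.prime_three⟩
      apply orderOf_eq_prime_pow
      · simpa using hy1
      · have := h.ker_cube hK hp hy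
        rw [← pow_mul] at this
        simpa using this
    have := ph_cyc 1 ho ((U1 : Set V) \ {0}) (by
      rintro v ⟨hv, hv0⟩
      have := AddSubgroup.smul_mem_pointwise_smul v y U1 hv
      rw [y1] at this
      refine ⟨this, ?_⟩
      intro e
      exact hv0 ((smul_eq_zero_iff_eq y).1 e)) (by
      rintro v ⟨hv, hv0⟩ e
      rw [pow_one] at e
      exact hv0 (h.ker_fpf hy hy1 e))
    rw [h.card_nz, h.cardU U1 h1] at this
    norm_num at this

theorem claimA2 (h : PHO 4 O) [FaithfulSMul R V] (hK : Nat.card (PHK O) ≤ 4) (hp : IsPGroup 3 R)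
    (hst : ∀ g : R, ∀ U ∈ O, g • U ∈ O) {y : R}
    {U1 U2 U3 U4 : AddSubgroup V} (h1 : U1 ∈ O) (h2 : U2 ∈ O) (h3 : U3 ∈ O) (h4 : U4 ∈ O)
    (d12 : U1 ≠ U2) (d13 : U1 ≠ U3) (d14 : U1 ≠ U4) (d23 : U2 ≠ U3) (d24 : U2 ≠ U4) (d34 : U3 ≠ U4)
    (y1 : y • U1 = U1) (y2 : y • U2 = U2) (y3 : y • U3 = U3) (y4 : y • U4 = U4) :
    y ∈ ker (R := R) O := by
  obtain ⟨k, hk⟩ := hp y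
  have hk' : y ^ 3 ^ k ∈ ker (R := R) O := by rw [hk]; exact one_mem _
  clear hk
  have pf : ∀ (n : ℕ) {U : AddSubgroup V}, y • U = U → y ^ n • U = U := by
    intro n U hU
    exact (MulAction.stabilizer R U).pow_mem (x := y) hU n
  induction k with
  | zero => simpa using hk'
  | succ k ih =>
    apply ih
    refine h.claimA hK hp hst ?_ h1 h2 h3 h4 d12 d13 d14 d23 d24 d34 (pf _ y1) (pf _ y2) (pf _ y3)
      (pf _ y4)
    rw [← pow_mul, ← pow_succ]; exact hk'

end PHO

end PartF2g

section PartF3g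

open scoped Pointwise

namespace PHO
variable {V : Type*} [AddCommGroup V] {O : Set (AddSubgroup V)}
variable {R : Type*} [Group R] [DistribMulAction R V]

theorem exists_four {α : Type*} {S : Set α} (hS : 4 ≤ S.ncard) :
    ∃ a ∈ S, ∃ b ∈ S, ∃ c ∈ S, ∃ d ∈ S, a ≠ b ∧ a ≠ c ∧ a ≠ d ∧ b ≠ c ∧ b ≠ d ∧ c ≠ d := by
  have hfin : Finite S := Nat.finite_of_card_ne_zero (by
    have : Nat.card S = S.ncard := rfl
    omega)
  have := Fintype.ofFinite S
  have hc : Fintype.card (Fin 4) ≤ Fintype.card S := by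
    rw [Fintype.card_fin, ← Nat.card_eq_fintype_card]; exact hS
  obtain ⟨f⟩ := Function.Embedding.nonempty_of_card_le hc
  have hne : ∀ i j : Fin 4, i ≠ j → (f i : α) ≠ f j := fun i j hij e =>
    hij (f.injective (Subtype.ext e))
  exact ⟨f 0, (f 0).2, f 1, (f 1).2, f 2, (f 2).2, f 3, (f 3).2, hne _ _ (by decide),
    hne _ _ (by decide), hne _ _ (by decide), hne _ _ (by decide), hne _ _ (by decide),
    hne _ _ (by decide)⟩

/-- members are permuted in a commuting way if the commutator lies in the kernel -/
theorem smul_comm_of (hst : ∀ g : R, ∀ U ∈ O, g • U ∈ O) {a b : R}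
    (hc : a * b * a⁻¹ * b⁻¹ ∈ ker (R := R) O) {U : AddSubgroup V} (hU : U ∈ O) :
    a • b • U = b • a • U := by
  have := hc _ (hst (b * a) U hU)
  rw [← mul_smul] at this
  rw [← mul_smul, ← mul_smul, ← this]
  congr 1
  group

theorem exists_z (h : PHO 4 O) [FaithfulSMul R V] (hK : Nat.card (PHK O) ≤ 4) (hp : IsPGroup 3 R)
    (hst : ∀ g : R, ∀ U ∈ O, g • U ∈ O)
    (horb : ∀ U ∈ O, (MulAction.orbit R U).ncard = 9) :
    ∃ z : R, z ^ 3 ∈ ker (R := R) O ∧ (∀ g, z * g * z⁻¹ * g⁻¹ ∈ ker (R := R) O) ∧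
      ∀ U ∈ O, z • U ≠ U := by
  haveI : Fact (Nat.Prime 3) := ⟨Nat.prime_three⟩
  have hfR := h.finG (G := R)
  have hn := ker_normal' (O := O) (R := R) hst
  let Q := R ⧸ (ker (R := R) O)
  have hQ : IsPGroup 3 Q := hp.to_quotient _
  have hnt : Nontrivial Q := by
    rw [QuotientGroup.nontrivial_iff]
    intro ht
    obtain ⟨U, hU, -⟩ := h.exists_third ⊥ ⊥
    have : MulAction.orbit R U = {U} := by
      ext W
      constructor
      · rintro ⟨g, rfl⟩
        have : g ∈ ker (R := R) O := by rw [ht]; trivial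
        exact this U hU
      · rintro rfl
        exact MulAction.mem_orbit_self _
    have h9 := horb U hU
    rw [this, Set.ncard_singleton] at h9
    omega
  have hcn : Nontrivial (Subgroup.center Q) := hQ.center_nontrivial
  have hcp : IsPGroup 3 (Subgroup.center Q) := hQ.to_subgroup _
  obtain ⟨k, hk0, hk⟩ := hcp.nontrivial_iff_card.1 hcn
  obtain ⟨c, hc⟩ := exists_prime_orderOf_dvd_card' (G := Subgroup.center Q) 3 (by
    rw [hk]; exact dvd_pow_self 3 (by omega))
  obtain ⟨z, hz⟩ := QuotientGroup.mk_surjective (c : Q)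
  have hzk : z ∉ ker (R := R) O := by
    intro hzk
    have : (c : Q) = 1 := by rw [← hz]; exact (QuotientGroup.eq_one_iff z).2 hzk
    have : c = 1 := Subtype.ext this
    rw [this, orderOf_one] at hc
    omega
  have hcomm : ∀ g, z * g * z⁻¹ * g⁻¹ ∈ ker (R := R) O := by
    intro g
    rw [← QuotientGroup.eq_one_iff]
    have := Subgroup.mem_center_iff.1 c.2 (g : Q)
    rw [QuotientGroup.mk_mul, QuotientGroup.mk_mul, QuotientGroup.mk_mul, QuotientGroup.mk_inv,
      QuotientGroup.mk_inv, hz, ← this]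
    group
  refine ⟨z, ?_, hcomm, ?_⟩
  · rw [← QuotientGroup.eq_one_iff, QuotientGroup.mk_pow, hz, ← Subgroup.coe_pow, ← hc,
      pow_orderOf_eq_one, Subgroup.coe_one]
  · intro U hU hzU
    apply hzk
    obtain ⟨_, ⟨a, rfl⟩, _, ⟨b, rfl⟩, _, ⟨c, rfl⟩, _, ⟨d, rfl⟩, d1, d2, d3, d4, d5, d6⟩ :=
      exists_four (S := MulAction.orbit R U) (by rw [horb U hU]; norm_num)
    have fixd : ∀ g : R, z • g • U = g • U := by
      intro g
      rw [smul_comm_of hst (hcomm g) hU, hzU]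
    exact h.claimA2 hK hp hst (hst a U hU) (hst b U hU) (hst c U hU) (hst d U hU) d1 d2 d3 d4 d5 d6
      (fixd a) (fixd b) (fixd c) (fixd d)

theorem smul_zpow_comm (hst : ∀ g : R, ∀ U ∈ O, g • U ∈ O) {z : R}
    (hc : ∀ g, z * g * z⁻¹ * g⁻¹ ∈ ker (R := R) O) (g : R) (i : ℤ)
    {U : AddSubgroup V} (hU : U ∈ O) : z ^ i • g • U = g • z ^ i • U := by
  have hn := ker_normal' (O := O) (R := R) hst
  refine smul_comm_of hst ?_ hU
  have h1 := hc g
  rw [← QuotientGroup.eq_one_iff] at h1 ⊢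
  simp only [QuotientGroup.mk_mul, QuotientGroup.mk_inv, QuotientGroup.mk_zpow] at h1 ⊢
  have h2 : Commute (z : R ⧸ (ker (R := R) O)) (g : R ⧸ (ker (R := R) O)) := by
    rw [mul_inv_eq_one, mul_inv_eq_iff_eq_mul] at h1
    exact h1
  rw [(h2.zpow_left i).eq]
  group

theorem zpow_eq (hst : ∀ g : R, ∀ U ∈ O, g • U ∈ O) {z : R} (hz : z ^ 3 ∈ ker (R := R) O)
    {i : ℤ} {U : AddSubgroup V} (hU : U ∈ O) (hi : 3 ∣ i) : z ^ i • U = U := by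
  obtain ⟨k, rfl⟩ := hi
  have : z ^ (3 * k) = (z ^ 3) ^ k := by rw [zpow_mul]; norm_cast
  rw [this]
  exact zpow_mem hz k U hU

theorem zpow_ne (hst : ∀ g : R, ∀ U ∈ O, g • U ∈ O) {z : R} (hz : z ^ 3 ∈ ker (R := R) O)
    {i : ℤ} {U : AddSubgroup V} (hU : U ∈ O) (hzU : z • U ≠ U) (hi : z ^ i • U = U) : 3 ∣ i := by
  by_contra h3
  have hz3 := zpow_eq hst hz hU (dvd_refl 3)
  have hg : IsCoprime i 3 := by
    rw [Int.isCoprime_iff_gcd_eq_one, Int.gcd_comm]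
    exact (Int.prime_three.coprime_iff_not_dvd.2 h3 |> Int.isCoprime_iff_gcd_eq_one.1)
  obtain ⟨a, b, hab⟩ := hg
  apply hzU
  have h1 : z ^ i ∈ MulAction.stabilizer R U := hi
  have h2 : z ^ (3 : ℤ) ∈ MulAction.stabilizer R U := hz3
  have := mul_mem (zpow_mem h1 a) (zpow_mem h2 b)
  rw [← zpow_mul, ← zpow_mul, ← zpow_add, mul_comm i, mul_comm 3, hab, zpow_one] at this
  exact this

/-- the stabiliser of the `z`-block of `U` -/
theorem exists_N (h : PHO 4 O) [FaithfulSMul R V] (hp : IsPGroup 3 R)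
    (hst : ∀ g : R, ∀ U ∈ O, g • U ∈ O)
    (horb : ∀ U ∈ O, (MulAction.orbit R U).ncard = 9) {z : R} (hz : z ^ 3 ∈ ker (R := R) O)
    (hc : ∀ g, z * g * z⁻¹ * g⁻¹ ∈ ker (R := R) O) {U : AddSubgroup V} (hU : U ∈ O)
    (hzU : z • U ≠ U) :
    ∃ N : Subgroup R, (∀ g, g ∈ N ↔ ∃ i : ℤ, g • U = z ^ i • U) ∧ (∃ a, a ∉ N) ∧ 
      ∀ g, g ^ 3 ∈ N := by
  have hfR := h.finG (G := R)
  let N : Subgroup R :=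
    { carrier := {g | ∃ i : ℤ, g • U = z ^ i • U}
      one_mem' := ⟨0, by simp⟩
      mul_mem' := by
        rintro a b ⟨i, hi⟩ ⟨j, hj⟩
        refine ⟨j + i, ?_⟩
        rw [mul_smul, hj, ← smul_zpow_comm hst hc a j hU, hi, zpow_add, mul_smul]
      inv_mem' := by
        rintro a ⟨i, hi⟩
        refine ⟨-i, ?_⟩
        rw [inv_smul_eq_iff, ← smul_zpow_comm hst hc a (-i) hU, hi, ← mul_smul, ← zpow_add,
          neg_add_cancel, zpow_zero, one_smul] }
  have hle : MulAction.stabilizer R U ≤ N := fun g hg => ⟨0, by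
    rw [zpow_zero, one_smul]; exact hg⟩
  have hmul := Subgroup.relIndex_mul_index hle
  rw [MulAction.index_stabilizer, horb U hU] at hmul
  have h1 : N.index ≠ 1 := by
    intro h1
    rw [Subgroup.index_eq_one] at h1
    have hsub : MulAction.orbit R U ⊆ {U, z • U, z • z • U} := by
      rintro _ ⟨g, rfl⟩
      have : g ∈ N := by rw [h1]; trivial
      obtain ⟨i, hi⟩ := this
      change g • U ∈ _
      rw [hi]
      have h3 : z ^ i • U = z ^ (i % 3) • U := by
        conv_lhs => rw [← Int.emod_add_mul_ediv i 3]
        rw [zpow_add, mul_smul, zpow_eq hst hz hU ⟨_, rfl⟩]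
      rw [h3]
      have : i % 3 = 0 ∨ i % 3 = 1 ∨ i % 3 = 2 := by omega
      rcases this with e | e | e <;> rw [e]
      · simp
      · simp
      · right; right
        change z ^ (2 : ℤ) • U = z • z • U
        rw [zpow_two, mul_smul]
    have := Set.ncard_le_ncard hsub (Set.toFinite _)
    rw [horb U hU] at this
    have h3 : ({U, z • U, z • z • U} : Set (AddSubgroup V)).ncard ≤ 3 := by
      refine (Set.ncard_insert_le _ _).trans ?_
      have := Set.ncard_insert_le (z • U) {z • z • U}
      rw [Set.ncard_singleton] at this
      omega
    omega
  have h9 : (MulAction.stabilizer R U).relIndex N ≠ 1 := by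
    intro h9
    rw [Subgroup.relIndex_eq_one] at h9
    exact hzU (h9 (show z ∈ N from ⟨1, by simp⟩))
  have h3 : N.index = 3 := by
    have hd : N.index ∣ 3 ^ 2 := Dvd.intro_left _ hmul
    obtain ⟨k, hk, e⟩ := (Nat.dvd_prime_pow Nat.prime_three).1 hd
    interval_cases k
    · exact absurd e h1
    · exact e
    · rw [e] at hmul; omega
  haveI : Fact (Nat.Prime 3) := ⟨Nat.prime_three⟩
  have hnorm : N.Normal := by
    apply Subgroup.normal_of_index_eq_minFac_card
    obtain ⟨k, hk⟩ := IsPGroup.iff_card.1 hp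
    have hk0 : k ≠ 0 := by
      rintro rfl
      have := N.index_dvd_card
      rw [hk, h3] at this
      norm_num at this
    rw [h3, hk, Nat.Prime.pow_minFac Nat.prime_three hk0]
  refine ⟨N, fun g => Iff.rfl, ?_, ?_⟩
  · by_contra! hall
    apply h1
    rw [Subgroup.index_eq_one]
    exact Subgroup.ext (fun g => ⟨fun _ => trivial, fun _ => hall g⟩)
  · intro g
    rw [← h3]
    exact Subgroup.pow_index_mem N g

theorem exists_h {N1 N2 : Subgroup R} (h1 : ∃ a, a ∉ N1) (h2 : ∃ a, a ∉ N2) :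
    ∃ a, a ∉ N1 ∧ a ∉ N2 := by
  obtain ⟨a, ha⟩ := h1
  obtain ⟨b, hb⟩ := h2
  by_cases a2 : a ∈ N2
  · by_cases b1 : b ∈ N1
    · refine ⟨a * b, fun e => ha ?_, fun e => hb ?_⟩
      · exact (Subgroup.mul_mem_cancel_right _ b1).1 e
      · exact (Subgroup.mul_mem_cancel_left _ a2).1 e
    · exact ⟨b, b1, hb⟩
  · exact ⟨a, ha, a2⟩

/-- the cube of `h` is in the kernel -/
theorem h_cube (h : PHO 4 O) [FaithfulSMul R V] (hK : Nat.card (PHK O) ≤ 4) (hp : IsPGroup 3 R)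
    (hst : ∀ g : R, ∀ U ∈ O, g • U ∈ O) {z : R} (hz : z ^ 3 ∈ ker (R := R) O)
    (hc : ∀ g, z * g * z⁻¹ * g⁻¹ ∈ ker (R := R) O) {U : AddSubgroup V} (hU : U ∈ O)
    (hzU : z • U ≠ U) {g : R} (hg : ∀ i : ℤ, g • U ≠ z ^ i • U) (a : ℤ)
    (ha : g ^ 3 • U = z ^ a • U) : g ^ 3 ∈ ker (R := R) O := by
  have hfin := h.fin
  have hodd := odd_orderOf_of_isPGroup Nat.prime_three (by norm_num) hp z
  obtain ⟨d1, d2, d3⟩ := three_distinct hodd hzU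
  have yU : (z ^ (-a) * g ^ 3) • U = U := by
    rw [mul_smul, ha, ← mul_smul, ← zpow_add, neg_add_cancel, zpow_zero, one_smul]
  have yz : ∀ W ∈ O, (z ^ (-a) * g ^ 3) • W = W → (z ^ (-a) * g ^ 3) • z • W = z • W := by
    intro W hW e
    have h1 := smul_zpow_comm hst hc (g ^ 3) 1 hW
    rw [zpow_one] at h1
    rw [mul_smul, ← h1, ← mul_smul, ← zpow_add_one, add_comm, zpow_one_add, mul_smul, ← mul_smul (z ^ (-a)), e]
  have yg : (z ^ (-a) * g ^ 3) • g • U = g • U := by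
    have : (z ^ (-a) * g ^ 3) • g • U = z ^ (-a) • g • g ^ 3 • U := by
      rw [← mul_smul, ← mul_smul, ← mul_smul]; congr 1; group
    rw [this, smul_zpow_comm hst hc g (-a) (hst _ U hU), ← mul_smul (z ^ (-a)), yU]
  have yk := h.claimA2 hK hp hst hU (hst z U hU) (hst z _ (hst z U hU)) (hst g U hU) d1 d2
    (fun e => hg 0 (by rw [zpow_zero, one_smul]; exact e.symm)) d3
    (fun e => hg 1 (by rw [zpow_one]; exact e.symm))
    (fun e => hg 2 (by
      rw [← e, ← mul_smul]; congr 1; exact (zpow_two z).symm)) yU (yz U hU yU)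
    (yz _ (hst z U hU) (yz U hU yU)) yg
  set y := z ^ (-a) * g ^ 3 with hy
  have hgy : g ^ 3 = z ^ a * y := by rw [hy]; group
  have hyc := h.ker_central hK hp hst yk
  have hy3 := h.ker_cube hK hp yk
  by_cases h3a : 3 ∣ a
  · rw [hgy]
    refine mul_mem ?_ yk
    intro W hW
    exact zpow_eq hst hz hW h3a
  exfalso
  have hmv : g ^ 3 • U ≠ U := by
    rw [ha]; exact fun e => h3a (zpow_ne hst hz hU hzU e)
  have h9 : g ^ 9 ∈ ker (R := R) O := by
    have : g ^ 9 = (z ^ 3) ^ a := by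
      have hcom : Commute (z ^ a) y := hyc _
      rw [show 9 = 3 * 3 from rfl, pow_mul, hgy, hcom.mul_pow, hy3, mul_one, ← zpow_natCast (z ^ a), 
        ← zpow_mul, mul_comm, zpow_mul]
      norm_cast
    rw [this]
    exact zpow_mem hz a
  haveI : Fact (Nat.Prime 3) := ⟨Nat.prime_three⟩
  by_cases h91 : g ^ 9 = 1
  · have ho : orderOf g = 3 ^ (1 + 1) := by
      apply orderOf_eq_prime_pow
      · intro e
        apply hmv
        rw [show g ^ 3 = 1 by simpa using e, one_smul]
      · simpa using h91
    have h33 : (g ^ 3) ^ 3 = 1 := by rw [← pow_mul]; exact h91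
    have hk1 := h.K1 hst h33 hU hmv
    have := ph_cyc 1 ho ((fx V (g ^ 3) : Set V)ᶜ) (by
      intro v hv e
      apply hv
      have e' : g ^ 3 • g • v = g • v := e
      change g ^ 3 • v = v
      rw [← mul_smul, ← pow_succ, pow_succ', mul_smul] at e'
      exact smul_left_cancel g e') (by
      intro v hv e
      exact hv (show g ^ 3 • v = v by simpa using e))
    rw [Set.ncard_compl, h.cardV] at this
    have e : (fx V (g ^ 3) : Set V).ncard = 2 ^ 4 := hk1
    rw [e] at this
    norm_num at this
  · have ho : orderOf g = 3 ^ (2 + 1) := by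
      apply orderOf_eq_prime_pow
      · simpa using h91
      · have := h.ker_cube hK hp h9
        rw [← pow_mul] at this
        simpa using this
    have := ph_cyc 2 ho (((⊤ : AddSubgroup V) : Set V) \ {0}) (by
      rintro v ⟨-, hv0⟩
      refine ⟨trivial, ?_⟩
      intro e
      exact hv0 ((smul_eq_zero_iff_eq g).1 e)) (by
      rintro v ⟨-, hv0⟩ e
      exact hv0 (h.ker_fpf h9 h91 (by simpa using e)))
    rw [h.card_nz, AddSubgroup.card_top, h.cardV] at this
    norm_num at this

end PHO

end PartF3g

section PartF4g

open scoped Pointwise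

theorem ph_cube {R : Type*} [Group R] {z h c : R} (hc : ∀ g, g * c = c * g) (hc3 : c ^ 3 = 1)
    (e : z * h = c * h * z) : (z * h) ^ 3 = z ^ 3 * h ^ 3 := by
  have hd : ∀ g, g * c⁻¹ = c⁻¹ * g := fun g => by
    rw [mul_inv_eq_iff_eq_mul, mul_assoc, hc, inv_mul_cancel_left]
  have hz : h * z = c⁻¹ * (z * h) := by rw [e]; group
  have hd3 : c⁻¹ * (c⁻¹ * c⁻¹) = 1 := by
    have : c⁻¹ * (c⁻¹ * c⁻¹) = (c ^ 3)⁻¹ := by group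
    rw [this, hc3, inv_one]
  generalize c⁻¹ = d at *
  have a1 : ∀ x, h * (z * x) = d * (z * (h * x)) := fun x => by
    rw [← mul_assoc, hz]; simp only [mul_assoc]
  have a2 : ∀ g x, g * (d * x) = d * (g * x) := fun g x => by
    rw [← mul_assoc, hd, mul_assoc]
  have : (z * h) ^ 3 = d * (d * d) * (z ^ 3 * h ^ 3) := by
    simp only [pow_succ, pow_zero, one_mul, mul_assoc, a1, a2 z, a2 h]
  rw [this, hd3, one_mul]

namespace PHO
variable {V : Type*} [AddCommGroup V] {O : Set (AddSubgroup V)}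
variable {R : Type*} [Group R] [DistribMulAction R V]

def Good (z h : R) (U : AddSubgroup V) : Prop :=
  ∀ i j : ℤ, (z ^ i * h ^ j) • U = U → 3 ∣ i ∧ 3 ∣ j

theorem mk_smul {a b : R} (hab : a⁻¹ * b ∈ ker (R := R) O) {U : AddSubgroup V} (hU : U ∈ O) :
    a • U = b • U := by
  have := hab U hU
  rw [mul_smul, inv_smul_eq_iff] at this
  exact this.symm

theorem good_change (hst : ∀ g : R, ∀ U ∈ O, g • U ∈ O) {z h c : R} (hc : c ∈ ker (R := R) O)
    (e : z * h = c * h * z) (α β γ δ : ℤ) (hdet : ¬ 3 ∣ α * δ - β * γ) {t p : R}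
    (ht : t = z ^ α * h ^ β) (hp : p = z ^ γ * h ^ δ) {U : AddSubgroup V} (hU : U ∈ O)
    (hg : Good z h U) : Good t p U := by
  have hn := ker_normal' (O := O) (R := R) hst
  have hcom : Commute (z : R ⧸ (ker (R := R) O)) (h : R ⧸ (ker (R := R) O)) := by
    have h1 : (c : R ⧸ (ker (R := R) O)) = 1 := (QuotientGroup.eq_one_iff c).2 hc
    have := congrArg (QuotientGroup.mk (s := ker (R := R) O)) e
    rw [QuotientGroup.mk_mul, QuotientGroup.mk_mul, QuotientGroup.mk_mul, h1, one_mul] at this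
    exact this
  intro i j hij
  have key : (t ^ i * p ^ j)⁻¹ * (z ^ (α * i + γ * j) * h ^ (β * i + δ * j)) ∈ ker (R := R) O := by
    rw [← QuotientGroup.eq_one_iff, ht, hp]
    simp only [QuotientGroup.mk_mul, QuotientGroup.mk_inv, QuotientGroup.mk_zpow]
    rw [(hcom.zpow_zpow α β).mul_zpow, (hcom.zpow_zpow γ δ).mul_zpow, zpow_add, zpow_add,
      ← zpow_mul, ← zpow_mul, ← zpow_mul, ← zpow_mul, inv_mul_eq_one]
    have := (hcom.zpow_zpow (γ * j) (β * i)).eq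
    calc _ = (z : R ⧸ (ker (R := R) O)) ^ (α * i) * ((h : R ⧸ (ker (R := R) O)) ^ (β * i) * 
        (z : R ⧸ (ker (R := R) O)) ^ (γ * j)) * (h : R ⧸ (ker (R := R) O)) ^ (δ * j) := by
          simp only [mul_assoc]
      _ = _ := by rw [← this]; simp only [mul_assoc]
  rw [mk_smul key hU] at hij
  obtain ⟨h1, h2⟩ := hg _ _ hij
  have d1 : 3 ∣ (α * δ - β * γ) * i := by
    have := dvd_sub (Dvd.dvd.mul_left h1 δ) (Dvd.dvd.mul_left h2 γ)
    have e : (α * δ - β * γ) * i = δ * (α * i + γ * j) - γ * (β * i + δ * j) := by ring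
    rw [e]; exact this
  have d2 : 3 ∣ (α * δ - β * γ) * j := by
    have := dvd_sub (Dvd.dvd.mul_left h2 α) (Dvd.dvd.mul_left h1 β)
    have e : (α * δ - β * γ) * j = α * (β * i + δ * j) - β * (α * i + γ * j) := by ring
    rw [e]; exact this
  exact ⟨(Int.prime_three.dvd_or_dvd d1).resolve_left hdet,
    (Int.prime_three.dvd_or_dvd d2).resolve_left hdet⟩

theorem good_of (hst : ∀ g : R, ∀ U ∈ O, g • U ∈ O) {z h : R} (hz : z ^ 3 ∈ ker (R := R) O)
    (hh : h ^ 3 ∈ ker (R := R) O)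
    (hc : ∀ g, z * g * z⁻¹ * g⁻¹ ∈ ker (R := R) O) {U : AddSubgroup V} (hU : U ∈ O)
    (hzU : z • U ≠ U) (hg : ∀ i : ℤ, h • U ≠ z ^ i • U) : Good z h U := by
  intro i j hij
  rw [mul_smul] at hij
  have hj : 3 ∣ j := by
    by_contra hj
    have hjU : h ^ j • U = z ^ (-i) • U := by
      rw [zpow_neg, eq_inv_smul_iff]; exact hij
    have e3 : h ^ j • U = h ^ (j % 3) • U := by
      conv_lhs => rw [← Int.emod_add_mul_ediv j 3]
      rw [zpow_add, mul_smul, zpow_eq hst hh hU ⟨_, rfl⟩]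
    have : j % 3 = 1 ∨ j % 3 = 2 := by omega
    rcases this with e | e
    · rw [e3, e, zpow_one] at hjU
      exact hg _ hjU
    · have e4 : h ^ (j % 3) • U = h⁻¹ • U := by
        rw [e, show (2 : ℤ) = -1 + 3 by norm_num, zpow_add, mul_smul, zpow_eq hst hh hU (dvd_refl 3),
          zpow_neg_one]
      rw [e3, e4, inv_smul_eq_iff, ← smul_zpow_comm hst hc h (-i) hU, zpow_neg,
        eq_inv_smul_iff] at hjU
      exact hg _ hjU.symm
  refine ⟨?_, hj⟩
  rw [zpow_eq hst hh hU hj] at hij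
  exact zpow_ne hst hz hU hzU hij

/-- commuting case is impossible -/
theorem comm_false (h : PHO 4 O) [FaithfulSMul R V] (hK : Nat.card (PHK O) ≤ 4) (hp : IsPGroup 3 R)
    (hst : ∀ g : R, ∀ U ∈ O, g • U ∈ O) {t p : R} (ht : t ^ 3 = 1) (hpk : p ^ 3 ∈ ker (R := R) O)
    (hc : t * p = p * t) {U : AddSubgroup V} (hU : U ∈ O) (hg : Good t p U) : False := by
  have hfin := h.fin
  haveI : Fact (Nat.Prime 3) := ⟨Nat.prime_three⟩
  have htU : t • U ≠ U := by
    intro e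
    have := (hg 1 0 (by simpa using e)).1
    omega
  have hf := h.K1 hst ht hU htU
  by_cases hp1 : p ^ 3 = 1
  · have hcom : Commute t p := hc
    let H : Subgroup R :=
      { carrier := {g | ∃ i j : ℤ, g = t ^ i * p ^ j}
        one_mem' := ⟨0, 0, by simp⟩
        mul_mem' := by
          rintro _ _ ⟨i, j, rfl⟩ ⟨k, l, rfl⟩
          refine ⟨i + k, j + l, ?_⟩
          have := (hcom.zpow_zpow k j).eq
          calc _ = t ^ i * (p ^ j * t ^ k) * p ^ l := by simp only [mul_assoc]
            _ = _ := by rw [← this, zpow_add, zpow_add]; simp only [mul_assoc]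
        inv_mem' := by
          rintro _ ⟨i, j, rfl⟩
          refine ⟨-i, -j, ?_⟩
          rw [(hcom.zpow_zpow i j).eq, mul_inv_rev, zpow_neg, zpow_neg] }
    have hfR := h.finG (G := R)
    have hfix : ∀ g : H, g ≠ 1 → Nat.card (MulAction.fixedBy V g) = 16 := by
      rintro ⟨g, i, j, rfl⟩ hne
      have hmv : (t ^ i * p ^ j) • U ≠ U := by
        intro e
        obtain ⟨⟨a, rfl⟩, ⟨b, rfl⟩⟩ := hg i j e
        apply hne
        apply Subtype.ext
        change t ^ (3 * a) * p ^ (3 * b) = 1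
        rw [zpow_mul, zpow_mul]
        norm_cast
        rw [ht, hp1]; simp
      have h3 : (t ^ i * p ^ j) ^ 3 = 1 := by
        rw [(hcom.zpow_zpow i j).mul_pow, ← zpow_natCast, ← zpow_natCast, ← zpow_mul, ← zpow_mul,
          mul_comm, zpow_mul, mul_comm j, zpow_mul]
        norm_cast
        rw [ht, hp1]; simp
      exact h.K1 hst h3 hU hmv
    classical
    have := Fintype.ofFinite H
    have := Fintype.ofFinite V
    have := Fintype.ofFinite (Quotient (MulAction.orbitRel H V))
    have hB := MulAction.sum_card_fixedBy_eq_card_orbits_mul_card_group H V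
    have hs : ∑ g : H, Fintype.card (MulAction.fixedBy V g) = 4080 + 16 * Fintype.card H := by
      have : ∀ g : H, Fintype.card (MulAction.fixedBy V g) = 16 + if g = 1 then 4080 else 0 := by
        intro g
        rw [← Nat.card_eq_fintype_card]
        split_ifs with hg1
        · rw [hg1]
          have : MulAction.fixedBy V (1 : H) = Set.univ := by ext v; simp
          rw [this, Nat.card_univ, h.cardV]; norm_num
        · rw [hfix g hg1]
      rw [Finset.sum_congr rfl (fun g _ => this g), Finset.sum_add_distrib, Finset.sum_const,
        Finset.sum_ite_eq']
      simp [mul_comm, add_comm]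
    rw [hs] at hB
    have hd : Fintype.card H ∣ 4080 :=
      (Nat.dvd_add_left (Dvd.intro_left 16 rfl)).1 (hB ▸ Dvd.intro_left _ rfl)
    obtain ⟨k, hk⟩ := IsPGroup.iff_card.1 (hp.to_subgroup H)
    rw [← Nat.card_eq_fintype_card, hk] at hd
    have hk2 : k < 2 := by
      by_contra hk2
      have := (pow_dvd_pow 3 (show 2 ≤ k by omega)).trans hd
      norm_num at this
    have hdiv : ∀ i j : ℤ, t ^ i * p ^ j = 1 → 3 ∣ i ∧ 3 ∣ j := fun i j e => hg i j (by
      rw [e, one_smul])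
    let f : Fin 3 × Fin 3 → H := fun x => ⟨t ^ ((x.1 : ℕ) : ℤ) * p ^ ((x.2 : ℕ) : ℤ), _, _, rfl⟩
    have hinj : Function.Injective f := by
      rintro ⟨a, b⟩ ⟨c, d⟩ e
      have e1 : t ^ ((a : ℕ) : ℤ) * p ^ ((b : ℕ) : ℤ) = t ^ ((c : ℕ) : ℤ) * p ^ ((d : ℕ) : ℤ) :=
        congrArg Subtype.val e
      obtain ⟨h1, h2⟩ := hdiv (-((c : ℕ) : ℤ) + ((a : ℕ) : ℤ)) (((b : ℕ) : ℤ) + -((d : ℕ) : ℤ)) (by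
        rw [zpow_add, zpow_add, mul_assoc, ← mul_assoc (t ^ ((a : ℕ) : ℤ)), e1]
        group)
      have := a.2; have := b.2; have := c.2; have := d.2
      exact Prod.ext (Fin.ext (show (a : ℕ) = c by omega)) (Fin.ext (show (b : ℕ) = d by omega))
    have := Nat.card_le_card_of_injective f hinj
    rw [hk] at this
    simp only [Nat.card_eq_fintype_card, Fintype.card_prod, Fintype.card_fin] at this
    interval_cases k <;> omega
  · have ho : orderOf p = 3 ^ (1 + 1) := by
      apply orderOf_eq_prime_pow
      · simpa using hp1
      · have := h.ker_cube hK hp hpk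
        rw [← pow_mul] at this
        simpa using this
    have := ph_cyc 1 ho ((fx V t : Set V) \ {0}) (by
      rintro v ⟨hv, hv0⟩
      refine ⟨?_, fun e => hv0 ((smul_eq_zero_iff_eq p).1 e)⟩
      change t • p • v = p • v
      rw [← mul_smul, hc, mul_smul]
      congr 1) (by
      rintro v ⟨hv, hv0⟩ e
      rw [pow_one] at e
      exact hv0 (h.ker_fpf hpk hp1 e))
    rw [h.card_nz, hf] at this
    norm_num at this

theorem good_inj (hst : ∀ g : R, ∀ U ∈ O, g • U ∈ O) {z h c : R} (hc : c ∈ ker (R := R) O)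
    (e : z * h = c * h * z) {U : AddSubgroup V} (hU : U ∈ O) (hg : Good z h U) {i j k l : ℤ}
    (eq : (z ^ i * h ^ j) • U = (z ^ k * h ^ l) • U) : 3 ∣ i - k ∧ 3 ∣ j - l := by
  have hn := ker_normal' (O := O) (R := R) hst
  have hcom : Commute (z : R ⧸ (ker (R := R) O)) (h : R ⧸ (ker (R := R) O)) := by
    have h1 : (c : R ⧸ (ker (R := R) O)) = 1 := (QuotientGroup.eq_one_iff c).2 hc
    have := congrArg (QuotientGroup.mk (s := ker (R := R) O)) e
    rw [QuotientGroup.mk_mul, QuotientGroup.mk_mul, QuotientGroup.mk_mul, h1, one_mul] at this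
    exact this
  apply hg
  rw [← inv_smul_eq_iff, ← mul_smul] at eq
  refine Eq.trans (mk_smul (O := O) ?_ hU) eq
  rw [← QuotientGroup.eq_one_iff]
  simp only [QuotientGroup.mk_mul, QuotientGroup.mk_inv, QuotientGroup.mk_zpow]
  rw [inv_mul_eq_one, sub_eq_add_neg, add_comm, zpow_add, sub_eq_add_neg, add_comm j, zpow_add,
    (hcom.zpow_zpow k l).eq, mul_inv_rev, zpow_neg, zpow_neg]
  have := ((hcom.zpow_zpow i l).inv_right).eq
  calc _ = ((z : R ⧸ (ker (R := R) O)) ^ k)⁻¹ * ((z : R ⧸ (ker (R := R) O)) ^ i *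
        ((h : R ⧸ (ker (R := R) O)) ^ l)⁻¹) * (h : R ⧸ (ker (R := R) O)) ^ j := by
          simp only [mul_assoc]
      _ = _ := by rw [this]; simp only [mul_assoc]

/-- normalisation of the pair -/
theorem norm1 (h : PHO 4 O) [FaithfulSMul R V] (hK : Nat.card (PHK O) ≤ 4) (hp : IsPGroup 3 R)
    (hst : ∀ g : R, ∀ U ∈ O, g • U ∈ O) {z g c : R} (hz : z ^ 3 ∈ ker (R := R) O)
    (hg : g ^ 3 ∈ ker (R := R) O) (hc : c ∈ ker (R := R) O) (e : z * g = c * g * z)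
    {U1 U2 : AddSubgroup V} (h1 : U1 ∈ O) (h2 : U2 ∈ O) (g1 : Good z g U1) (g2 : Good z g U2) :
    ∃ z g c : R, z ^ 3 = 1 ∧ g ^ 3 ∈ ker (R := R) O ∧ c ∈ ker (R := R) O ∧ z * g = c * g * z ∧
      Good z g U1 ∧ Good z g U2 := by
  have hcc := h.ker_central hK hp hst hc
  have hc3 := h.ker_cube hK hp hc
  have hci := inv_mem hc
  have hcic := h.ker_central hK hp hst hci
  have hci3 := h.ker_cube hK hp hci
  by_cases hz1 : z ^ 3 = 1
  · exact ⟨z, g, c, hz1, hg, hc, e, g1, g2⟩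
  by_cases hg1 : g ^ 3 = 1
  · refine ⟨g, z, c⁻¹, hg1, hz, hci, by rw [mul_assoc, e]; group, ?_, ?_⟩
    · exact good_change hst hc e 0 1 1 0 (by norm_num) (by simp) (by simp) h1 g1
    · exact good_change hst hc e 0 1 1 0 (by norm_num) (by simp) (by simp) h2 g2
  rcases h.ker_two hK hp hz hg hz1 hg1 with e3 | e3
  · have e' : z⁻¹ * g = c⁻¹ * g * z⁻¹ := by
      rw [eq_mul_inv_iff_mul_eq, mul_assoc, inv_mul_eq_iff_eq_mul]
      rw [← mul_assoc z, hcic z, mul_assoc c⁻¹, e]; group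
    refine ⟨z⁻¹ * g, z, c⁻¹, ?_, hz, hci, ?_, ?_, ?_⟩
    · rw [ph_cube hcic hci3 e', e3]; group
    · calc z⁻¹ * g * z = c⁻¹ * g * z⁻¹ * z := by rw [e']
        _ = _ := by group
    · exact good_change hst hc e (-1) 1 1 0 (by norm_num) (by simp) (by simp) h1 g1
    · exact good_change hst hc e (-1) 1 1 0 (by norm_num) (by simp) (by simp) h2 g2
  · refine ⟨z * g, z, c⁻¹, ?_, hz, hci, ?_, ?_, ?_⟩
    · rw [ph_cube hcc hc3 e, e3]; group
    · have e4 : g * z = c⁻¹ * (z * g) := by rw [e]; group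
      rw [mul_assoc z, e4, ← mul_assoc z, hcic z]
    · exact good_change hst hc e 1 1 1 0 (by norm_num) (by simp) (by simp) h1 g1
    · exact good_change hst hc e 1 1 1 0 (by norm_num) (by simp) (by simp) h2 g2

end PHO

end PartF4g

section PartF5g

open scoped Pointwise

namespace PHO
variable {V : Type*} [AddCommGroup V] {O : Set (AddSubgroup V)}
variable {R : Type*} [Group R] [DistribMulAction R V]

theorem norm2 (h : PHO 4 O) [FaithfulSMul R V] (hK : Nat.card (PHK O) ≤ 4) (hp : IsPGroup 3 R)
    (hst : ∀ g : R, ∀ U ∈ O, g • U ∈ O) {z g c : R} (hz : z ^ 3 ∈ ker (R := R) O)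
    (hg : g ^ 3 ∈ ker (R := R) O) (hc : c ∈ ker (R := R) O) (e : z * g = c * g * z)
    {U1 U2 : AddSubgroup V} (h1 : U1 ∈ O) (h2 : U2 ∈ O) (g1 : Good z g U1) (g2 : Good z g U2) :
    ∃ z g c : R, z ^ 3 = 1 ∧ (g ^ 3 = 1 ∨ g ^ 3 = c) ∧ c ∈ ker (R := R) O ∧ c ≠ 1 ∧
      z * g = c * g * z ∧ Good z g U1 ∧ Good z g U2 := by
  obtain ⟨z, g, c, hz, hg, hc, e, g1, g2⟩ := h.norm1 hK hp hst hz hg hc e h1 h2 g1 g2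
  have hc1 : c ≠ 1 := by
    rintro rfl
    rw [one_mul] at e
    exact h.comm_false hK hp hst hz hg e h1 g1
  by_cases hg1 : g ^ 3 = 1
  · exact ⟨z, g, c, hz, Or.inl hg1, hc, hc1, e, g1, g2⟩
  rcases h.ker_two hK hp hc hg hc1 hg1 with e3 | e3
  · exact ⟨z, g, c, hz, Or.inr e3, hc, hc1, e, g1, g2⟩
  · have hci := inv_mem hc
    have hcic := h.ker_central hK hp hst hci
    have e' : z⁻¹ * g = c⁻¹ * g * z⁻¹ := by
      rw [eq_mul_inv_iff_mul_eq, mul_assoc, inv_mul_eq_iff_eq_mul]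
      rw [← mul_assoc z, hcic z, mul_assoc c⁻¹, e]; group
    refine ⟨z⁻¹, g, c⁻¹, ?_, Or.inr e3, hci, by simpa using hc1, e', ?_, ?_⟩
    · rw [inv_pow, hz, inv_one]
    · exact good_change hst hc e (-1) 0 0 1 (by norm_num) (by simp) (by simp) h1 g1
    · exact good_change hst hc e (-1) 0 0 1 (by norm_num) (by simp) (by simp) h2 g2

theorem group_part (h : PHO 4 O) [FaithfulSMul R V] (hK : Nat.card (PHK O) ≤ 4) (hp : IsPGroup 3 R)
    (hst : ∀ g : R, ∀ U ∈ O, g • U ∈ O)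
    (horb : ∀ U ∈ O, (MulAction.orbit R U).ncard = 9) :
    ∃ z g c : R, z ^ 3 = 1 ∧ (g ^ 3 = 1 ∨ g ^ 3 = c) ∧ c ∈ ker (R := R) O ∧ c ≠ 1 ∧
      z * g = c * g * z ∧ ∃ U1 ∈ O, ∃ U2 ∈ O, Good z g U1 ∧ Good z g U2 ∧
        (∀ x : R, x • U1 ≠ U2) ∧
        ∀ W ∈ O, ∃ i j : ℕ, W = (z ^ i * g ^ j) • U1 ∨ W = (z ^ i * g ^ j) • U2 := by
  obtain ⟨z, hz, hcz, hzU⟩ := h.exists_z hK hp hst horb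
  obtain ⟨U1, h1, -⟩ := h.exists_third ⊥ ⊥
  have hfinO : O.Finite := h.finO
  obtain ⟨U2, h2, hn⟩ : ∃ U2 ∈ O, U2 ∉ MulAction.orbit R U1 := by
    by_contra! hall
    have := Set.ncard_le_ncard (show O ⊆ MulAction.orbit R U1 from hall)
      (hfinO.subset (by rintro _ ⟨x, rfl⟩; exact hst x U1 h1))
    rw [horb U1 h1, h.ncard] at this
    norm_num at this
  obtain ⟨N1, hN1, a1, c1⟩ := h.exists_N hp hst horb hz hcz h1 (hzU U1 h1)
  obtain ⟨N2, hN2, a2, c2⟩ := h.exists_N hp hst horb hz hcz h2 (hzU U2 h2)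
  obtain ⟨g, hg1, hg2⟩ := exists_h a1 a2
  obtain ⟨a, ha⟩ := (hN1 _).1 (c1 g)
  rw [hN1] at hg1
  rw [hN2] at hg2
  push Not at hg1 hg2
  have hg := h.h_cube hK hp hst hz hcz h1 (hzU U1 h1) hg1 a ha
  have G1 := good_of hst hz hg hcz h1 (hzU U1 h1) hg1
  have G2 := good_of hst hz hg hcz h2 (hzU U2 h2) hg2
  obtain ⟨z, g, c, hz, hg, hc, hc1, e, G1, G2⟩ := h.norm2 hK hp hst hz hg (hcz g)
    (show z * g = z * g * z⁻¹ * g⁻¹ * g * z by group) h1 h2 G1 G2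
  have hx : ∀ x : R, x • U1 ≠ U2 := fun x hx => hn ⟨x, hx⟩
  refine ⟨z, g, c, hz, hg, hc, hc1, e, U1, h1, U2, h2, G1, G2, hx, ?_⟩
  let f : Bool × Fin 3 × Fin 3 → O := fun x =>
    ⟨(z ^ (x.2.1 : ℕ) * g ^ (x.2.2 : ℕ)) • (if x.1 then U1 else U2), by
      apply hst; split_ifs; exacts [h1, h2]⟩
  have hfO : Finite O := hfinO
  have := Fintype.ofFinite O
  have hinj : Function.Injective f := by
    have key : ∀ {U}, U ∈ O → Good z g U → ∀ a b c d : Fin 3,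
      (z ^ (a : ℕ) * g ^ (b : ℕ)) • U = (z ^ (c : ℕ) * g ^ (d : ℕ)) • U → a = c ∧ b = d := by
      intro U hU hG a b c d eq
      obtain ⟨h1, h2⟩ := good_inj hst hc e hU hG (i := (a : ℕ)) (j := (b : ℕ)) (k := (c : ℕ))
        (l := (d : ℕ)) (by simpa only [zpow_natCast] using eq)
      have := a.2; have := b.2; have := c.2; have := d.2
      exact ⟨Fin.ext (by omega), Fin.ext (by omega)⟩
    rintro ⟨s, a, b⟩ ⟨t, c, d⟩ eq
    have eq1 : (z ^ (a : ℕ) * g ^ (b : ℕ)) • (if s then U1 else U2) =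
      (z ^ (c : ℕ) * g ^ (d : ℕ)) • (if t then U1 else U2) := congrArg Subtype.val eq
    cases s <;> cases t <;> simp only [Bool.false_eq_true, if_true, if_false] at eq1
    · obtain ⟨rfl, rfl⟩ := key h2 G2 _ _ _ _ eq1; rfl
    · exfalso
      refine hx ((z ^ (a : ℕ) * g ^ (b : ℕ))⁻¹ * (z ^ (c : ℕ) * g ^ (d : ℕ))) ?_
      rw [mul_smul, inv_smul_eq_iff]; exact eq1.symm
    · exfalso
      refine hx ((z ^ (c : ℕ) * g ^ (d : ℕ))⁻¹ * (z ^ (a : ℕ) * g ^ (b : ℕ))) ?_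
      rw [mul_smul, inv_smul_eq_iff]; exact eq1
    · obtain ⟨rfl, rfl⟩ := key h1 G1 _ _ _ _ eq1; rfl
  have hbij : Function.Bijective f := by
    rw [Fintype.bijective_iff_injective_and_card]
    refine ⟨hinj, ?_⟩
    rw [← Nat.card_eq_fintype_card (α := O)]
    have : Nat.card O = 18 := h.ncard
    rw [this]; rfl
  intro W hW
  obtain ⟨⟨s, a, b⟩, hs⟩ := hbij.2 ⟨W, hW⟩
  have hs1 : (z ^ (a : ℕ) * g ^ (b : ℕ)) • (if s then U1 else U2) = W := congrArg Subtype.val hs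
  refine ⟨a, b, ?_⟩
  cases s
  · right; simpa using hs1.symm
  · left; simpa using hs1.symm

/-- orbit lengths of a Sylow 3-subgroup -/
theorem sylow_orbits {G : Type*} [Group G] [DistribMulAction G V] [FaithfulSMul G V] (h : PHO 4 O)
    (hst : ∀ g : G, ∀ U ∈ O, g • U ∈ O)
    (htr : ∀ U ∈ O, ∀ U' ∈ O, ∃ g : G, g • U = U') (P : Sylow 3 G) :
    ∀ U ∈ O, (MulAction.orbit P U).ncard = 9 := by
  intro U hU
  have hfG := h.finG (G := G)
  haveI : Fact (Nat.Prime 3) := ⟨Nat.prime_three⟩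
  have hPp : IsPGroup 3 P := P.2
  have hle : (MulAction.orbit P U).ncard ≤ 18 := by
    have hs : MulAction.orbit P U ⊆ O := by rintro _ ⟨x, rfl⟩; exact hst x U hU
    have := Set.ncard_le_ncard hs h.finO
    rw [h.ncard] at this
    exact this
  have h1 : (MulAction.stabilizer G U).index = 18 := by
    rw [MulAction.index_stabilizer, orbit_eq hst htr hU, h.ncard]; rfl
  have hd : 9 ∣ (MulAction.orbit P U).ncard := by
    rw [← MulAction.index_stabilizer]
    have e1 : (MulAction.stabilizer P U) = (MulAction.stabilizer G U).subgroupOf P := rfl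
    have h2 : (MulAction.stabilizer G U ⊓ P).relIndex P * (P : Subgroup G).index =
      (MulAction.stabilizer G U ⊓ P).index := Subgroup.relIndex_mul_index inf_le_right
    rw [Subgroup.inf_relIndex_right] at h2
    have h3 : (MulAction.stabilizer G U).index ∣ (MulAction.stabilizer G U ⊓ P).index :=
      Subgroup.index_dvd_of_le inf_le_left
    rw [h1, ← h2] at h3
    have h4 : 9 ∣ (MulAction.stabilizer G U).relIndex P * (P : Subgroup G).index :=
      (by norm_num : 9 ∣ 18).trans h3
    have h5 : Nat.Coprime 9 (P : Subgroup G).index := by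
      rw [show 9 = 3 ^ 2 by norm_num]
      exact Nat.Coprime.pow_left 2 ((Nat.Prime.coprime_iff_not_dvd Nat.prime_three).2 P.not_dvd_index)
    exact h5.dvd_of_dvd_mul_right h4
  have hfo : Finite (MulAction.orbit P U) := h.finO.subset (by
    rintro _ ⟨x, rfl⟩; exact hst x U hU)
  obtain ⟨k, hk⟩ := hPp.card_orbit U
  have hk' : (MulAction.orbit P U).ncard = 3 ^ k := hk
  rw [hk'] at hle hd ⊢
  have : k < 3 := by
    by_contra h3
    have := Nat.pow_le_pow_right (show 0 < 3 by norm_num) (show 3 ≤ k by omega)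
    omega
  interval_cases k <;> omega

end PHO

end PartF5g

section PartG1

/-- the field with four elements, with kernel friendly operations -/
inductive F4 where
  | o
  | i
  | w
  | v
  deriving DecidableEq

namespace F4
protected def add : F4 → F4 → F4
  | o, b => b
  | i, o => i
  | i, i => o
  | i, w => v
  | i, v => w
  | w, o => w
  | w, i => v
  | w, w => o
  | w, v => i
  | v, o => v
  | v, i => w
  | v, w => i
  | v, v => o
protected def mul : F4 → F4 → F4
  | o, _ => o
  | i, b => b
  | w, o => o
  | w, i => w
  | w, w => v
  | w, v => i
  | v, o => o
  | v, i => v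
  | v, w => i
  | v, v => w
protected def inv : F4 → F4
  | o => o
  | i => i
  | w => v
  | v => w
instance : Zero F4 := ⟨o⟩
instance : One F4 := ⟨i⟩
instance : Add F4 := ⟨F4.add⟩
instance : Mul F4 := ⟨F4.mul⟩
instance : Neg F4 := ⟨fun a => a⟩
instance : Inv F4 := ⟨F4.inv⟩

instance : Field F4 where
  add_assoc := by intro a b c; cases a <;> cases b <;> cases c <;> rfl
  zero_add := by intro a; cases a <;> rfl
  add_zero := by intro a; cases a <;> rfl
  add_comm := by intro a b; cases a <;> cases b <;> rfl
  neg_add_cancel := by intro a; cases a <;> rfl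
  left_distrib := by intro a b c; cases a <;> cases b <;> cases c <;> rfl
  right_distrib := by intro a b c; cases a <;> cases b <;> cases c <;> rfl
  zero_mul := by intro a; cases a <;> rfl
  mul_zero := by intro a; cases a <;> rfl
  mul_assoc := by intro a b c; cases a <;> cases b <;> cases c <;> rfl
  one_mul := by intro a; cases a <;> rfl
  mul_one := by intro a; cases a <;> rfl
  mul_comm := by intro a b; cases a <;> cases b <;> rfl
  exists_pair_ne := ⟨o, i, by decide⟩
  mul_inv_cancel := by intro a ha; cases a; exact absurd rfl ha; all_goals rfl
  inv_zero := rfl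
  nsmul := nsmulRec
  zsmul := zsmulRec
  nnqsmul := _
  qsmul := _

instance : Fintype F4 := ⟨{o, i, w, v}, by intro a; cases a <;> decide⟩

def all (p : F4 → Bool) : Bool := p o && p i && p w && p v
theorem all_spec {p : F4 → Bool} (h : all p = true) (a : F4) : p a = true := by
  simp only [all, Bool.and_eq_true] at h
  cases a
  exacts [h.1.1.1, h.1.1.2, h.1.2, h.2]

def isO : F4 → Bool
  | o => true
  | _ => false
theorem isO_iff (a : F4) : isO a = true ↔ a = 0 := by cases a <;> decide
theorem isO_false (a : F4) : isO a = false ↔ a ≠ 0 := by cases a <;> decide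
protected def beq (a b : F4) : Bool := isO (F4.add a b)
theorem beq_iff (a b : F4) : F4.beq a b = true ↔ a = b := by cases a <;> cases b <;> decide
/-- forcing evaluation -/
def ev {α : Type} (a : F4) (k : F4 → α) : α := match a with
  | o => k o
  | i => k i
  | w => k w
  | v => k v
theorem ev_eq {α : Type} (a : F4) (k : F4 → α) : ev a k = k a := by cases a <;> rfl
end F4

/-- 2 by 2 matrices over F4 -/
structure M2 where
  (a b c d : F4)

namespace M2
def ev {α : Type} (A : M2) (k : M2 → α) : α :=
  F4.ev A.a fun a => F4.ev A.b fun b => F4.ev A.c fun c => F4.ev A.d fun d => k ⟨a, b, c, d⟩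
theorem ev_eq {α : Type} (A : M2) (k : M2 → α) : ev A k = k A := by
  simp only [ev, F4.ev_eq]
def add (A B : M2) : M2 := ⟨A.a.add B.a, A.b.add B.b, A.c.add B.c, A.d.add B.d⟩
def mul (A B : M2) : M2 := ⟨(A.a.mul B.a).add (A.b.mul B.c), (A.a.mul B.b).add (A.b.mul B.d),
  (A.c.mul B.a).add (A.d.mul B.c), (A.c.mul B.b).add (A.d.mul B.d)⟩
def sc (l : F4) (A : M2) : M2 := ⟨l.mul A.a, l.mul A.b, l.mul A.c, l.mul A.d⟩
def one : M2 := ⟨.i, .o, .o, .i⟩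
def mn (a b c d : F4) : F4 := (a.mul d).add (b.mul c)
def det (A : M2) : F4 := mn A.a A.b A.c A.d
def inv (A : M2) : M2 := sc (F4.inv A.det) ⟨A.d, A.b, A.c, A.a⟩
/-- singular -/
def sg (A : M2) : Bool := F4.isO A.det
def beq (A B : M2) : Bool := F4.beq A.a B.a && F4.beq A.b B.b && F4.beq A.c B.c && F4.beq A.d B.d
/-- scalar -/
def scal (A : M2) : Bool := F4.isO A.b && F4.isO A.c && F4.beq A.a A.d
def all (p : M2 → Bool) : Bool :=
  F4.all fun a => F4.all fun b => F4.all fun c => F4.all fun d => p ⟨a, b, c, d⟩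
theorem all_spec {p : M2 → Bool} (h : all p = true) (A : M2) : p A = true := by
  obtain ⟨a, b, c, d⟩ := A
  exact F4.all_spec (F4.all_spec (F4.all_spec (F4.all_spec h a) b) c) d
theorem beq_iff (A B : M2) : beq A B = true ↔ A = B := by
  simp only [beq, Bool.and_eq_true, F4.beq_iff]
  constructor
  · rintro ⟨⟨⟨h1, h2⟩, h3⟩, h4⟩
    cases A; cases B; simp_all
  · rintro rfl; simp
def comp (d t : F4) : M2 := ⟨.o, d, .i, t⟩
/-- determinant of a block matrix -/
def det4 (P Q R S : M2) : F4 :=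
  F4.add (F4.mul (mn P.a P.b P.c P.d) (mn S.a S.b S.c S.d)) <|
  F4.add (F4.mul (mn P.a Q.a P.c Q.c) (mn R.b S.b R.d S.d)) <|
  F4.add (F4.mul (mn P.a Q.b P.c Q.d) (mn R.b S.a R.d S.c)) <|
  F4.add (F4.mul (mn P.b Q.a P.d Q.c) (mn R.a S.b R.c S.d)) <|
  F4.add (F4.mul (mn P.b Q.b P.d Q.d) (mn R.a S.a R.c S.c)) <|
  F4.mul (mn Q.a Q.b Q.c Q.d) (mn R.a R.b R.c R.d)
end M2

/-- pairs of matrices, coordinates of members -/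
structure P2 where
  (B C : M2)

namespace P2
open M2
def ev {α : Type} (T : P2) (k : P2 → α) : α := T.B.ev fun B => T.C.ev fun C => k ⟨B, C⟩
theorem ev_eq {α : Type} (A : P2) (k : P2 → α) : ev A k = k A := by
  simp only [ev, M2.ev_eq]
def z (T : P2) : P2 := ⟨sc .w T.B, sc .v T.C⟩
def h (l : F4) (T : P2) : P2 := ⟨sc (F4.inv l) (inv T.C), sc (F4.inv l) (mul T.B (inv T.C))⟩
def hp (l : F4) : ℕ → P2 → P2
  | 0, T => T
  | j + 1, T => h l (hp l j T)
def zp : ℕ → P2 → P2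
  | 0, T => T
  | j + 1, T => z (zp j T)
def g (l : F4) (i j : ℕ) (T : P2) : P2 := zp i (hp l j T)
def bad (T0 T1 T2 : P2) : Bool := T0.ev fun T0 => T1.ev fun T1 => T2.ev fun T2 =>
  F4.isO (det4 (T1.B.add T0.B) (T2.B.add T0.B) (T1.C.add T0.C) (T2.C.add T0.C))
/-- triple inside one orbit -/
def b1 (l : F4) (T : P2) (i j i' j' : ℕ) : Bool := bad T (g l i j T) (g l i' j' T)
/-- triple in two orbits -/
def b2 (l : F4) (T T' : P2) (i j i' j' : ℕ) : Bool := bad T (g l i j T) (g l i' j' T')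

def any9 (p : ℕ → ℕ → Bool) : Bool := p 0 0 || p 0 1 || p 0 2 || p 1 0 || p 1 1 || p 1 2 || p 2 0 ||
  p 2 1 || p 2 2
theorem any9_spec {p : ℕ → ℕ → Bool} (h : any9 p = true) : ∃ i j, p i j = true := by
  simp only [any9, Bool.or_eq_true] at h
  rcases h with ((((((((h | h) | h) | h) | h) | h) | h) | h) | h) <;> exact ⟨_, _, h⟩

def good1 (T : P2) : Bool := beq T.B one && !(scal T.C)
def good2 (T : P2) : Bool := T.ev fun T => F4.beq (T.B.a.add T.B.d) .i && !(F4.beq T.B.det .i) &&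
  !(scal T.B) && scal (mul T.B T.C)

def c1 (B C : M2) : Bool := sg C || b1 .i ⟨B, C⟩ 0 1 0 2 || b1 .i ⟨B, C⟩ 1 1 2 2 ||
  b1 .i ⟨B, C⟩ 1 2 2 1 || any9 fun i j => good1 (g .i i j ⟨B, C⟩)
def c2 (B C : M2) : Bool := sg C || b1 .w ⟨B, C⟩ 0 1 1 2 || b1 .w ⟨B, C⟩ 0 1 1 0 ||
  b1 .w ⟨B, C⟩ 0 1 2 1 || b1 .w ⟨B, C⟩ 0 1 1 1 || b1 .w ⟨B, C⟩ 1 0 2 1 ||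
  b1 .w ⟨B, C⟩ 0 1 2 0 || b1 .w ⟨B, C⟩ 1 0 2 2 || any9 fun i j => good2 (g .w i j ⟨B, C⟩)

def rat (p : M2 → Bool) : Bool := (F4.all fun m => F4.isO m || p ⟨m, .o, .o, m⟩) &&
  (F4.all fun d => F4.isO d || F4.all fun t => p (comp d t))

def chk1 : Bool := rat fun B => all fun C => c1 B C
def chk2 : Bool := rat fun B => all fun C => c2 B C

def d1 (C C' : M2) : Bool :=
  let T : P2 := ⟨one, C⟩
  let T' : P2 := ⟨one, C'⟩
  sg C' || b1 .i T' 0 1 1 2 || b2 .i T T' 0 1 0 0 || b2 .i T T' 1 1 0 2 || b2 .i T T' 1 2 0 2 ||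
  b2 .i T T' 0 1 1 0 || b2 .i T' T 0 1 1 0 || beq (mul C C') (mul C' C)
def chk3 : Bool := F4.all fun d => F4.isO d || F4.all fun t => all fun C' => d1 (comp d t) C'

def d2 (T T' : P2) : Bool := T.ev fun T => T'.ev fun T' =>
  b2 .w T T' 0 1 2 2 || b2 .w T' T 1 0 0 2 || b2 .w T' T 1 1 0 0 || b2 .w T T' 1 2 1 1 ||
  b2 .w T T' 1 1 2 1 || b2 .w T T' 1 0 2 0 || b2 .w T T' 1 0 0 0 || b2 .w T' T 1 0 2 0 ||
  b2 .w T' T 0 1 0 0 || b2 .w T T' 0 1 2 1 || b2 .w T' T 1 0 0 0 || b2 .w T' T 1 2 0 2 ||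
  b2 .w T T' 0 1 2 0 || b2 .w T' T 0 1 2 0 || b2 .w T T' 1 0 1 0 || b2 .w T' T 1 1 0 1 ||
  b2 .w T' T 1 1 2 0 || b2 .w T T' 1 2 0 2 || b2 .w T T' 0 1 0 2 || b2 .w T T' 1 0 0 1
def chk4 : Bool := F4.all fun d => F4.isO d || F4.beq d .i || F4.all fun m => F4.isO m ||
  all fun B' => sg B' || !(F4.beq (B'.a.add B'.d) .i) || F4.beq B'.det .i ||
  F4.all fun m' => F4.isO m' || d2 ⟨comp d .i, sc m (inv (comp d .i))⟩ ⟨B', sc m' (inv B')⟩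

set_option maxRecDepth 100000
theorem chk1_true : chk1 = true := by decide +kernel
theorem chk3_true : chk3 = true := by decide +kernel
theorem chk4_true : chk4 = true := by decide +kernel
theorem chk2_true : chk2 = true := by decide +kernel
end P2

end PartG1

section PartG2

namespace M2
open Matrix
abbrev Mat := Matrix (Fin 2) (Fin 2) F4
def of (M : Mat) : M2 := ⟨M 0 0, M 0 1, M 1 0, M 1 1⟩

theorem of_inj {M N : Mat} (h : of M = of N) : M = N := by
  simp only [of, mk.injEq] at h
  obtain ⟨h1, h2, h3, h4⟩ := h
  ext i j
  fin_cases i <;> fin_cases j <;> assumption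
theorem of_surj (A : M2) : ∃ M : Mat, of M = A := ⟨!![A.a, A.b; A.c, A.d], rfl⟩
theorem of_add (M N : Mat) : of (M + N) = add (of M) (of N) := rfl
theorem of_one : of 1 = one := rfl
theorem of_smul (l : F4) (M : Mat) : of (l • M) = sc l (of M) := rfl
theorem of_mul (M N : Mat) : of (M * N) = mul (of M) (of N) := by
  simp only [of, mul, Matrix.mul_apply, Fin.sum_univ_two]
  rfl
theorem sub_eq (x y : F4) : x - y = x + y := by cases x <;> cases y <;> rfl
theorem neg_eq (x : F4) : -x = x := by cases x <;> rfl
theorem det_of (M : Mat) : det (of M) = M.det := by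
  rw [Matrix.det_fin_two, sub_eq]
  rfl
theorem sg_of {M : Mat} (h : IsUnit M) : sg (of M) = false := by
  rw [sg, F4.isO_false, det_of]
  exact ((Matrix.isUnit_iff_isUnit_det M).1 h).ne_zero
theorem unit_of {M : Mat} (h : sg (of M) = false) : IsUnit M := by
  rw [sg, F4.isO_false, det_of] at h
  exact (Matrix.isUnit_iff_isUnit_det M).2 (isUnit_iff_ne_zero.2 h)
theorem of_inv (M : Mat) : of M⁻¹ = inv (of M) := by
  rw [Matrix.inv_def, of_smul, Matrix.adjugate_fin_two, inv, det_of, Ring.inverse_eq_inv]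
  simp only [neg_eq]
  rfl
theorem scal_of {M : Mat} (h : scal (of M) = true) : ∃ m : F4, M = m • (1 : Mat) := by
  simp only [scal, Bool.and_eq_true, F4.isO_iff, F4.beq_iff] at h
  refine ⟨M 0 0, of_inj ?_⟩
  obtain ⟨⟨h1, h2⟩, h3⟩ := h
  simp only [of] at h1 h2 h3
  simp [of, h1, h2, h3]
theorem of_scal (m : F4) : of (m • (1 : Mat)) = ⟨m, .o, .o, m⟩ := by
  cases m <;> rfl

def okP (M P : M2) : Bool := !(sg P) && beq (mul M P) (mul P (comp M.det (M.a.add M.d)))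
def chkP : Bool := all fun M => scal M || okP M ⟨.i, M.a, .o, M.c⟩ || okP M ⟨.o, M.b, .i, M.d⟩ ||
  okP M ⟨.i, M.a.add M.b, .i, M.c.add M.d⟩
set_option maxRecDepth 100000 in
theorem chkP_true : chkP = true := by decide +kernel

theorem okP_of {M : Mat} {P : M2} (h : okP (of M) P = true) :
    ∃ P : Mat, IsUnit P ∧ of (P⁻¹ * M * P) = comp M.det (M 0 0 + M 1 1) := by
  obtain ⟨P, rfl⟩ := of_surj P
  simp only [okP, Bool.and_eq_true, Bool.not_eq_true', beq_iff] at h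
  have hu := unit_of h.1
  refine ⟨P, hu, ?_⟩
  obtain ⟨K, hK⟩ := of_surj (comp M.det (M 0 0 + M 1 1))
  have h2 := h.2
  rw [det_of] at h2
  change _ = (of P).mul (comp M.det (M 0 0 + M 1 1)) at h2
  rw [← hK, ← of_mul, ← of_mul] at h2
  have := of_inj h2
  rw [← hK, mul_assoc, this, ← mul_assoc, Matrix.nonsing_inv_mul _ ((Matrix.isUnit_iff_isUnit_det P).1 hu),
    one_mul]

theorem rational (M : Mat) (hM : scal (of M) = false) :
    ∃ P : Mat, IsUnit P ∧ of (P⁻¹ * M * P) = comp M.det (M 0 0 + M 1 1) := by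
  have := all_spec chkP_true (of M)
  rw [hM, Bool.false_or, Bool.or_eq_true, Bool.or_eq_true] at this
  rcases this with (h | h) | h <;> exact okP_of h

theorem det4_eq (P Q R S : Mat) : det4 (of P) (of Q) (of R) (of S) =
    Matrix.det !![P 0 0, P 0 1, Q 0 0, Q 0 1; P 1 0, P 1 1, Q 1 0, Q 1 1;
      R 0 0, R 0 1, S 0 0, S 0 1; R 1 0, R 1 1, S 1 0, S 1 1] := by
  have e : ∀ a b c d : F4, mn a b c d = a * d + b * c := fun _ _ _ _ => rfl
  have e1 : ∀ a b : F4, a.add b = a + b := fun _ _ => rfl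
  have e2 : ∀ a b : F4, a.mul b = a * b := fun _ _ => rfl
  simp only [det4, of, e, e1, e2]
  simp only [Matrix.det_succ_row_zero, Fin.sum_univ_succ]
  simp [Fin.succAbove, Matrix.submatrix, neg_eq]
  ring

theorem det4_ne (P Q R S : Mat) (h : ∀ x y : Fin 2 → F4, P *ᵥ x + Q *ᵥ y = 0 → R *ᵥ x + S *ᵥ y = 0 →
    x = 0 ∧ y = 0) : F4.isO (det4 (of P) (of Q) (of R) (of S)) = false := by
  rw [F4.isO_false, det4_eq]
  intro h0
  obtain ⟨u, hu, e⟩ := Matrix.exists_mulVec_eq_zero_iff.2 h0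
  have e0 := congrFun e 0
  have e1 := congrFun e 1
  have e2 := congrFun e 2
  have e3 := congrFun e 3
  simp [Matrix.mulVec, dotProduct, Fin.sum_univ_succ] at e0 e1 e2 e3
  have := h ![u 0, u 1] ![u 2, u 3] ?_ ?_
  · apply hu
    have h1 := congrFun this.1 0
    have h2 := congrFun this.1 1
    have h3 := congrFun this.2 0
    have h4 := congrFun this.2 1
    simp at h1 h2 h3 h4
    ext i
    fin_cases i <;> assumption
  · ext i
    fin_cases i
    · simp [Matrix.mulVec, dotProduct, Fin.sum_univ_succ]
      rw [← e0]; ring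
    · simp [Matrix.mulVec, dotProduct, Fin.sum_univ_succ]
      rw [← e1]; ring
  · ext i
    fin_cases i
    · simp [Matrix.mulVec, dotProduct, Fin.sum_univ_succ]
      rw [← e2]; ring
    · simp [Matrix.mulVec, dotProduct, Fin.sum_univ_succ]
      rw [← e3]; ring
end M2

namespace P2
open M2 Matrix
def of (B C : Mat) : P2 := ⟨M2.of B, M2.of C⟩
theorem bad_of {B0 C0 B1 C1 B2 C2 : Mat} (h : ∀ x y : Fin 2 → F4,
    (B1 + B0) *ᵥ x + (B2 + B0) *ᵥ y = 0 → (C1 + C0) *ᵥ x + (C2 + C0) *ᵥ y = 0 → x = 0 ∧ y = 0) :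
    bad (of B0 C0) (of B1 C1) (of B2 C2) = false := by
  simp only [bad, ev_eq]
  exact det4_ne _ _ _ _ h
theorem z_of (B C : Mat) : z (of B C) = of (F4.w • B) (F4.v • C) := rfl
theorem h_of (l : F4) (B C : Mat) : h l (of B C) = of (l⁻¹ • C⁻¹) (l⁻¹ • (B * C⁻¹)) := by
  simp only [h, of, of_smul, of_mul, of_inv]
  rfl
end P2

end PartG2

section PartG3
open scoped Pointwise
open Matrix

theorem F4.two {X : Type*} [AddCommGroup X] [Module F4 X] (x : X) : x + x = 0 := by
  have : ((1 : F4) + 1) • x = x + x := by rw [add_smul, one_smul]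
  rw [← this, show (1 : F4) + 1 = 0 from rfl, zero_smul]

/-- coordinates -/
def phpi {V R : Type*} [AddCommGroup V] [Group R] [DistribMulAction R V] [Module F4 V] (g : R)
    (φ : (Fin 2 → F4) →ₗ[F4] V) (x y u : Fin 2 → F4) : V := φ x + g • φ y + g • g • φ u

structure Frame {V R : Type*} [AddCommGroup V] [Group R] [DistribMulAction R V] [Module F4 V]
    (z g : R) (l : F4) (φ : (Fin 2 → F4) →ₗ[F4] V) : Prop where
  zs : ∀ (a : F4) (v : V), z • a • v = a • z • v
  gs : ∀ (a : F4) (v : V), g • a • v = a • g • v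
  zg : ∀ v : V, z • g • v = F4.w • g • z • v
  ggg : ∀ v : V, g • g • g • v = l • v
  l0 : l ≠ 0
  fx : ∀ x, z • φ x = φ x
  inj : ∀ x y u, phpi g φ x y u = 0 → x = 0 ∧ y = 0 ∧ u = 0
  surj : ∀ v, ∃ x y u, v = phpi g φ x y u

/-- a subgroup is a graph -/
def Gr {V R : Type*} [AddCommGroup V] [Group R] [DistribMulAction R V] [Module F4 V] (g : R)
    (φ : (Fin 2 → F4) →ₗ[F4] V) (U : AddSubgroup V) (B C : M2.Mat) : Prop :=
  ∀ x y u, phpi g φ x y u ∈ U ↔ y = B *ᵥ x ∧ u = C *ᵥ x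

namespace Frame
variable {V R : Type*} [AddCommGroup V] [Group R] [DistribMulAction R V] [Module F4 V]
    {z g : R} {l : F4} {φ : (Fin 2 → F4) →ₗ[F4] V} {U : AddSubgroup V} {B C : M2.Mat}

theorem pi_add (x y u x' y' u' : Fin 2 → F4) :
    phpi g φ (x + x') (y + y') (u + u') = phpi g φ x y u + phpi g φ x' y' u' := by
  simp only [phpi, map_add, smul_add]
  abel
theorem pi_zero : phpi g φ 0 0 0 = 0 := by simp [phpi]
theorem pi_smul (F : Frame z g l φ) (a : F4) (x y u : Fin 2 → F4) :
    phpi g φ (a • x) (a • y) (a • u) = a • phpi g φ x y u := by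
  simp only [phpi, map_smul, F.gs, smul_add]
theorem pi_z (F : Frame z g l φ) (x y u : Fin 2 → F4) :
    z • phpi g φ x y u = phpi g φ x (F4.w • y) (F4.v • u) := by
  have e : F4.v • g • g • φ u = F4.w • F4.w • g • g • φ u := mul_smul F4.w F4.w _
  simp only [phpi, map_smul, F.gs, smul_add, F.zg, F.fx, e]
theorem pi_g (F : Frame z g l φ) (x y u : Fin 2 → F4) :
    g • phpi g φ x y u = phpi g φ (l • u) x y := by
  simp only [phpi, map_smul, smul_add, F.ggg]
  abel
theorem pi_inj (F : Frame z g l φ) {x y u x' y' u' : Fin 2 → F4}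
    (e : phpi g φ x y u = phpi g φ x' y' u') : x = x' ∧ y = y' ∧ u = u' := by
  have h : phpi g φ (x + x') (y + y') (u + u') = 0 := by rw [pi_add, e]; exact F4.two _
  obtain ⟨h1, h2, h3⟩ := F.inj _ _ _ h
  have k : ∀ a b : Fin 2 → F4, a + b = 0 → a = b := fun a b hab => by
    rw [← add_zero a, ← F4.two b, ← add_assoc, hab, zero_add]
  exact ⟨k _ _ h1, k _ _ h2, k _ _ h3⟩

theorem gr_z (F : Frame z g l φ) (h : Gr g φ U B C) : Gr g φ (z • U) (F4.w • B) (F4.v • C) := by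
  intro x y u
  have e : phpi g φ x y u = z • phpi g φ x (F4.v • y) (F4.w • u) := by
    rw [F.pi_z, smul_smul, smul_smul]
    change _ = phpi g φ x ((1 : F4) • y) ((1 : F4) • u)
    rw [one_smul, one_smul]
  rw [e, AddSubgroup.smul_mem_pointwise_smul_iff, h, smul_mulVec, smul_mulVec]
  have k1 : F4.v • y = B *ᵥ x ↔ y = F4.w • B *ᵥ x := by
    constructor
    · intro k; rw [← k, smul_smul]; exact (one_smul F4 y).symm
    · intro k; rw [k, smul_smul]; exact (one_smul F4 _)
  have k2 : F4.w • u = C *ᵥ x ↔ u = F4.v • C *ᵥ x := by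
    constructor
    · intro k; rw [← k, smul_smul]; exact (one_smul F4 u).symm
    · intro k; rw [k, smul_smul]; exact (one_smul F4 _)
  rw [k1, k2]

theorem gr_g (F : Frame z g l φ) (h : Gr g φ U B C) (hC : IsUnit C) :
    Gr g φ (g • U) (l⁻¹ • C⁻¹) (l⁻¹ • (B * C⁻¹)) := by
  intro x y u
  have hd := (Matrix.isUnit_iff_isUnit_det C).1 hC
  have e : phpi g φ x y u = g • phpi g φ y u (l⁻¹ • x) := by
    rw [F.pi_g, smul_smul, mul_inv_cancel₀ F.l0, one_smul]
  rw [e, AddSubgroup.smul_mem_pointwise_smul_iff, h, smul_mulVec, smul_mulVec,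
    ← Matrix.mulVec_mulVec]
  have k : l⁻¹ • x = C *ᵥ y ↔ y = l⁻¹ • C⁻¹ *ᵥ x := by
    constructor
    · intro k; rw [← Matrix.mulVec_smul, k, Matrix.mulVec_mulVec, Matrix.nonsing_inv_mul _ hd, one_mulVec]
    · intro k; rw [k, Matrix.mulVec_smul, Matrix.mulVec_mulVec, Matrix.mul_nonsing_inv _ hd, one_mulVec]
  rw [k, and_comm]
  constructor
  · rintro ⟨k1, k2⟩; refine ⟨k1, ?_⟩; rw [k2, k1, Matrix.mulVec_smul]
  · rintro ⟨k1, k2⟩; refine ⟨k1, ?_⟩; rw [k2, k1, Matrix.mulVec_smul]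

theorem sm_unit {a : F4} (ha : a ≠ 0) (hB : IsUnit B) : IsUnit (a • B) := by
  have := hB.smul (Units.mk0 a ha)
  exact this

theorem gr_gp (F : Frame z g l φ) (h : Gr g φ U B C) (hB : IsUnit B) (hC : IsUnit C) (j : ℕ) :
    ∃ B' C', IsUnit B' ∧ IsUnit C' ∧ Gr g φ (g ^ j • U) B' C' ∧
      P2.hp l j (P2.of B C) = P2.of B' C' := by
  induction j with
  | zero => exact ⟨B, C, hB, hC, by simpa using h, rfl⟩
  | succ j ih =>
    obtain ⟨B', C', uB, uC, hG, e⟩ := ih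
    have ui : IsUnit C'⁻¹ := Matrix.isUnit_nonsing_inv_iff.2 uC
    have li : l⁻¹ ≠ 0 := inv_ne_zero F.l0
    refine ⟨_, _, sm_unit li ui, sm_unit li (uB.mul ui), ?_, ?_⟩
    rotate_left
    · rw [P2.hp, e, P2.h_of]
    · rw [pow_succ', mul_smul]
      exact F.gr_g hG uC

theorem gr_zp (F : Frame z g l φ) (h : Gr g φ U B C) (hB : IsUnit B) (hC : IsUnit C) (i : ℕ) :
    ∃ B' C', IsUnit B' ∧ IsUnit C' ∧ Gr g φ (z ^ i • U) B' C' ∧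
      P2.zp i (P2.of B C) = P2.of B' C' := by
  induction i with
  | zero => exact ⟨B, C, hB, hC, by simpa using h, rfl⟩
  | succ j ih =>
    obtain ⟨B', C', uB, uC, hG, e⟩ := ih
    refine ⟨_, _, sm_unit (a := F4.w) (by decide) uB, sm_unit (a := F4.v) (by decide) uC, ?_, ?_⟩
    rotate_left
    · rw [P2.zp, e, P2.z_of]
    · rw [pow_succ', mul_smul]
      exact F.gr_z hG

theorem gr_zg (F : Frame z g l φ) (h : Gr g φ U B C) (hB : IsUnit B) (hC : IsUnit C) (i j : ℕ) :
    ∃ B' C', IsUnit B' ∧ IsUnit C' ∧ Gr g φ ((z ^ i * g ^ j) • U) B' C' ∧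
      P2.g l i j (P2.of B C) = P2.of B' C' := by
  obtain ⟨B', C', uB, uC, hG, e⟩ := F.gr_gp h hB hC j
  obtain ⟨B2, C2, uB2, uC2, hG2, e2⟩ := F.gr_zp hG uB uC i
  refine ⟨B2, C2, uB2, uC2, ?_, ?_⟩
  · rw [mul_smul]; exact hG2
  · rw [P2.g, e, e2]

theorem tri (F : Frame z g l φ) {m : ℕ} {O : Set (AddSubgroup V)} (h : PHO m O)
    {U0 U1 U2 : AddSubgroup V} (h0 : U0 ∈ O) (h1 : U1 ∈ O) (h2 : U2 ∈ O) (d1 : U0 ≠ U1)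
    (d2 : U0 ≠ U2) (d3 : U1 ≠ U2) {B0 C0 B1 C1 B2 C2 : M2.Mat} (g0 : Gr g φ U0 B0 C0)
    (g1 : Gr g φ U1 B1 C1) (g2 : Gr g φ U2 B2 C2) :
    P2.bad (P2.of B0 C0) (P2.of B1 C1) (P2.of B2 C2) = false := by
  apply P2.bad_of
  intro x y e1 e2
  have m0 := (g0 (x + y) _ _).2 ⟨rfl, rfl⟩
  have m1 := (g1 x _ _).2 ⟨rfl, rfl⟩
  have m2 := (g2 y _ _).2 ⟨rfl, rfl⟩
  have hs := h.indep h0 h1 h2 d1 d2 d3 m0 m1 m2 (by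
    rw [← pi_add, ← pi_add]
    have q1 : x + y + x + y = 0 := by
      rw [show x + y + x + y = (x + y) + (x + y) by abel]; exact F4.two _
    have q2 : B0 *ᵥ (x + y) + B1 *ᵥ x + B2 *ᵥ y = 0 := by
      rw [← e1, add_mulVec, add_mulVec, mulVec_add]; abel
    have q3 : C0 *ᵥ (x + y) + C1 *ᵥ x + C2 *ᵥ y = 0 := by
      rw [← e2, add_mulVec, add_mulVec, mulVec_add]; abel
    rw [q1, q2, q3, pi_zero])
  exact ⟨(F.inj _ _ _ hs.2.1).1, (F.inj _ _ _ hs.2.2).1⟩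

/-- change of basis -/
theorem change (F : Frame z g l φ) {P : M2.Mat} (hP : IsUnit P) :
    Frame z g l (φ ∘ₗ Matrix.mulVecLin P) ∧ ∀ U B C, Gr g φ U B C →
      Gr g (φ ∘ₗ Matrix.mulVecLin P) U (P⁻¹ * B * P) (P⁻¹ * C * P) := by
  have hd := (Matrix.isUnit_iff_isUnit_det P).1 hP
  have e : ∀ x y u, phpi g (φ ∘ₗ Matrix.mulVecLin P) x y u = phpi g φ (P *ᵥ x) (P *ᵥ y) (P *ᵥ u) :=
    fun x y u => rfl
  have k : ∀ x y, P *ᵥ x = y ↔ x = P⁻¹ *ᵥ y := fun x y => by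
    constructor
    · intro k; rw [← k, Matrix.mulVec_mulVec, Matrix.nonsing_inv_mul _ hd, one_mulVec]
    · intro k; rw [k, Matrix.mulVec_mulVec, Matrix.mul_nonsing_inv _ hd, one_mulVec]
  refine ⟨⟨F.zs, F.gs, F.zg, F.ggg, F.l0, fun x => F.fx _, ?_, ?_⟩, ?_⟩
  · intro x y u h
    rw [e] at h
    have := F.inj _ _ _ h
    simpa only [k, mulVec_zero] using this
  · intro v
    obtain ⟨x, y, u, rfl⟩ := F.surj v
    refine ⟨P⁻¹ *ᵥ x, P⁻¹ *ᵥ y, P⁻¹ *ᵥ u, ?_⟩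
    rw [e, (k _ _).2 rfl, (k _ _).2 rfl, (k _ _).2 rfl]
  · intro U B C h x y u
    rw [e, h, k, k]
    simp only [Matrix.mulVec_mulVec, mul_assoc]

theorem one_w_v {X : Type*} [AddCommGroup X] [Module F4 X] (x : X) : x + F4.w • x + F4.v • x = 0 := by
  have : ((1 : F4) + F4.w + F4.v) • x = x + F4.w • x + F4.v • x := by
    rw [add_smul, add_smul, one_smul]
  rw [← this, show (1 : F4) + F4.w + F4.v = 0 from rfl, zero_smul]

theorem exists_gr (F : Frame z g l φ) {m : ℕ} {O : Set (AddSubgroup V)} (h : PHO m O)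
    (hst : ∀ x : R, ∀ U ∈ O, x • U ∈ O) (hs : ∀ U ∈ O, ∀ a : F4, ∀ v ∈ U, a • v ∈ U)
    (hm : 2 ^ m = 16) (hU : U ∈ O) (z3 : z ^ 3 = 1) (hz : z • U ≠ U) :
    ∃ B C, IsUnit B ∧ IsUnit C ∧ Gr g φ U B C := by
  have hz2 : z • z • U ≠ U := by
    intro e
    apply hz
    calc z • U = z • z • z • U := by rw [e]
      _ = z ^ 3 • U := by rw [pow_succ, pow_succ, pow_one, mul_smul, mul_smul]
      _ = U := by rw [z3, one_smul]
  have hz3 : z • U ≠ z • z • U := fun e => hz (smul_left_cancel z e).symm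
  have h1 := hst z U hU
  have h2 := hst z _ h1
  -- the three projections
  have key : ∀ a b : F4, ∀ v ∈ U, v + a • z • v + b • z • z • v = 0 → v = 0 := fun a b v hv e =>
    (h.indep hU h1 h2 hz.symm hz2.symm hz3 hv
      (hs _ h1 a _ (AddSubgroup.smul_mem_pointwise_smul _ _ _ hv))
      (hs _ h2 b _ (AddSubgroup.smul_mem_pointwise_smul _ _ _
        (AddSubgroup.smul_mem_pointwise_smul _ _ _ hv))) e).1
  let X := Fin 2 → F4
  let pp : X × X × X →+ V :=
    { toFun := fun p => phpi g φ p.1 p.2.1 p.2.2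
      map_zero' := pi_zero
      map_add' := fun p q => pi_add _ _ _ _ _ _ }
  have hpp : Function.Bijective pp := by
    constructor
    · rintro ⟨x, y, u⟩ ⟨x', y', u'⟩ e
      obtain ⟨a, b, c⟩ := F.pi_inj e
      exact Prod.ext a (Prod.ext b c)
    · intro v
      obtain ⟨x, y, u, e⟩ := F.surj v
      exact ⟨(x, y, u), e.symm⟩
  let T : AddSubgroup (X × X × X) := U.comap pp
  have hT : ∀ x y u, (x, y, u) ∈ T ↔ phpi g φ x y u ∈ U := fun _ _ _ => Iff.rfl
  have cX : Nat.card X = 16 := by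
    simp [X, Nat.card_eq_fintype_card]; rfl
  have cT : Nat.card T = Nat.card X := by
    rw [cX, ← hm, ← h.cardU U hU]
    refine Nat.card_congr (Equiv.ofBijective (fun t : T => (⟨pp t.1, t.2⟩ : U)) ⟨?_, ?_⟩)
    · intro a b e
      exact Subtype.ext (hpp.1 (congrArg Subtype.val e))
    · rintro ⟨v, hv⟩
      obtain ⟨t, rfl⟩ := hpp.2 v
      exact ⟨⟨t, hv⟩, rfl⟩
  obtain ⟨A, D, hAD⟩ := ph_graph T cT (by
    intro y u hyu
    rw [hT] at hyu
    have := key 1 1 _ hyu (by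
      rw [one_smul, one_smul, F.pi_z, F.pi_z, ← pi_add, ← pi_add, smul_smul, smul_smul]
      have e1 := one_w_v y
      have e2 : u + F4.v • u + (F4.v * F4.v) • u = 0 := by
        rw [add_right_comm]; exact one_w_v u
      rw [e2]
      change phpi g φ (0 + 0 + 0) (y + F4.w • y + F4.v • y) 0 = 0
      rw [e1, add_zero, add_zero, pi_zero])
    exact (F.inj _ _ _ this).2)
  have hlin : ∀ (a : F4) (x : X), A (a • x) = a • A x ∧ D (a • x) = a • D x := by
    intro a x
    have : (a • x, a • A x, a • D x) ∈ T := by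
      rw [hT, F.pi_smul]
      exact hs U hU a _ ((hT _ _ _).1 ((hAD x _ _).2 ⟨rfl, rfl⟩))
    have := (hAD _ _ _).1 this
    exact ⟨this.1.symm, this.2.symm⟩
  let A' : X →ₗ[F4] X := { toFun := A, map_add' := map_add A, map_smul' := fun a x => (hlin a x).1 }
  let D' : X →ₗ[F4] X := { toFun := D, map_add' := map_add D, map_smul' := fun a x => (hlin a x).2 }
  have eA : ∀ x, LinearMap.toMatrix' A' *ᵥ x = A x := fun x => LinearMap.toMatrix'_mulVec A' x
  have eD : ∀ x, LinearMap.toMatrix' D' *ᵥ x = D x := fun x => LinearMap.toMatrix'_mulVec D' x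
  have hG : Gr g φ U (LinearMap.toMatrix' A') (LinearMap.toMatrix' D') := by
    intro x y u
    rw [eA, eD, ← hAD, hT]
  have un : ∀ M : M2.Mat, (∀ x, M *ᵥ x = 0 → x = 0) → IsUnit M := by
    intro M hM
    rw [Matrix.isUnit_iff_isUnit_det, isUnit_iff_ne_zero]
    intro h0
    obtain ⟨x, hx, e⟩ := Matrix.exists_mulVec_eq_zero_iff.2 h0
    exact hx (hM x e)
  refine ⟨_, _, un _ ?_, un _ ?_, hG⟩
  · intro x hx
    have hm := (hG x _ _).2 ⟨rfl, rfl⟩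
    rw [hx] at hm
    refine (F.inj _ _ _ (key F4.v F4.w _ hm ?_)).1
    generalize (LinearMap.toMatrix' D') *ᵥ x = u
    rw [F.pi_z, F.pi_z, ← F.pi_smul, ← F.pi_smul, ← pi_add, ← pi_add]
    simp only [smul_smul, smul_zero, add_zero]
    have e2 : u + (F4.v * F4.v) • u + (F4.w * (F4.v * F4.v)) • u = 0 := one_w_v u
    have e3 : x + F4.v • x + F4.w • x = 0 := by rw [add_right_comm]; exact one_w_v x
    rw [e2, e3, pi_zero]
  · intro x hx
    have hm := (hG x _ _).2 ⟨rfl, rfl⟩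
    rw [hx] at hm
    refine (F.inj _ _ _ (key F4.w F4.v _ hm ?_)).1
    generalize (LinearMap.toMatrix' A') *ᵥ x = u
    rw [F.pi_z, F.pi_z, ← F.pi_smul, ← F.pi_smul, ← pi_add, ← pi_add]
    simp only [smul_smul, smul_zero, add_zero]
    have e2 : u + (F4.w * F4.w) • u + (F4.v * (F4.w * F4.w)) • u = 0 := by
      rw [add_right_comm]; exact one_w_v u
    have e3 : x + F4.w • x + F4.v • x = 0 := one_w_v x
    rw [e2, e3, pi_zero]
end Frame

end PartG3

section PartG4
open scoped Pointwise
open Matrix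

namespace P2
open M2
theorem rat_spec {p : M2 → M2 → Bool} (h : rat (fun B => M2.all fun C => p B C) = true)
    {B C : Mat} (hB : IsUnit B) :
    ∃ P : Mat, IsUnit P ∧ p (M2.of (P⁻¹ * B * P)) (M2.of (P⁻¹ * C * P)) = true := by
  simp only [rat, Bool.and_eq_true] at h
  have hd : B.det ≠ 0 := ((Matrix.isUnit_iff_isUnit_det B).1 hB).ne_zero
  cases hs : scal (M2.of B)
  · obtain ⟨P, hP, e⟩ := rational B hs
    refine ⟨P, hP, ?_⟩
    have := F4.all_spec h.2 B.det
    rw [(F4.isO_false _).2 hd, Bool.false_or] at this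
    rw [e]
    exact M2.all_spec (F4.all_spec this _) _
  · obtain ⟨m, rfl⟩ := scal_of hs
    have hm : m ≠ 0 := by
      rintro rfl
      simp at hd
    have := F4.all_spec h.1 m
    rw [(F4.isO_false _).2 hm, Bool.false_or] at this
    refine ⟨1, isUnit_one, ?_⟩
    rw [inv_one, one_mul, mul_one, of_scal]
    exact M2.all_spec this _

theorem of_B (B C : Mat) : (of B C).B = M2.of B := rfl
theorem of_C (B C : Mat) : (of B C).C = M2.of C := rfl
end P2

namespace PHO
variable {V : Type*} [AddCommGroup V] {O : Set (AddSubgroup V)}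
variable {R : Type*} [Group R] [DistribMulAction R V]

theorem good_move (hst : ∀ g : R, ∀ U ∈ O, g • U ∈ O) {z h c : R} (hc : c ∈ ker (R := R) O)
    (e : z * h = c * h * z) {U : AddSubgroup V} (hU : U ∈ O) (hg : Good z h U) (a b : ℕ) :
    Good z h ((z ^ a * h ^ b) • U) := by
  have hn := ker_normal' (O := O) (R := R) hst
  have hcom : Commute (z : R ⧸ (ker (R := R) O)) (h : R ⧸ (ker (R := R) O)) := by
    have h1 : (c : R ⧸ (ker (R := R) O)) = 1 := (QuotientGroup.eq_one_iff c).2 hc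
    have := congrArg (QuotientGroup.mk (s := ker (R := R) O)) e
    rw [QuotientGroup.mk_mul, QuotientGroup.mk_mul, QuotientGroup.mk_mul, h1, one_mul] at this
    exact this
  intro i j hij
  apply hg
  rw [← mul_smul] at hij
  have key : (z ^ i * h ^ j * (z ^ a * h ^ b)) • U = (z ^ a * h ^ b * (z ^ i * h ^ j)) • U := by
    apply mk_smul _ hU
    rw [← QuotientGroup.eq]
    simp only [QuotientGroup.mk_mul, QuotientGroup.mk_zpow, QuotientGroup.mk_pow]
    have c1 : Commute (((z : R ⧸ (ker (R := R) O))) ^ i * (h : R ⧸ (ker (R := R) O)) ^ j)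
        ((z : R ⧸ (ker (R := R) O)) ^ a) :=
      Commute.mul_left (((Commute.refl _).zpow_left i).pow_right a) ((hcom.symm.zpow_left j).pow_right a)
    have c2 : Commute (((z : R ⧸ (ker (R := R) O))) ^ i * (h : R ⧸ (ker (R := R) O)) ^ j)
        ((h : R ⧸ (ker (R := R) O)) ^ b) :=
      Commute.mul_left ((hcom.zpow_left i).pow_right b) (((Commute.refl _).zpow_left j).pow_right b)
    exact (c1.mul_right c2).eq
  rw [key, mul_smul] at hij
  exact smul_left_cancel _ hij

end PHO

/-- the data of the configuration -/
structure Cfg {V R : Type*} [AddCommGroup V] [Group R] [DistribMulAction R V]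
    (O : Set (AddSubgroup V)) (z g c : R) : Prop where
  pho : PHO 4 O
  hst : ∀ g : R, ∀ U ∈ O, g • U ∈ O
  hc : c ∈ PHO.ker (R := R) O
  e : z * g = c * g * z

namespace Cfg
variable {V : Type*} [AddCommGroup V] {O : Set (AddSubgroup V)}
variable {R : Type*} [Group R] [DistribMulAction R V] [Module F4 V] {z g c : R} {l : F4}
  {φ : (Fin 2 → F4) →ₗ[F4] V} {U U' : AddSubgroup V} {B C B' C' : M2.Mat}

theorem ne_self (hg : PHO.Good z g U) {i j : ℕ} (d : ¬ (3 ∣ (i : ℤ) ∧ 3 ∣ (j : ℤ))) :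
    U ≠ (z ^ i * g ^ j) • U := by
  intro e
  apply d
  apply hg
  rw [zpow_natCast, zpow_natCast]
  exact e.symm

theorem b1 (S : Cfg O z g c) (F : Frame z g l φ) (hU : U ∈ O) (hg : PHO.Good z g U)
    (G : Gr g φ U B C) (hB : IsUnit B) (hC : IsUnit C) {i j i' j' : ℕ}
    (d1 : ¬ (3 ∣ (i : ℤ) ∧ 3 ∣ (j : ℤ))) (d2 : ¬ (3 ∣ (i' : ℤ) ∧ 3 ∣ (j' : ℤ)))
    (d3 : ¬ (3 ∣ (i : ℤ) - i' ∧ 3 ∣ (j : ℤ) - j')) :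
    P2.b1 l (P2.of B C) i j i' j' = false := by
  obtain ⟨B1, C1, -, -, G1, e1⟩ := F.gr_zg G hB hC i j
  obtain ⟨B2, C2, -, -, G2, e2⟩ := F.gr_zg G hB hC i' j'
  rw [P2.b1, e1, e2]
  refine F.tri S.pho hU (S.hst _ _ hU) (S.hst _ _ hU) (ne_self hg d1) (ne_self hg d2) ?_ G G1 G2
  intro e
  apply d3
  apply PHO.good_inj S.hst S.hc S.e hU hg
  simpa only [zpow_natCast] using e

theorem b2 (S : Cfg O z g c) (F : Frame z g l φ) (hU : U ∈ O) (hU' : U' ∈ O) (hg : PHO.Good z g U)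
    (hn : ∀ x : R, x • U ≠ U')
    (G : Gr g φ U B C) (hB : IsUnit B) (hC : IsUnit C)
    (G' : Gr g φ U' B' C') (hB' : IsUnit B') (hC' : IsUnit C') {i j i' j' : ℕ}
    (d1 : ¬ (3 ∣ (i : ℤ) ∧ 3 ∣ (j : ℤ))) :
    P2.b2 l (P2.of B C) (P2.of B' C') i j i' j' = false := by
  obtain ⟨B1, C1, -, -, G1, e1⟩ := F.gr_zg G hB hC i j
  obtain ⟨B2, C2, -, -, G2, e2⟩ := F.gr_zg G' hB' hC' i' j'
  rw [P2.b2, e1, e2]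
  refine F.tri S.pho hU (S.hst _ _ hU) (S.hst _ _ hU') (ne_self hg d1) ?_ ?_ G G1 G2
  · intro e
    apply hn (z ^ i' * g ^ j')⁻¹
    rw [inv_smul_eq_iff]; exact e
  · intro e
    apply hn ((z ^ i' * g ^ j')⁻¹ * (z ^ i * g ^ j))
    rw [mul_smul, e, inv_smul_smul]

theorem conj_unit {P : M2.Mat} (hP : IsUnit P) (hB : IsUnit B) : IsUnit (P⁻¹ * B * P) :=
  ((Matrix.isUnit_nonsing_inv_iff.2 hP).mul hB).mul hP

theorem conj_one {P : M2.Mat} (hP : IsUnit P) : P⁻¹ * 1 * P = 1 := by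
  rw [mul_one, Matrix.nonsing_inv_mul _ ((Matrix.isUnit_iff_isUnit_det P).1 hP)]

theorem conj_scal {P : M2.Mat} (hP : IsUnit P) (hC : M2.scal (M2.of C) = false) :
    M2.scal (M2.of (P⁻¹ * C * P)) = false := by
  by_contra h
  rw [Bool.not_eq_false] at h
  obtain ⟨m, e⟩ := M2.scal_of h
  have hd := (Matrix.isUnit_iff_isUnit_det P).1 hP
  have : C = m • (1 : M2.Mat) := by
    calc C = P * (P⁻¹ * C * P) * P⁻¹ := by
          rw [mul_assoc, mul_assoc, mul_assoc, Matrix.mul_nonsing_inv _ hd, mul_one, ← mul_assoc,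
            Matrix.mul_nonsing_inv _ hd, one_mul]
      _ = m • (1 : M2.Mat) := by
          rw [e, mul_smul_comm, smul_mul_assoc, mul_one, Matrix.mul_nonsing_inv _ hd]
  rw [this, M2.of_scal] at hC
  cases m <;> exact absurd hC (by decide)

theorem norm1 (S : Cfg O z g c) (F : Frame z g 1 φ) (hU : U ∈ O) (hg : PHO.Good z g U)
    (G : Gr g φ U B C) (hB : IsUnit B) (hC : IsUnit C) :
    ∃ P, IsUnit P ∧ ∃ a b : ℕ, ∃ C', IsUnit C' ∧ M2.scal (M2.of C') = false ∧
      Gr g (φ ∘ₗ Matrix.mulVecLin P) ((z ^ a * g ^ b) • U) 1 C' := by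
  obtain ⟨P, hP, hc⟩ := P2.rat_spec P2.chk1_true (C := C) hB
  obtain ⟨F', hF'⟩ := F.change hP
  have G' := hF' _ _ _ G
  have uB := conj_unit hP hB
  have uC := conj_unit hP hC
  refine ⟨P, hP, ?_⟩
  generalize P⁻¹ * B * P = B1 at *
  generalize P⁻¹ * C * P = C1 at *
  have e : (⟨M2.of B1, M2.of C1⟩ : P2) = P2.of B1 C1 := rfl
  have f1 := S.b1 F' hU hg G' uB uC (i := 0) (j := 1) (i' := 0) (j' := 2) (by omega) (by omega) (by omega)
  have f2 := S.b1 F' hU hg G' uB uC (i := 1) (j := 1) (i' := 2) (j' := 2) (by omega) (by omega) (by omega)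
  have f3 := S.b1 F' hU hg G' uB uC (i := 1) (j := 2) (i' := 2) (j' := 1) (by omega) (by omega) (by omega)
  rw [show (1 : F4) = F4.i from rfl] at f1 f2 f3
  rw [P2.c1, e, f1, f2, f3, M2.sg_of uC] at hc
  simp only [Bool.false_or] at hc
  obtain ⟨a, b, hab⟩ := P2.any9_spec hc
  obtain ⟨B2, C2, uB2, uC2, G2, e2⟩ := F'.gr_zg G' uB uC a b
  rw [show (1 : F4) = F4.i from rfl] at e2
  rw [e2, P2.good1, Bool.and_eq_true, P2.of_B, P2.of_C, M2.beq_iff, ← M2.of_one] at hab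
  rw [M2.of_inj hab.1] at G2
  exact ⟨a, b, C2, uC2, by simpa using hab.2, G2⟩

theorem norm2 (S : Cfg O z g c) (F : Frame z g F4.w φ) (hU : U ∈ O) (hg : PHO.Good z g U)
    (G : Gr g φ U B C) (hB : IsUnit B) (hC : IsUnit C) :
    ∃ P, IsUnit P ∧ ∃ a b : ℕ, ∃ B' : M2.Mat, ∃ m : F4, IsUnit B' ∧ m ≠ 0 ∧ B'.trace = 1 ∧
      B'.det ≠ 1 ∧ Gr g (φ ∘ₗ Matrix.mulVecLin P) ((z ^ a * g ^ b) • U) B' (m • B'⁻¹) := by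
  obtain ⟨P, hP, hc⟩ := P2.rat_spec P2.chk2_true (C := C) hB
  obtain ⟨F', hF'⟩ := F.change hP
  have G' := hF' _ _ _ G
  have uB := conj_unit hP hB
  have uC := conj_unit hP hC
  refine ⟨P, hP, ?_⟩
  generalize P⁻¹ * B * P = B1 at *
  generalize P⁻¹ * C * P = C1 at *
  have e : (⟨M2.of B1, M2.of C1⟩ : P2) = P2.of B1 C1 := rfl
  have f := fun i j i' j' => S.b1 F' hU hg G' uB uC (i := i) (j := j) (i' := i') (j' := j')
  have f1 := f 0 1 1 2 (by omega) (by omega) (by omega)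
  have f2 := f 0 1 1 0 (by omega) (by omega) (by omega)
  have f3 := f 0 1 2 1 (by omega) (by omega) (by omega)
  have f4 := f 0 1 1 1 (by omega) (by omega) (by omega)
  have f5 := f 1 0 2 1 (by omega) (by omega) (by omega)
  have f6 := f 0 1 2 0 (by omega) (by omega) (by omega)
  have f7 := f 1 0 2 2 (by omega) (by omega) (by omega)
  rw [P2.c2, e, f1, f2, f3, f4, f5, f6, f7, M2.sg_of uC] at hc
  simp only [Bool.false_or] at hc
  obtain ⟨a, b, hab⟩ := P2.any9_spec hc
  obtain ⟨B2, C2, uB2, uC2, G2, e2⟩ := F'.gr_zg G' uB uC a b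
  rw [e2, P2.good2, P2.ev_eq, Bool.and_eq_true, Bool.and_eq_true, Bool.and_eq_true, P2.of_B, P2.of_C,
    F4.beq_iff, ← M2.of_mul, M2.det_of] at hab
  obtain ⟨⟨⟨k1, k2⟩, -⟩, k3⟩ := hab
  obtain ⟨m, hm⟩ := M2.scal_of k3
  have hd := (Matrix.isUnit_iff_isUnit_det B2).1 uB2
  have hC2 : C2 = m • B2⁻¹ := by
    calc C2 = B2⁻¹ * (B2 * C2) := by rw [← mul_assoc, Matrix.nonsing_inv_mul _ hd, one_mul]
      _ = m • B2⁻¹ := by rw [hm, mul_smul_comm, mul_one]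
  rw [hC2] at G2 uC2
  refine ⟨a, b, B2, m, uB2, ?_, ?_, ?_, G2⟩
  · rintro rfl
    rw [zero_smul] at uC2
    exact not_isUnit_zero uC2
  · rw [Matrix.trace_fin_two]; exact k1
  · intro h1
    rw [h1] at k2
    exact absurd k2 (by decide)

theorem case2 (S : Cfg O z g c) (F : Frame z g F4.w φ)
    (hs : ∀ U ∈ O, ∀ a : F4, ∀ v ∈ U, a • v ∈ U) (z3 : z ^ 3 = 1)
    (hU : U ∈ O) (hU' : U' ∈ O) (hg : PHO.Good z g U) (hg' : PHO.Good z g U')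
    (hn : ∀ x : R, x • U ≠ U') : False := by
  have hz : ∀ U : AddSubgroup V, PHO.Good z g U → z • U ≠ U := fun U hg e => by
    have := (hg 1 0 (by simpa using e)).1
    omega
  obtain ⟨B, C, uB, uC, G⟩ := F.exists_gr S.pho S.hst hs (by norm_num) hU z3 (hz U hg)
  obtain ⟨P1, hP1, a, b, B, m, uB, hm, ht, hd, G⟩ := S.norm2 F hU hg G uB uC
  obtain ⟨F1, -⟩ := F.change hP1
  obtain ⟨B', C', uB', uC', G'⟩ := F1.exists_gr S.pho S.hst hs (by norm_num) hU' z3 (hz U' hg')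
  obtain ⟨P2, hP2, a', b', B', m', uB', hm', ht', hd', G'⟩ := S.norm2 F1 hU' hg' G' uB' uC'
  obtain ⟨F2, hF2⟩ := F1.change hP2
  have G := hF2 _ _ _ G
  have cj : ∀ (P : M2.Mat), IsUnit P → ∀ (B : M2.Mat) (m : F4),
      P⁻¹ * (m • B⁻¹) * P = m • (P⁻¹ * B * P)⁻¹ := by
    intro P hP B m
    rw [Matrix.mul_inv_rev, Matrix.mul_inv_rev,
      Matrix.nonsing_inv_nonsing_inv _ ((Matrix.isUnit_iff_isUnit_det P).1 hP), mul_smul_comm,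
      smul_mul_assoc, mul_assoc]
  have ct : ∀ (P : M2.Mat), IsUnit P → ∀ (B : M2.Mat), (P⁻¹ * B * P).trace = B.trace := by
    intro P hP B
    rw [Matrix.trace_mul_comm, ← mul_assoc, Matrix.mul_nonsing_inv _
      ((Matrix.isUnit_iff_isUnit_det P).1 hP), one_mul]
  have cd : ∀ (P : M2.Mat), IsUnit P → ∀ (B : M2.Mat), (P⁻¹ * B * P).det = B.det := by
    intro P hP B
    rw [Matrix.det_mul_comm, ← mul_assoc, Matrix.mul_nonsing_inv _
      ((Matrix.isUnit_iff_isUnit_det P).1 hP), one_mul]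
  rw [cj _ hP2] at G
  rw [← ct _ hP2] at ht
  rw [← cd _ hP2] at hd
  have uB := conj_unit hP2 uB
  generalize P2⁻¹ * B * P2 = B at *
  have hns : M2.scal (M2.of B) = false := by
    by_contra h
    rw [Bool.not_eq_false] at h
    obtain ⟨s, rfl⟩ := M2.scal_of h
    revert ht
    cases s <;> decide
  obtain ⟨P3, hP3, e⟩ := M2.rational B hns
  obtain ⟨F3, hF3⟩ := F2.change hP3
  have G := hF3 _ _ _ G
  have G' := hF3 _ _ _ G'
  rw [cj _ hP3] at G G'
  have uB3 := conj_unit hP3 uB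
  have uB3' := conj_unit hP3 uB'
  rw [← ct _ hP3] at ht'
  rw [← cd _ hP3] at hd'
  have hd0 : B.det ≠ 0 := ((Matrix.isUnit_iff_isUnit_det B).1 uB).ne_zero
  rw [← Matrix.trace_fin_two, ht] at e
  generalize P3⁻¹ * B * P3 = B3 at *
  generalize P3⁻¹ * B' * P3 = B3' at *
  generalize B.det = d at *
  have uC : IsUnit (m • B3⁻¹) := Frame.sm_unit hm (Matrix.isUnit_nonsing_inv_iff.2 uB3)
  have uC' : IsUnit (m' • B3'⁻¹) := Frame.sm_unit hm' (Matrix.isUnit_nonsing_inv_iff.2 uB3')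
  have hV := S.hst (z ^ a * g ^ b) _ hU
  have hV' := S.hst (z ^ a' * g ^ b') _ hU'
  have gV := PHO.good_move S.hst S.hc S.e hU hg a b
  have gV' := PHO.good_move S.hst S.hc S.e hU' hg' a' b'
  have hn1 : ∀ x : R, x • (z ^ a * g ^ b) • U ≠ (z ^ a' * g ^ b') • U' := by
    intro x ex
    apply hn ((z ^ a' * g ^ b')⁻¹ * (x * (z ^ a * g ^ b)))
    rw [mul_smul, mul_smul, ex, inv_smul_smul]
  have hn2 : ∀ x : R, x • (z ^ a' * g ^ b') • U' ≠ (z ^ a * g ^ b) • U := by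
    intro x ex
    apply hn1 x⁻¹
    rw [← ex, inv_smul_smul]
  have f := fun i j i' j' => S.b2 F3 hV hV' gV hn1 G uB3 uC G' uB3' uC' (i := i) (j := j)
    (i' := i') (j' := j')
  have f' := fun i j i' j' => S.b2 F3 hV' hV gV' hn2 G' uB3' uC' G uB3 uC (i := i) (j := j)
    (i' := i') (j' := j')
  have hc := F4.all_spec _root_.P2.chk4_true d
  rw [(F4.isO_false _).2 hd0, Bool.false_or, Bool.or_eq_true] at hc
  rcases hc with hc | hc
  · exact hd ((F4.beq_iff _ _).1 hc)
  have hc := F4.all_spec hc m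
  rw [(F4.isO_false _).2 hm, Bool.false_or] at hc
  have hc := M2.all_spec hc (M2.of B3')
  have t1 : F4.beq ((M2.of B3').a.add (M2.of B3').d) F4.i = true := by
    rw [F4.beq_iff]
    rw [Matrix.trace_fin_two] at ht'
    exact ht'
  have t2 : F4.beq (M2.of B3').det F4.i = false := by
    rw [← Bool.not_eq_true, F4.beq_iff, M2.det_of]
    exact hd'
  rw [M2.sg_of uB3', t1, t2] at hc
  simp only [Bool.false_or, Bool.not_true] at hc
  have hc := F4.all_spec hc m'
  rw [(F4.isO_false _).2 hm', Bool.false_or, show F4.i = (1 : F4) from rfl, ← e, ← M2.of_inv,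
    ← M2.of_inv, ← M2.of_smul, ← M2.of_smul] at hc
  change _root_.P2.d2 (_root_.P2.of B3 (m • B3⁻¹)) (_root_.P2.of B3' (m' • B3'⁻¹)) = true at hc
  rw [_root_.P2.d2, _root_.P2.ev_eq, _root_.P2.ev_eq] at hc
  rw [f 0 1 2 2 (by omega), f' 1 0 0 2 (by omega), f' 1 1 0 0 (by omega), f 1 2 1 1 (by omega),
    f 1 1 2 1 (by omega), f 1 0 2 0 (by omega), f 1 0 0 0 (by omega), f' 1 0 2 0 (by omega),
    f' 0 1 0 0 (by omega), f 0 1 2 1 (by omega), f' 1 0 0 0 (by omega), f' 1 2 0 2 (by omega),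
    f 0 1 2 0 (by omega), f' 0 1 2 0 (by omega), f 1 0 1 0 (by omega), f' 1 1 0 1 (by omega),
    f' 1 1 2 0 (by omega), f 1 2 0 2 (by omega), f 0 1 0 2 (by omega), f 1 0 0 1 (by omega)] at hc
  exact absurd hc (by decide)

theorem case1 (S : Cfg O z g c) (F : Frame z g 1 φ)
    (hs : ∀ U ∈ O, ∀ a : F4, ∀ v ∈ U, a • v ∈ U) (z3 : z ^ 3 = 1)
    (hU : U ∈ O) (hU' : U' ∈ O) (hg : PHO.Good z g U) (hg' : PHO.Good z g U')
    (hn : ∀ x : R, x • U ≠ U') :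
    ∃ (a b a' b' : ℕ) (φ : (Fin 2 → F4) →ₗ[F4] V) (C C' : M2.Mat), Frame z g 1 φ ∧
      M2.scal (M2.of C) = false ∧ C * C' = C' * C ∧
      Gr g φ ((z ^ a * g ^ b) • U) 1 C ∧ Gr g φ ((z ^ a' * g ^ b') • U') 1 C' := by
  have hz : ∀ U : AddSubgroup V, PHO.Good z g U → z • U ≠ U := fun U hg e => by
    have := (hg 1 0 (by simpa using e)).1
    omega
  obtain ⟨B, C, uB, uC, G⟩ := F.exists_gr S.pho S.hst hs (by norm_num) hU z3 (hz U hg)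
  obtain ⟨P1, hP1, a, b, C, uC, hC, G⟩ := S.norm1 F hU hg G uB uC
  obtain ⟨F1, -⟩ := F.change hP1
  obtain ⟨B', C', uB', uC', G'⟩ := F1.exists_gr S.pho S.hst hs (by norm_num) hU' z3 (hz U' hg')
  obtain ⟨P2, hP2, a', b', C', uC', hC', G'⟩ := S.norm1 F1 hU' hg' G' uB' uC'
  obtain ⟨F2, hF2⟩ := F1.change hP2
  have G := hF2 _ _ _ G
  have uC := conj_unit hP2 uC
  have hC := conj_scal hP2 hC
  rw [conj_one hP2] at G
  generalize P2⁻¹ * C * P2 = C at *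
  obtain ⟨P3, hP3, e⟩ := M2.rational C hC
  obtain ⟨F3, hF3⟩ := F2.change hP3
  have G := hF3 _ _ _ G
  have G' := hF3 _ _ _ G'
  have uC3 := conj_unit hP3 uC
  have uC3' := conj_unit hP3 uC'
  have hC3 := conj_scal hP3 hC
  rw [conj_one hP3] at G G'
  have hd0 : C.det ≠ 0 := ((Matrix.isUnit_iff_isUnit_det C).1 uC).ne_zero
  generalize P3⁻¹ * C * P3 = C3 at *
  generalize P3⁻¹ * C' * P3 = C3' at *
  refine ⟨a, b, a', b', _, C3, C3', F3, hC3, ?_, G, G'⟩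
  have hV := S.hst (z ^ a * g ^ b) _ hU
  have hV' := S.hst (z ^ a' * g ^ b') _ hU'
  have gV := PHO.good_move S.hst S.hc S.e hU hg a b
  have gV' := PHO.good_move S.hst S.hc S.e hU' hg' a' b'
  have hn1 : ∀ x : R, x • (z ^ a * g ^ b) • U ≠ (z ^ a' * g ^ b') • U' := by
    intro x ex
    apply hn ((z ^ a' * g ^ b')⁻¹ * (x * (z ^ a * g ^ b)))
    rw [mul_smul, mul_smul, ex, inv_smul_smul]
  have hn2 : ∀ x : R, x • (z ^ a' * g ^ b') • U' ≠ (z ^ a * g ^ b) • U := by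
    intro x ex
    apply hn1 x⁻¹
    rw [← ex, inv_smul_smul]
  have u1 : IsUnit (1 : M2.Mat) := isUnit_one
  have f := fun i j i' j' => S.b2 F3 hV hV' gV hn1 G u1 uC3 G' u1 uC3' (i := i) (j := j)
    (i' := i') (j' := j')
  have f' := fun i j i' j' => S.b2 F3 hV' hV gV' hn2 G' u1 uC3' G u1 uC3 (i := i) (j := j)
    (i' := i') (j' := j')
  have k := S.b1 F3 hV' gV' G' u1 uC3' (i := 0) (j := 1) (i' := 1) (j' := 2) (by omega) (by omega)
    (by omega)
  have hc := F4.all_spec _root_.P2.chk3_true C.det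
  rw [(F4.isO_false _).2 hd0, Bool.false_or] at hc
  have hc := M2.all_spec (F4.all_spec hc (C 0 0 + C 1 1)) (M2.of C3')
  rw [← e] at hc
  change (M2.sg (M2.of C3') || _root_.P2.b1 1 (_root_.P2.of 1 C3') 0 1 1 2 ||
    _root_.P2.b2 1 (_root_.P2.of 1 C3) (_root_.P2.of 1 C3') 0 1 0 0 ||
    _root_.P2.b2 1 (_root_.P2.of 1 C3) (_root_.P2.of 1 C3') 1 1 0 2 ||
    _root_.P2.b2 1 (_root_.P2.of 1 C3) (_root_.P2.of 1 C3') 1 2 0 2 ||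
    _root_.P2.b2 1 (_root_.P2.of 1 C3) (_root_.P2.of 1 C3') 0 1 1 0 ||
    _root_.P2.b2 1 (_root_.P2.of 1 C3') (_root_.P2.of 1 C3) 0 1 1 0 ||
    M2.beq ((M2.of C3).mul (M2.of C3')) ((M2.of C3').mul (M2.of C3))) = true at hc
  rw [M2.sg_of uC3', k, f 0 1 0 0 (by omega), f 1 1 0 2 (by omega), f 1 2 0 2 (by omega),
    f 0 1 1 0 (by omega), f' 0 1 1 0 (by omega)] at hc
  simp only [Bool.false_or] at hc
  rw [M2.beq_iff, ← M2.of_mul, ← M2.of_mul] at hc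
  exact M2.of_inj hc
end Cfg

end PartG4

section PartG5
open scoped Pointwise
open Matrix

/-- module structure over F4 from a fixed point free element of order three -/
@[reducible] def F4.module {X R : Type*} [AddCommGroup X] [Group R] [DistribMulAction R X] (c : R)
    (h2 : ∀ x : X, x + x = 0) (h : ∀ x : X, x + c • x + c • c • x = 0)
    (k3 : ∀ x : X, c • c • c • x = x) : Module F4 X where
  smul a x := match a with
    | o => 0
    | i => x
    | w => c • x
    | v => c • c • x
  one_smul _ := rfl
  smul_zero a := by
    cases a
    · rfl
    · rfl
    · exact smul_zero c
    · change c • c • (0 : X) = 0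
      rw [smul_zero, smul_zero]
  smul_add a x y := by
    cases a
    · exact (add_zero (0 : X)).symm
    · rfl
    · exact smul_add c x y
    · change c • c • (x + y) = c • c • x + c • c • y
      rw [smul_add, smul_add]
  zero_smul _ := rfl
  add_smul a b x := by
    have hk : x = c • x + c • c • x := by
      have h1 := h x
      rw [add_assoc] at h1
      have h3 : x + (c • x + c • c • x) + (c • x + c • c • x) = c • x + c • c • x := by
        rw [h1, zero_add]
      rwa [add_assoc, h2, add_zero] at h3
    have k1 : c • x = x + c • c • x := by
      nth_rw 2 [hk]; rw [add_assoc, h2, add_zero]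
    have k2 : c • c • x = x + c • x := by
      nth_rw 2 [hk]; rw [add_comm (c • x), add_assoc, h2, add_zero]
    cases a <;> cases b
    · exact (add_zero (0 : X)).symm
    · exact (zero_add _).symm
    · exact (zero_add _).symm
    · exact (zero_add _).symm
    · exact (add_zero _).symm
    · exact (h2 _).symm
    · exact k2
    · exact k1
    · exact (add_zero _).symm
    · exact k2.trans (add_comm _ _)
    · exact (h2 _).symm
    · exact hk
    · exact (add_zero _).symm
    · exact k1.trans (add_comm _ _)
    · exact hk.trans (add_comm _ _)
    · exact (h2 _).symm
  mul_smul a b x := by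
    cases a <;> cases b
    · rfl
    · rfl
    · rfl
    · rfl
    · rfl
    · rfl
    · rfl
    · rfl
    · exact (smul_zero c).symm
    · rfl
    · rfl
    · exact (k3 x).symm
    · change (0 : X) = c • c • (0 : X)
      rw [smul_zero, smul_zero]
    · rfl
    · exact (k3 x).symm
    · change c • x = c • c • c • c • x
      rw [k3]

section
variable {V : Type*} [AddCommGroup V] {R : Type*} [Group R] [DistribMulAction R V] [Module F4 V]

theorem F4.smul_comm' {c r : R} (hw : ∀ v : V, F4.w • v = c • v) (hr : r * c = c * r) (a : F4)
    (v : V) : r • a • v = a • r • v := by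
  have hk : ∀ v : V, r • c • v = c • r • v := fun v => by rw [← mul_smul, hr, mul_smul]
  have hv : ∀ v : V, F4.v • v = c • c • v := fun v => by
    rw [← hw, ← hw]; exact mul_smul F4.w F4.w v
  cases a
  · change r • (0 : F4) • v = (0 : F4) • r • v
    rw [zero_smul, zero_smul, smul_zero]
  · change r • (1 : F4) • v = (1 : F4) • r • v
    rw [one_smul, one_smul]
  · rw [hw, hw, hk]
  · rw [hv, hv, hk, hk]

theorem exists_frame {z g c : R} {l : F4} (hw : ∀ v : V, F4.w • v = c • v) (hz : z * c = c * z)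
    (hg : g * c = c * g) (e : z * g = c * g * z) (hV : Nat.card V = 2 ^ 12)
    (hX : Nat.card (PHO.fx V z) = 16) (hl : (g ^ 3 = 1 ∧ l = 1) ∨ (g ^ 3 = c ∧ l = F4.w)) :
    ∃ φ : (Fin 2 → F4) →ₗ[F4] V, Frame z g l φ := by
  have zs := F4.smul_comm' hw hz
  have gs := F4.smul_comm' hw hg
  have zg : ∀ v : V, z • g • v = F4.w • g • z • v := fun v => by
    rw [hw, ← mul_smul, e, mul_smul, mul_smul]
  let X : Submodule F4 V :=
    { PHO.fx V z with
      smul_mem' := fun a v hv => by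
        change z • v = v at hv
        change z • a • v = a • v
        rw [zs, hv] }
  have hfinV : Finite V := Nat.finite_of_card_ne_zero (by rw [hV]; norm_num)
  have hfd : Module.Finite F4 X := Module.Finite.of_finite
  have hX' : Nat.card X = 16 := hX
  have hr : Module.finrank F4 X = 2 := by
    have := Module.natCard_eq_pow_finrank (K := F4) (V := X)
    rw [hX', Nat.card_eq_fintype_card, show Fintype.card F4 = 4 from rfl] at this
    have h8 : 4 ^ 2 = 4 ^ Module.finrank F4 X := by rw [← this]; norm_num
    exact (Nat.pow_right_injective (by norm_num : 2 ≤ 4) h8).symm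
  let b := Module.finBasisOfFinrankEq F4 X hr
  let φ : (Fin 2 → F4) →ₗ[F4] V := X.subtype ∘ₗ b.equivFun.symm.toLinearMap
  have hφ : Function.Injective φ := X.injective_subtype.comp b.equivFun.symm.injective
  have hfx : ∀ x, z • φ x = φ x := fun x => (b.equivFun.symm x).2
  have piz : ∀ x y u, z • phpi g φ x y u = phpi g φ x (F4.w • y) (F4.v • u) := by
    intro x y u
    have e : F4.v • g • g • φ u = F4.w • F4.w • g • g • φ u := mul_smul F4.w F4.w _
    simp only [phpi, map_smul, gs, smul_add, zg, hfx, e]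
  have hinj : ∀ x y u, phpi g φ x y u = 0 → x = 0 ∧ y = 0 ∧ u = 0 := by
    intro x y u h0
    have h1 : phpi g φ x (F4.w • y) (F4.v • u) = 0 := by rw [← piz, h0, smul_zero]
    have h2 : phpi g φ x (F4.v • y) (F4.w • u) = 0 := by
      have := piz x (F4.w • y) (F4.v • u)
      rw [h1, smul_zero, smul_smul, smul_smul] at this
      exact this.symm
    have hx : x = 0 := by
      apply hφ
      rw [map_zero]
      have h3 : phpi g φ (x + x + x) (y + F4.w • y + F4.v • y) (u + F4.v • u + F4.w • u) = 0 := by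
        rw [Frame.pi_add, Frame.pi_add, h0, h1, h2, add_zero, add_zero]
      have e2 : u + F4.v • u + F4.w • u = 0 := by rw [add_right_comm]; exact Frame.one_w_v u
      rw [Frame.one_w_v, e2, F4.two, zero_add] at h3
      simpa [phpi] using h3
    subst hx
    have hy : y = 0 := by
      apply hφ
      rw [map_zero]
      have h3 : phpi g φ (0 + 0) (F4.w • y + F4.v • y) (F4.v • (u + u)) = 0 := by
        have e1 : F4.v • phpi g φ 0 y u = phpi g φ 0 (F4.v • y) (F4.v • u) := by
          simp only [phpi, map_smul, gs, smul_add, map_zero, smul_zero]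
        rw [smul_add, Frame.pi_add, h1, ← e1, h0, smul_zero, add_zero]
      have e3 : F4.w • y + F4.v • y = y := by rw [← add_smul]; exact one_smul F4 y
      rw [add_zero, e3, F4.two u, smul_zero] at h3
      have : g • φ y = 0 := by simpa [phpi] using h3
      exact (smul_eq_zero_iff_eq g).1 this
    subst hy
    refine ⟨rfl, rfl, hφ ?_⟩
    have : g • g • φ u = 0 := by simpa [phpi, smul_smul] using h0
    rw [map_zero]
    exact (smul_eq_zero_iff_eq g).1 ((smul_eq_zero_iff_eq g).1 this)
  let pp : (Fin 2 → F4) × (Fin 2 → F4) × (Fin 2 → F4) →+ V :=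
    { toFun := fun p => phpi g φ p.1 p.2.1 p.2.2
      map_zero' := Frame.pi_zero
      map_add' := fun p q => Frame.pi_add _ _ _ _ _ _ }
  have pinj : Function.Injective pp := by
    rw [injective_iff_map_eq_zero]
    rintro ⟨x, y, u⟩ h0
    obtain ⟨h1, h2, h3⟩ := hinj x y u h0
    rw [h1, h2, h3]; rfl
  have cX : Nat.card (Fin 2 → F4) = 16 := by
    simp [Nat.card_eq_fintype_card]; rfl
  have psurj : Function.Surjective pp :=
    (Nat.bijective_iff_injective_and_card pp).2 ⟨pinj, by
      rw [Nat.card_prod, Nat.card_prod, cX, hV]; norm_num⟩ |>.2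
  have ggg : ∀ v : V, g • g • g • v = l • v := by
    intro v
    have : g • g • g • v = g ^ 3 • v := by rw [pow_succ, pow_succ, pow_one, mul_smul, mul_smul]
    rcases hl with ⟨h1, h2⟩ | ⟨h1, h2⟩
    · rw [this, h1, h2, one_smul, one_smul]
    · rw [this, h1, h2, hw]
  refine ⟨φ, zs, gs, zg, ggg, ?_, hfx, hinj, ?_⟩
  · rcases hl with ⟨h1, h2⟩ | ⟨h1, h2⟩ <;> rw [h2] <;> decide
  · intro v
    obtain ⟨p, hp⟩ := psurj v
    exact ⟨p.1, p.2.1, p.2.2, hp.symm⟩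

theorem Frame.exists_kappa {z g : R} {l : F4} {φ : (Fin 2 → F4) →ₗ[F4] V} (F : Frame z g l φ)
    (C : M2.Mat) : ∃ κ : AddMonoid.End V, (∀ x y u, κ (phpi g φ x y u) =
      phpi g φ (C *ᵥ x) (C *ᵥ y) (C *ᵥ u)) ∧ (∀ v, κ (z • v) = z • κ v) ∧
      ∀ v, κ (g • v) = g • κ v := by
  choose p q r hv using F.surj
  have hk : ∀ x y u, p (phpi g φ x y u) = x ∧ q (phpi g φ x y u) = y ∧ r (phpi g φ x y u) = u :=
    fun x y u => F.pi_inj (hv (phpi g φ x y u)).symm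
  let k : V → V := fun v => phpi g φ (C *ᵥ p v) (C *ᵥ q v) (C *ᵥ r v)
  have kk : ∀ x y u, k (phpi g φ x y u) = phpi g φ (C *ᵥ x) (C *ᵥ y) (C *ᵥ u) := fun x y u => by
    obtain ⟨h1, h2, h3⟩ := hk x y u
    simp only [k, h1, h2, h3]
  refine ⟨AddMonoidHom.mk' k ?_, kk, ?_, ?_⟩
  · intro a b
    rw [hv a, hv b, ← pi_add, kk, kk, kk, ← pi_add, mulVec_add, mulVec_add, mulVec_add]
  · intro v
    change k (z • v) = z • k v
    rw [hv v, F.pi_z, kk, kk, F.pi_z, mulVec_smul, mulVec_smul]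
  · intro v
    change k (g • v) = g • k v
    rw [hv v, F.pi_g, kk, kk, F.pi_g, mulVec_smul]

theorem Frame.kappa_gr {z g : R} {l : F4} {φ : (Fin 2 → F4) →ₗ[F4] V} (F : Frame z g l φ)
    {C C' : M2.Mat} (hC : C * C' = C' * C) {κ : AddMonoid.End V} (hk : ∀ x y u, κ (phpi g φ x y u) =
      phpi g φ (C *ᵥ x) (C *ᵥ y) (C *ᵥ u)) {U : AddSubgroup V} (G : Gr g φ U 1 C') :
    ∀ v ∈ U, κ v ∈ U := by
  intro v hv
  obtain ⟨x, y, u, rfl⟩ := F.surj v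
  obtain ⟨h1, h2⟩ := (G _ _ _).1 hv
  rw [hk, G, h1, h2, one_mulVec, one_mulVec, mulVec_mulVec, mulVec_mulVec, hC]
  exact ⟨rfl, rfl⟩

theorem stable_smul {κ : AddMonoid.End V} {x : R} (hx : ∀ v, κ (x • v) = x • κ v)
    {U : AddSubgroup V} (h : ∀ v ∈ U, κ v ∈ U) : ∀ v ∈ x • U, κ v ∈ x • U := by
  intro v hv
  rw [AddSubgroup.mem_smul_pointwise_iff_exists] at hv
  obtain ⟨u, hu, rfl⟩ := hv
  rw [hx]
  exact AddSubgroup.smul_mem_pointwise_smul _ _ _ (h u hu)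
end

theorem comm_mul {V : Type*} [AddCommGroup V] {R : Type*} [Group R] [DistribMulAction R V]
    {κ : AddMonoid.End V} {z g : R} (hz : ∀ v, κ (z • v) = z • κ v) (hg : ∀ v, κ (g • v) = g • κ v)
    (a b : ℕ) : (∀ v, κ ((z ^ a * g ^ b) • v) = (z ^ a * g ^ b) • κ v) ∧
      ∀ v, κ ((z ^ a * g ^ b)⁻¹ • v) = (z ^ a * g ^ b)⁻¹ • κ v := by
  let S : Subgroup R :=
    { carrier := {x | ∀ v, κ (x • v) = x • κ v}
      mul_mem' := fun {a b} ha hb v => by rw [mul_smul, ha, hb, mul_smul]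
      one_mem' := fun v => by rw [one_smul, one_smul]
      inv_mem' := fun {a} ha v => by
        rw [eq_inv_smul_iff, ← ha, smul_inv_smul] }
  have hz' : z ∈ S := hz
  have hg' : g ∈ S := hg
  have h : z ^ a * g ^ b ∈ S := mul_mem (pow_mem hz' a) (pow_mem hg' b)
  exact ⟨h, inv_mem h⟩

namespace PHO
theorem core_four_aux {V R : Type*} [AddCommGroup V] [Group R] [DistribMulAction R V] [FaithfulSMul R V]
    {O : Set (AddSubgroup V)} (h : PHO 4 O) (hK : Nat.card (PHK O) ≤ 4) (hp : IsPGroup 3 R)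
    (hst : ∀ g : R, ∀ U ∈ O, g • U ∈ O)
    (horb : ∀ U ∈ O, (MulAction.orbit R U).ncard = 9) : False := by
  obtain ⟨z, g, c, z3, hg3, hc, hc1, e, U1, h1, U2, h2, g1, g2, hn, hex⟩ :=
    h.group_part hK hp hst horb
  have hcen := h.ker_central hK hp hst hc
  have hc3 := h.ker_cube hK hp hc
  have k3 : ∀ v : V, c • c • c • v = v := fun v => by
    rw [← mul_smul, ← mul_smul, ← pow_three', hc3, one_smul]
  have ksum : ∀ v : V, v + c • v + c • c • v = 0 := fun v => by
    refine h.ker_fpf hc hc1 ?_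
    rw [smul_add, smul_add, k3]
    abel
  letI : Module F4 V := F4.module c h.two ksum k3
  have hw : ∀ v : V, F4.w • v = c • v := fun v => rfl
  have hs : ∀ U ∈ O, ∀ a : F4, ∀ v ∈ U, a • v ∈ U := by
    have hcU : ∀ U ∈ O, ∀ v ∈ U, c • v ∈ U := fun U hU v hv => toEnd_mem hc U hU v hv
    intro U hU a v hv
    cases a
    · exact U.zero_mem
    · exact hv
    · exact hcU U hU v hv
    · exact hcU U hU _ (hcU U hU v hv)
  have hzU : z • U1 ≠ U1 := fun e => by
    have := (g1 1 0 (by simpa using e)).1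
    omega
  have hX : Nat.card (fx V z) = 16 := by
    rw [h.K1 hst z3 h1 hzU]; norm_num
  have S : Cfg O z g c := ⟨h, hst, hc, e⟩
  rcases hg3 with hg3 | hg3
  · obtain ⟨φ, F⟩ := exists_frame (l := 1) hw (hcen z) (hcen g) e h.cardV hX (Or.inl ⟨hg3, rfl⟩)
    obtain ⟨a, b, a', b', φ, C, C', F, hC, hcom, G1, G2⟩ := S.case1 F hs z3 h1 h2 g1 g2 hn
    obtain ⟨κ, hk, hkz, hkg⟩ := F.exists_kappa C
    have s1 := F.kappa_gr (rfl : C * C = C * C) hk G1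
    have s2 := F.kappa_gr hcom hk G2
    have s1' := stable_smul (comm_mul hkz hkg a b).2 s1
    have s2' := stable_smul (comm_mul hkz hkg a' b').2 s2
    rw [inv_smul_smul] at s1' s2'
    have hκ : κ ∈ PHK O := by
      intro W hW
      obtain ⟨i, j, rfl | rfl⟩ := hex W hW
      · exact stable_smul (comm_mul hkz hkg i j).1 s1'
      · exact stable_smul (comm_mul hkz hkg i j).1 s2'
    let s : F4 → AddMonoid.End V := fun a => DistribSMul.toAddMonoidHom V a
    have hsm : ∀ a, s a ∈ PHK O := fun a U hU v hv => hs U hU a v hv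
    have hne : ∀ a, s a ≠ κ := by
      intro a ea
      have : C = a • (1 : M2.Mat) := by
        refine Matrix.ext_of_mulVec_single ?_
        intro i
        have e1 := DFunLike.congr_fun ea (phpi g φ (Pi.single i 1) 0 0)
        have e2 : s a (phpi g φ (Pi.single i 1) 0 0) = phpi g φ (a • Pi.single i 1) (a • 0) (a • 0) :=
          (F.pi_smul a _ _ _).symm
        rw [e2, hk] at e1
        rw [smul_mulVec, one_mulVec]
        exact (F.pi_inj e1).1.symm
      rw [this, M2.of_scal] at hC
      cases a <;> exact absurd hC (by decide)
    obtain ⟨v, -, hv0⟩ := h.exists_nz h1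
    have hsi : Function.Injective s := by
      intro a b eab
      by_contra hab
      have e1 : a • v = b • v := DFunLike.congr_fun eab v
      have e2 : (a - b) • v = 0 := by rw [sub_smul, e1, sub_self]
      rcases smul_eq_zero.1 e2 with e3 | e3
      · exact hab (sub_eq_zero.1 e3)
      · exact hv0 e3
    have := h.card_le_of_list [κ, s F4.o, s F4.i, s F4.w, s F4.v] (by
      simp [(hne _).symm, hsi.eq_iff]) (by
      intro k hk
      simp only [List.mem_cons, List.not_mem_nil, or_false] at hk
      rcases hk with rfl | rfl | rfl | rfl | rfl
      · exact hκ
      all_goals exact hsm _)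
    simp at this
    omega
  · obtain ⟨φ, F⟩ := exists_frame (l := F4.w) hw (hcen z) (hcen g) e h.cardV hX (Or.inr ⟨hg3, rfl⟩)
    exact S.case2 F hs z3 h1 h2 g1 g2 hn

theorem core_four {V G : Type*} [AddCommGroup V] [Group G] [DistribMulAction G V] [FaithfulSMul G V]
    {O : Set (AddSubgroup V)} (h : PHO 4 O) (hst : ∀ g : G, ∀ U ∈ O, g • U ∈ O)
    (htr : ∀ U ∈ O, ∀ U' ∈ O, ∃ g : G, g • U = U') : 2 ^ 4 < Nat.card (PHK O) ^ 2 := by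
  by_contra hcon
  have hK : Nat.card (PHK O) ≤ 4 := by
    by_contra! h5
    apply hcon
    nlinarith
  obtain ⟨P⟩ : Nonempty (Sylow 3 G) := inferInstance
  have horb := h.sylow_orbits hst htr P
  have hp : IsPGroup 3 P := P.2
  have hst' : ∀ g : P, ∀ U ∈ O, g • U ∈ O := fun g U hU => hst g U hU
  exact core_four_aux h hK hp hst' horb

theorem core {V G : Type*} [AddCommGroup V] [Group G] [DistribMulAction G V] [FaithfulSMul G V]
    {m : ℕ} {O : Set (AddSubgroup V)} (h : PHO m O) (hst : ∀ g : G, ∀ U ∈ O, g • U ∈ O)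
    (htr : ∀ U ∈ O, ∀ U' ∈ O, ∃ g : G, g • U = U') : 2 ^ m < Nat.card (PHK O) ^ 2 := by
  by_cases h5 : 5 ≤ m
  · exact (h.big_false h5 hst htr).elim
  · have := h.pos
    have hm : m = 1 ∨ m = 2 ∨ m = 3 ∨ m = 4 := by omega
    rcases hm with rfl | rfl | rfl | rfl
    · exact h.core_one
    · exact h.core_two
    · exact h.core_three
    · exact h.core_four hst htr
end PHO

end PartG5

open scoped Pointwise in
theorem pseudo_hyperoval_irreducible_transitive_is_elementary
    {F V : Type*} [Field F] [Fintype F] [AddCommGroup V] [Module F V]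
    {f n : ℕ} (hf : 1 ≤ f) (hn : 1 ≤ n)
    (hF : Fintype.card F = 2 ^ f)
    (hV : Module.finrank F V = 3 * n)
    (O : Set (Submodule F V))
    (hOdim : ∀ U ∈ O, Module.finrank F U = n)
    (hOcard : O.ncard = (2 ^ f) ^ n + 2)
    (hOspan : ∀ U₁ ∈ O, ∀ U₂ ∈ O, ∀ U₃ ∈ O,
      U₁ ≠ U₂ → U₁ ≠ U₃ → U₂ ≠ U₃ → U₁ ⊔ U₂ ⊔ U₃ = ⊤)
    (G : Subgroup (V ≃ₗ[F] V))
    (hirr : ∀ W : Submodule F V,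
      (∀ g ∈ G, W.map (g : V ≃ₗ[F] V).toLinearMap = W) → W = ⊥ ∨ W = ⊤)
    (hstab : ∀ g ∈ G, ∀ U ∈ O, U.map (g : V ≃ₗ[F] V).toLinearMap ∈ O)
    (htrans : ∀ U ∈ O, ∀ U' ∈ O,
      ∃ g ∈ G, U.map (g : V ≃ₗ[F] V).toLinearMap = U') :
    ∃ K : Subalgebra F (Module.End F V), IsField K ∧
      Nat.card K = (2 ^ f) ^ n ∧
      ∀ k ∈ K, ∀ U ∈ O, ∀ v ∈ U, k v ∈ U := by
  have hfd : Module.Finite F V := Module.finite_of_finrank_pos (by omega)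
  have hfinV : Finite V := Module.finite_of_finite F
  have hinj : Function.Injective (Submodule.toAddSubgroup : Submodule F V → AddSubgroup V) :=
    Submodule.toAddSubgroup_injective
  have hcF : Nat.card F = 2 ^ f := by rw [Nat.card_eq_fintype_card, hF]
  have hchar : (2 : F) = 0 := by
    have hp : CharP F (ringChar F) := ringChar.charP F
    obtain ⟨n, hpr, hn'⟩ := FiniteField.card F (ringChar F)
    rw [hF] at hn'
    have h2 : ringChar F ∣ 2 ^ f := by rw [hn']; exact dvd_pow_self _ n.2.ne'
    have h3 : ringChar F = 2 := (Nat.prime_dvd_prime_iff_eq hpr Nat.prime_two).1 (hpr.dvd_of_dvd_pow h2)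
    have := ringChar.Nat.cast_ringChar (R := F)
    rw [h3] at this
    exact_mod_cast this
  let O' : Set (AddSubgroup V) := Submodule.toAddSubgroup '' O
  have hP : PHO (f * n) O' := by
    refine ⟨?_, hfinV, Nat.mul_pos hf hn, ?_, ?_, ?_, ?_⟩
    · intro v
      rw [← two_smul F v, hchar, zero_smul]
    · rw [Module.natCard_eq_pow_finrank (K := F), hcF, hV, ← pow_mul]; congr 1; ring
    · rintro _ ⟨U, hU, rfl⟩
      change Nat.card U = _
      rw [Module.natCard_eq_pow_finrank (K := F), hcF, hOdim U hU, ← pow_mul]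
    · rw [Set.ncard_image_of_injective _ hinj, hOcard, ← pow_mul]
    · rintro _ ⟨U, hU, rfl⟩ _ ⟨U', hU', rfl⟩ _ ⟨U'', hU'', rfl⟩ h1 h2 h3
      rw [← Submodule.sup_toAddSubgroup, ← Submodule.sup_toAddSubgroup,
        hOspan U hU U' hU' U'' hU'' (fun e => h1 (by rw [e])) (fun e => h2 (by rw [e]))
          (fun e => h3 (by rw [e])), Submodule.top_toAddSubgroup]
  have hmap : ∀ (g : G) (U : Submodule F V),
      g • U.toAddSubgroup = (U.map (g : V ≃ₗ[F] V).toLinearMap).toAddSubgroup := by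
    intro g U
    ext v
    exact Iff.rfl
  have hc : Nat.card (PHK O') = 2 ^ (f * n) := by
    apply hP.card_eq
    apply PHO.core (G := G) hP
    · rintro g _ ⟨U, hU, rfl⟩
      exact (congrArg (· ∈ O') (hmap g U)).mpr ⟨_, hstab g g.2 U hU, rfl⟩
    · rintro _ ⟨U, hU, rfl⟩ _ ⟨U', hU', rfl⟩
      obtain ⟨g, hg, e⟩ := htrans U hU U' hU'
      refine ⟨⟨g, hg⟩, ?_⟩
      exact (hmap ⟨g, hg⟩ U).trans (congrArg _ e)
  have hfield := hP.isField
  let K : Subalgebra F (Module.End F V) :=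
    { carrier := {k | ∀ U ∈ O, ∀ v ∈ U, k v ∈ U}
      mul_mem' := fun ha hb U hU u hu => ha U hU _ (hb U hU u hu)
      add_mem' := fun ha hb U hU u hu => U.add_mem (ha U hU u hu) (hb U hU u hu)
      algebraMap_mem' := fun r U hU u hu => U.smul_mem r hu }
  let φ : K →+* PHK O' :=
    { toFun := fun k => ⟨(k : Module.End F V).toAddMonoidHom, by
        rintro _ ⟨U, hU, rfl⟩ u hu
        exact k.2 U hU u hu⟩
      map_one' := rfl
      map_mul' := fun _ _ => rfl
      map_zero' := rfl
      map_add' := fun _ _ => rfl }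
  have hφ : Function.Bijective φ := by
    constructor
    · intro a b hab
      apply Subtype.ext
      ext v
      have := congrArg Subtype.val hab
      exact DFunLike.congr_fun this v
    · rintro ⟨k, hk⟩
      have hlin : ∀ (r : F) (v : V), k (r • v) = r • k v := by
        intro r v
        let s : AddMonoid.End V := DistribSMul.toAddMonoidHom V r
        have hs : s ∈ PHK O' := by
          rintro _ ⟨U, hU, rfl⟩ u hu
          exact U.smul_mem r hu
        have := hfield.mul_comm ⟨k, hk⟩ ⟨s, hs⟩
        have := congrArg Subtype.val this
        exact DFunLike.congr_fun this v
      refine ⟨⟨{ toFun := k, map_add' := map_add k, map_smul' := hlin }, ?_⟩, ?_⟩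
      · intro U hU u hu
        exact hk _ ⟨U, hU, rfl⟩ u hu
      · rfl
  let e : K ≃+* PHK O' := RingEquiv.ofBijective φ hφ
  refine ⟨K, MulEquiv.isField hfield e.toMulEquiv, ?_, fun k hk => hk⟩
  rw [Nat.card_congr e.toEquiv, hc, pow_mul]
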